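/- arXiv:1201.1089 — 7 statements merged into one kernel-verified Lean document; each statement's English description precedes it below -/
import Mathlib

section
/- Let p ≥ 2. Let f and g be real-valued martingales (with respect to the same filtration) such that g is differentially subordinate to f. Then ‖g*‖_p ≤ p·‖f‖_p, i.e. ‖sup_{n≥0}|g_n|‖_{L^p} ≤ p·sup_{n≥0}‖f_n‖_{L^p}. -/
open MeasureTheory

/-- tangent line inequality -/
lemma aux_tangent {a r s : ℝ} (ha : 1 ≤ a) (hr : 0 ≤ r) (hs : 0 ≤ s) :
    r ^ a + a * r ^ (a - 1) * (s - r) ≤ s ^ a := by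
  rcases hr.eq_or_lt with h | hr
  · subst h
    rcases ha.eq_or_lt with h | ha'
    · subst h; simp
    · rw [Real.zero_rpow (by linarith), Real.zero_rpow (by linarith)]
      have := Real.rpow_nonneg hs a
      simpa using this
  · have hb := one_add_mul_self_le_rpow_one_add (s := s / r - 1) (p := a)
      (by have := div_nonneg hs hr.le; linarith) ha
    have e : (1 + (s / r - 1)) = s / r := by ring
    rw [e, Real.div_rpow hs hr.le, le_div_iff₀ (Real.rpow_pos_of_pos hr a)] at hb
    have e2 : r ^ a = r ^ (a - 1) * r := by
      rw [← Real.rpow_add_one hr.ne']; congr 1; ring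
    calc r ^ a + a * r ^ (a - 1) * (s - r) = (1 + a * (s / r - 1)) * r ^ a := by
          rw [e2]; field_simp
      _ ≤ _ := hb

/-- second order bound to the left -/
lemma aux_T1 {p r s : ℝ} (hp : 2 ≤ p) (hs : 0 ≤ s) (hsr : s ≤ r) :
    s ^ p ≤ r ^ p + p * r ^ (p - 1) * (s - r) + p * (p - 1) / 2 * r ^ (p - 2) * (s - r) ^ 2 := by
  have hr : 0 ≤ r := hs.trans hsr
  let φ : ℝ → ℝ := fun t => r ^ p + p * r ^ (p - 1) * (t - r)
    + p * (p - 1) / 2 * r ^ (p - 2) * (t - r) ^ 2 - t ^ p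
  have hd : ∀ t, HasDerivAt φ (p * r ^ (p - 1) + p * (p - 1) * r ^ (p - 2) * (t - r)
      - p * t ^ (p - 1)) t := by
    intro t
    have h1 := (((hasDerivAt_id t).sub_const r).const_mul (p * r ^ (p - 1))).const_add (r ^ p)
    have h2 := (((hasDerivAt_id t).sub_const r).pow 2).const_mul (p * (p - 1) / 2 * r ^ (p - 2))
    have h3 := Real.hasDerivAt_rpow_const (x := t) (p := p) (Or.inr (by linarith))
    refine ((h1.add h2).sub h3).congr_deriv ?_
    simp; ring
  have hanti : AntitoneOn φ (Set.Icc 0 r) := by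
    apply antitoneOn_of_deriv_nonpos (convex_Icc 0 r)
    · exact fun t _ => (hd t).continuousAt.continuousWithinAt
    · exact fun t _ => (hd t).differentiableAt.differentiableWithinAt
    · intro t ht
      rw [interior_Icc] at ht
      rw [(hd t).deriv]
      have := aux_tangent (a := p - 1) (r := r) (s := t) (by linarith) hr ht.1.le
      rw [show p - 1 - 1 = p - 2 by ring] at this
      nlinarith
  have := hanti ⟨hs, hsr⟩ ⟨hr, le_rfl⟩ hsr
  simp only [φ] at this
  simp at this
  linarith

/-- trapezoid rule -/
lemma aux_T2 {p r s : ℝ} (hp : 2 ≤ p) (hr : 0 ≤ r) (hrs : r ≤ s) :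
    s ^ p - r ^ p ≤ p * (s - r) * (s ^ (p - 1) + r ^ (p - 1)) / 2 := by
  let φ : ℝ → ℝ := fun t => p / 2 * ((t - r) * (t ^ (p - 1) + r ^ (p - 1))) - t ^ p
  have hd : ∀ t, HasDerivAt φ (p / 2 * ((t ^ (p - 1) + r ^ (p - 1)) +
      (t - r) * ((p - 1) * t ^ (p - 2))) - p * t ^ (p - 1)) t := by
    intro t
    have h2 := (hasDerivAt_id t).sub_const r
    have h4 := (Real.hasDerivAt_rpow_const (x := t) (p := p - 1) (Or.inr (by linarith))).add_const
      (r ^ (p - 1))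
    have h3 := Real.hasDerivAt_rpow_const (x := t) (p := p) (Or.inr (by linarith))
    refine (((h2.mul h4).const_mul (p / 2)).sub h3).congr_deriv ?_
    rw [show p - 1 - 1 = p - 2 by ring]
    simp
  have hmono : MonotoneOn φ (Set.Ici r) := by
    apply monotoneOn_of_deriv_nonneg (convex_Ici r)
    · exact fun t _ => (hd t).continuousAt.continuousWithinAt
    · exact fun t _ => (hd t).differentiableAt.differentiableWithinAt
    · intro t ht
      rw [interior_Ici] at ht
      have ht : r < t := ht
      rw [(hd t).deriv]
      have := aux_tangent (a := p - 1) (r := t) (s := r) (by linarith) (by linarith) hr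
      rw [show p - 1 - 1 = p - 2 by ring] at this
      nlinarith
  have := hmono (Set.self_mem_Ici) hrs hrs
  simp only [φ] at this
  simp at this
  linarith

lemma aux_alpha {u : ℝ} (hu : 1 ≤ u) : (1 + 1 / u) ^ u ≤ 1 + u := by
  have h0 : 0 < u := by linarith
  have h1 : 0 < 1 + 1 / u := by positivity
  have h2 : (1 + 1 / u) ^ (u - 1) ≤ u := by
    rw [Real.rpow_def_of_pos h1, ← Real.le_log_iff_exp_le h0]
    have a1 := Real.log_le_sub_one_of_pos h1
    have a2 := Real.one_sub_inv_le_log_of_pos h0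
    have : Real.log (1 + 1 / u) * (u - 1) ≤ (1 / u) * (u - 1) :=
      mul_le_mul_of_nonneg_right (by linarith) (by linarith)
    have e : (1 / u) * (u - 1) = 1 - u⁻¹ := by field_simp
    linarith
  calc (1 + 1 / u) ^ u = (1 + 1 / u) ^ (u - 1) * (1 + 1 / u) := by
        rw [← Real.rpow_add_one h1.ne']; congr 1; ring
    _ ≤ u * (1 + 1 / u) := by gcongr
    _ = 1 + u := by field_simp; ring

lemma aux_chord {p w : ℝ} (hp : 2 ≤ p) (hw : 0 ≤ w) (hw1 : w * (p - 1) ≤ 1) :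
    (1 + w) ^ (p - 1) ≤ 1 + (p - 1) ^ 2 * w := by
  have hp1 : 0 < p - 1 := by linarith
  have hc0 := convexOn_rpow (p := p - 1) (by linarith)
  have hc := hc0.2 (Set.mem_Ici.2 (zero_le_one (α := ℝ)))
    (Set.mem_Ici.2 (by positivity : (0 : ℝ) ≤ 1 + 1 / (p - 1)))
    (by linarith : 0 ≤ 1 - w * (p - 1)) (by positivity : 0 ≤ w * (p - 1)) (by ring)
  have ha := aux_alpha (u := p - 1) (by linarith)
  have hp' : p - 1 ≠ 0 := by linarith
  have e : (1 - w * (p - 1)) • (1 : ℝ) + (w * (p - 1)) • (1 + 1 / (p - 1)) = 1 + w := by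
    simp only [smul_eq_mul]; field_simp; ring
  rw [e] at hc
  simp only [smul_eq_mul, Real.one_rpow] at hc
  have : w * (p - 1) * (1 + 1 / (p - 1)) ^ (p - 1) ≤ w * (p - 1) * (1 + (p - 1)) :=
    mul_le_mul_of_nonneg_left ha (by nlinarith)
  nlinarith

/-- majorization -/
lemma aux_major {p y z : ℝ} (hp : 2 ≤ p) (hy : 0 ≤ y) (hz : 0 ≤ z) :
    y ^ p - z ^ p ≤ p * (y - z) * (y - (y - z) / p) ^ (p - 1) := by
  have hp0 : 0 < p := by linarith
  let K : ℝ → ℝ := fun t => p * ((t - z) * (t - (t - z) / p) ^ (p - 1)) - t ^ p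
  have hd : ∀ t, HasDerivAt K (p * ((t - (t - z) / p) ^ (p - 1) + (t - z) *
     ((1 - 1 / p) * (p - 1) * (t - (t - z) / p) ^ (p - 2))) - p * t ^ (p - 1)) t := by
    intro t
    have h2 := (hasDerivAt_id t).sub_const z
    have h5 := (hasDerivAt_id t).sub (h2.div_const p)
    have h4 := h5.rpow_const (p := p - 1) (Or.inr (by linarith))
    have h3 := Real.hasDerivAt_rpow_const (x := t) (p := p) (Or.inr (by linarith))
    refine (((h2.mul h4).const_mul p).sub h3).congr_deriv ?_
    rw [show p - 1 - 1 = p - 2 by ring]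
    simp
  -- rewriting of the derivative
  have key : ∀ t, 0 < t - (t - z) / p → 0 ≤ t → ∃ w, w = (t - z) / (p * (t - (t - z) / p)) ∧
      0 ≤ 1 + w ∧
      deriv K t = p * (t - (t - z) / p) ^ (p - 1) * (1 + (p - 1) ^ 2 * w - (1 + w) ^ (p - 1)) := by
    intro t hM ht
    have hfr : 1 + (t - z) / (p * (t - (t - z) / p)) = t / (t - (t - z) / p) := by
      rw [← div_div, eq_div_iff hM.ne', add_mul, div_mul_cancel₀ _ hM.ne']; ring
    refine ⟨_, rfl, ?_, ?_⟩
    · rw [hfr]; positivity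
    · rw [(hd t).deriv]
      rw [hfr, Real.div_rpow ht hM.le]
      set M := t - (t - z) / p with hMd
      have e2 : M ^ (p - 1) = M ^ (p - 2) * M := by
        rw [← Real.rpow_add_one hM.ne']; congr 1; ring
      have hpos : M ^ (p - 1) ≠ 0 := (Real.rpow_pos_of_pos hM _).ne'
      have e3 : M ^ (p - 1) * (t ^ (p - 1) / M ^ (p - 1)) = t ^ (p - 1) := by field_simp
      have e4 : M ^ (p - 1) * ((p - 1) ^ 2 * ((t - z) / (p * M)))
        = (t - z) * ((1 - 1 / p) * (p - 1) * M ^ (p - 2)) := by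
        rw [e2]; field_simp
      linear_combination p * e3 - p * e4
  have hMe : ∀ t, t - (t - z) / p = (t * (p - 1) + z) / p := by intro t; field_simp; ring
  have hKz : K z = - z ^ p := by simp [K]
  have fin : K z ≤ K y := by
    rcases le_total z y with h | h
    · have hmono : MonotoneOn K (Set.Ici z) := by
        apply monotoneOn_of_deriv_nonneg (convex_Ici z)
        · exact fun t _ => (hd t).continuousAt.continuousWithinAt
        · exact fun t _ => (hd t).differentiableAt.differentiableWithinAt
        · intro t ht
          rw [interior_Ici] at ht
          have ht : z < t := ht
          have hM : 0 < t - (t - z) / p := by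
            rw [hMe]
            have : 0 < t * (p - 1) := mul_pos (by linarith) (by linarith)
            positivity
          obtain ⟨w, hw, hw1, hD⟩ := key t hM (by linarith)
          rw [hD]
          have hw0 : 0 ≤ w := by
            rw [hw]; exact div_nonneg (by linarith) (by positivity)
          have hw2 : w * (p - 1) ≤ 1 := by
            rw [hw, div_mul_eq_mul_div, div_le_one (by positivity), hMe]
            field_simp
            nlinarith
          have := aux_chord hp hw0 hw2
          exact mul_nonneg (by positivity) (by linarith)
      exact hmono (Set.self_mem_Ici) h h
    · have hanti : AntitoneOn K (Set.Icc 0 z) := by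
        apply antitoneOn_of_deriv_nonpos (convex_Icc 0 z)
        · exact fun t _ => (hd t).continuousAt.continuousWithinAt
        · exact fun t _ => (hd t).differentiableAt.differentiableWithinAt
        · intro t ht
          rw [interior_Icc] at ht
          have hM : 0 < t - (t - z) / p := by
            rw [hMe]
            have : 0 < t * (p - 1) := mul_pos ht.1 (by linarith)
            positivity
          obtain ⟨w, hw, hw1, hD⟩ := key t hM ht.1.le
          rw [hD]
          have hw0 : w ≤ 0 := by
            rw [hw]; exact div_nonpos_of_nonpos_of_nonneg (by linarith [ht.2]) (by positivity)
          have := one_add_mul_self_le_rpow_one_add (s := w) (p := p - 1) (by linarith)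
            (by linarith)
          refine mul_nonpos_of_nonneg_of_nonpos (by positivity) ?_
          nlinarith [mul_nonneg (mul_nonneg (by linarith : 0 ≤ p - 1) (by linarith : 0 ≤ p - 2))
            (by linarith : 0 ≤ -w)]
      exact hanti ⟨hy, h⟩ ⟨hz, le_rfl⟩ h
  rw [hKz] at fin
  simp only [K] at fin
  linarith

/-- Burkholder step inequality in the first quadrant -/
lemma aux_step0 {p x y x' y' : ℝ} (hp : 2 ≤ p) (hx : 0 ≤ x) (hy : 0 ≤ y)
    (h : |y' - y| ≤ |x' - x|) :
    (|x'| + |y'|) ^ p - p * |x'| * (|x'| + |y'|) ^ (p - 1) ≤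
      (x + y) ^ p - p * x * (x + y) ^ (p - 1) + (- (p * (p - 1)) * x * (x + y) ^ (p - 2)) * (x' - x)
       + (p * (x + y) ^ (p - 2) * (y - (p - 2) * x)) * (y' - y) := by
  have hsq : (y' - y) ^ 2 ≤ (x' - x) ^ 2 := sq_le_sq.mpr h
  have ha : 0 ≤ |x'| := abs_nonneg _
  have hb : 0 ≤ |y'| := abs_nonneg _
  have hxa : x' ≤ |x'| := le_abs_self _
  have hya : y' ≤ |y'| := le_abs_self _
  have hxq : x' ^ 2 = |x'| ^ 2 := (sq_abs x').symm
  have hyq : y' ^ 2 = |y'| ^ 2 := (sq_abs y').symm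
  have hlin : |y'| - y ≤ |x'| + x := by
    have h1 := abs_sub_abs_le_abs_sub y' y
    have h2 := abs_sub x' x
    rw [abs_of_nonneg hy] at h1
    rw [abs_of_nonneg hx] at h2
    linarith
  generalize |x'| = a at *
  generalize |y'| = b at *
  obtain ⟨s, hs⟩ : ∃ s, s = a + b := ⟨_, rfl⟩
  obtain ⟨r, hr⟩ : ∃ r, r = x + y := ⟨_, rfl⟩
  rw [← hs, ← hr]
  have hs0 : 0 ≤ s := by linarith
  have hr0 : 0 ≤ r := by linarith
  rcases hr0.eq_or_lt with h0 | hrp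
  · have hx0 : x = 0 := by linarith
    have hy0 : y = 0 := by linarith
    subst hx0 hy0
    rw [← h0, Real.zero_rpow (by linarith), Real.zero_rpow (by linarith)]
    rcases hs0.eq_or_lt with h1 | h1
    · rw [← h1, Real.zero_rpow (by linarith), Real.zero_rpow (by linarith)]; simp
    · have e : s ^ p = s ^ (p - 1) * s := by
        rw [← Real.rpow_add_one h1.ne']; congr 1; ring
      have : 0 ≤ s ^ (p - 1) := by positivity
      rw [e]
      have : 0 ≤ s ^ (p - 1) * (p * a - s) := mul_nonneg this (by nlinarith)
      simp
      linarith
  have e1 : r ^ (p - 1) = r ^ (p - 2) * r := by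
    rw [← Real.rpow_add_one hrp.ne']; congr 1; ring
  have e2 : r ^ p = r ^ (p - 2) * r * r := by
    rw [← e1, ← Real.rpow_add_one hrp.ne']; congr 1; ring
  have hE := aux_tangent (a := p - 1) (r := r) (s := s) (by linarith) hr0 hs0
  rw [show p - 1 - 1 = p - 2 by ring] at hE
  have hρ : 0 ≤ r ^ (p - 2) := by positivity
  -- bracket
  have hbr : (s - r) ^ 2 / 2 + y * (b - y') ≤ (a - x) * (s - r) + x * (a - x') := by
    rw [hs, hr]; nlinarith
  have hbr2 := mul_le_mul_of_nonneg_left hbr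
    (mul_nonneg (mul_nonneg (by linarith : 0 ≤ p) (by linarith : 0 ≤ p - 1)) hρ)
  have hex : 0 ≤ p * r ^ (p - 2) * ((p - 2) * r * (b - y')) := by
    refine mul_nonneg (mul_nonneg (by linarith) hρ) (mul_nonneg (mul_nonneg ?_ hr0) ?_) <;> linarith
  have main : s ^ p - r ^ p - p * r ^ (p - 1) * (s - r) ≤
      p * a * (s ^ (p - 1) - r ^ (p - 1) - (p - 1) * r ^ (p - 2) * (s - r))
       + p * (p - 1) * r ^ (p - 2) * ((s - r) ^ 2 / 2) := by
    rcases le_total s r with hsr | hrs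
    · have := aux_T1 hp hs0 hsr
      have h2 := mul_nonneg (mul_nonneg (by linarith : 0 ≤ p) ha) (sub_nonneg.2 hE)
      linarith
    · have := aux_T2 hp hr0 hrs
      have h3 : (s - r) / 2 ≤ a := by linarith
      have h2 := mul_nonneg (mul_nonneg (by linarith : 0 ≤ p) (sub_nonneg.2 h3)) (sub_nonneg.2 hE)
      linarith
  have hb' : b = s - a := by linarith
  have hy' : y = r - x := by linarith
  rw [e1, e2] at main ⊢
  subst hb' hy'
  nlinarith

/-- Burkholder function and its supergradient -/
noncomputable def auxU (p x y : ℝ) : ℝ := (|x| + |y|) ^ p - p * |x| * (|x| + |y|) ^ (p - 1)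
noncomputable def auxA (p x y : ℝ) : ℝ := -(p * (p - 1)) * x * (|x| + |y|) ^ (p - 2)
noncomputable def auxσ (y : ℝ) : ℝ := if y < 0 then -1 else 1
noncomputable def auxB (p x y : ℝ) : ℝ :=
  auxσ y * (p * (|x| + |y|) ^ (p - 2) * (|y| - (p - 2) * |x|))

lemma auxσ_mul_self (y : ℝ) : auxσ y * y = |y| := by
  unfold auxσ; split_ifs with h
  · rw [abs_of_neg h]; ring
  · rw [abs_of_nonneg (not_lt.1 h)]; ring

lemma auxσ_abs (y : ℝ) : |auxσ y| = 1 := by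
  unfold auxσ; split_ifs <;> simp

lemma auxσ_sq (y : ℝ) : auxσ y * auxσ y = 1 := by
  unfold auxσ; split_ifs <;> simp

lemma auxσ_meas : Measurable auxσ :=
  Measurable.ite measurableSet_Iio measurable_const measurable_const

lemma aux_step {p x y x' y' : ℝ} (hp : 2 ≤ p) (h : |y' - y| ≤ |x' - x|) :
    auxU p x' y' ≤ auxU p x y + auxA p x y * (x' - x) + auxB p x y * (y' - y) := by
  have h1 : auxσ y * y' - |y| = auxσ y * (y' - y) := by rw [← auxσ_mul_self]; ring
  have h2 : auxσ x * x' - |x| = auxσ x * (x' - x) := by rw [← auxσ_mul_self]; ring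
  have := aux_step0 (x := |x|) (y := |y|) (x' := auxσ x * x') (y' := auxσ y * y') hp
    (abs_nonneg _) (abs_nonneg _) (by
      rw [h1, h2, abs_mul, abs_mul, auxσ_abs, auxσ_abs]; simpa using h)
  rw [h1, h2, abs_mul, abs_mul, auxσ_abs, auxσ_abs, one_mul, one_mul] at this
  have h3 : x = auxσ x * |x| := by
    rw [← auxσ_mul_self, ← mul_assoc, auxσ_sq, one_mul]
  have h4 : auxA p x y = -(p * (p - 1)) * (auxσ x * |x|) * (|x| + |y|) ^ (p - 2) := by
    rw [← h3]; rfl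
  rw [h4]; unfold auxU auxB
  linarith

lemma aux_pow_succ {p R : ℝ} (hp : 2 ≤ p) (hR : 0 ≤ R) : R ^ (p - 1) = R ^ (p - 2) * R := by
  rw [← Real.rpow_add_one' hR (by linarith)]; congr 1; ring

lemma aux_pow_succ' {p R : ℝ} (hp : 2 ≤ p) (hR : 0 ≤ R) : R ^ p = R ^ (p - 1) * R := by
  rw [← Real.rpow_add_one' hR (by linarith)]; congr 1; ring

lemma auxA_bound {p x y : ℝ} (hp : 2 ≤ p) : |auxA p x y| ≤ p ^ 2 * (|x| + |y|) ^ (p - 1) := by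
  unfold auxA
  have hx := abs_nonneg x
  have hy := abs_nonneg y
  have hR : 0 ≤ (|x| + |y|) ^ (p - 2) := by positivity
  rw [abs_mul, abs_mul, abs_neg, abs_of_nonneg hR, aux_pow_succ hp (by positivity),
    abs_of_nonneg (by nlinarith : 0 ≤ p * (p - 1))]
  calc p * (p - 1) * |x| * (|x| + |y|) ^ (p - 2)
      ≤ p ^ 2 * (|x| + |y|) * (|x| + |y|) ^ (p - 2) := by
        apply mul_le_mul_of_nonneg_right _ hR
        apply mul_le_mul <;> nlinarith
    _ = _ := by ring

lemma auxB_bound {p x y : ℝ} (hp : 2 ≤ p) : |auxB p x y| ≤ p ^ 2 * (|x| + |y|) ^ (p - 1) := by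
  unfold auxB
  have hx := abs_nonneg x
  have hy := abs_nonneg y
  have hR : 0 ≤ (|x| + |y|) ^ (p - 2) := by positivity
  rw [abs_mul, auxσ_abs, one_mul, abs_mul, abs_mul, abs_of_nonneg hR,
    aux_pow_succ hp (by positivity), abs_of_nonneg (by linarith : 0 ≤ p)]
  have : |(|y| - (p - 2) * |x|)| ≤ p * (|x| + |y|) := by
    rw [abs_le]; constructor <;> nlinarith
  calc p * (|x| + |y|) ^ (p - 2) * |(|y| - (p - 2) * |x|)|
      ≤ p * (|x| + |y|) ^ (p - 2) * (p * (|x| + |y|)) := by gcongr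
    _ = _ := by ring

lemma auxU_major {p x y : ℝ} (hp : 2 ≤ p) :
    |y| ^ p - ((p - 1) * |x|) ^ p ≤ p * ((p - 1) / p) ^ (p - 1) * auxU p x y := by
  have hx := abs_nonneg x
  have hy := abs_nonneg y
  have := aux_major hp hy (mul_nonneg (by linarith : 0 ≤ p - 1) hx)
  have e : |y| - (|y| - (p - 1) * |x|) / p = ((p - 1) / p) * (|x| + |y|) := by
    field_simp; ring
  rw [e, Real.mul_rpow (div_nonneg (by linarith) (by linarith)) (by positivity)] at this
  unfold auxU
  rw [aux_pow_succ' hp (by positivity : 0 ≤ |x| + |y|)]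
  linarith

lemma auxU_nonpos {p x y : ℝ} (hp : 2 ≤ p) (h : |y| ≤ |x|) : auxU p x y ≤ 0 := by
  have hx := abs_nonneg x
  have hy := abs_nonneg y
  unfold auxU
  rw [aux_pow_succ' hp (by positivity : 0 ≤ |x| + |y|)]
  have : 0 ≤ (|x| + |y|) ^ (p - 1) * (p * |x| - (|x| + |y|)) :=
    mul_nonneg (by positivity) (by nlinarith)
  linarith

lemma auxU_meas (p : ℝ) : Measurable (fun z : ℝ × ℝ => auxU p z.1 z.2) := by
  unfold auxU; fun_prop
lemma auxA_meas (p : ℝ) : Measurable (fun z : ℝ × ℝ => auxA p z.1 z.2) := by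
  unfold auxA; fun_prop
lemma auxB_meas (p : ℝ) : Measurable (fun z : ℝ × ℝ => auxB p z.1 z.2) := by
  have := auxσ_meas
  unfold auxB; fun_prop

lemma auxU_bound {p x y : ℝ} (hp : 2 ≤ p) : |auxU p x y| ≤ p * (|x| + |y|) ^ p := by
  have hx := abs_nonneg x
  have hy := abs_nonneg y
  unfold auxU
  rw [aux_pow_succ' hp (by positivity : 0 ≤ |x| + |y|)]
  have h0 : 0 ≤ (|x| + |y|) ^ (p - 1) := by positivity
  have e : (|x| + |y|) ^ (p - 1) * (|x| + |y|) - p * |x| * (|x| + |y|) ^ (p - 1)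
     = (|x| + |y|) ^ (p - 1) * (|y| - (p - 1) * |x|) := by ring
  rw [e, abs_mul, abs_of_nonneg h0]
  have : |(|y| - (p - 1) * |x|)| ≤ p * (|x| + |y|) := by
    rw [abs_le]; constructor <;> nlinarith
  calc _ ≤ (|x| + |y|) ^ (p - 1) * (p * (|x| + |y|)) := by gcongr
    _ = _ := by ring

section prob
variable {Ω : Type*} {m0 : MeasurableSpace Ω} {μ : Measure Ω}

lemma aux_int_pow {p : ℝ} (hp : 2 ≤ p) {S : Ω → ℝ} (hS : MemLp S (ENNReal.ofReal p) μ) :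
    Integrable (fun ω => |S ω| ^ p) μ := by
  have := hS.integrable_norm_rpow (by simp; linarith) (by simp)
  rw [ENNReal.toReal_ofReal (by linarith)] at this
  exact this

lemma aux_int_bound {p C : ℝ} (hp : 2 ≤ p) {S X : Ω → ℝ} (hS : MemLp S (ENNReal.ofReal p) μ)
    (hX : AEStronglyMeasurable X μ) (h : ∀ ω, |X ω| ≤ C * |S ω| ^ p) : Integrable X μ :=
  ((aux_int_pow hp hS).const_mul C).mono' hX (Filter.Eventually.of_forall h)

lemma aux_int_mul {p C : ℝ} (hp : 2 ≤ p) (hC : 0 ≤ C) {S A H : Ω → ℝ}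
    (hS : MemLp S (ENNReal.ofReal p) μ) (hH : MemLp H (ENNReal.ofReal p) μ)
    (hA : AEStronglyMeasurable A μ) (h : ∀ ω, |A ω| ≤ C * |S ω| ^ (p - 1)) :
    Integrable (A * H) μ := by
  have hT := hS.norm.add hH.norm
  refine aux_int_bound (C := C) hp hT (hA.mul hH.1) (fun ω => ?_)
  have hs := abs_nonneg (S ω)
  have hh := abs_nonneg (H ω)
  simp only [Pi.mul_apply, Pi.add_apply, Real.norm_eq_abs]
  rw [abs_mul, abs_of_nonneg (by positivity : 0 ≤ |S ω| + |H ω|),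
    aux_pow_succ' hp (by positivity : 0 ≤ |S ω| + |H ω|), ← mul_assoc]
  refine mul_le_mul ((h ω).trans ?_) (by linarith) hh (by positivity)
  gcongr
  · linarith
  · linarith

variable [IsProbabilityMeasure μ] {𝓕 : Filtration ℕ m0}

lemma aux_mart_zero {h : ℕ → Ω → ℝ} (hh : Martingale h 𝓕 μ) {n : ℕ} {A : Ω → ℝ}
    (hA : StronglyMeasurable[𝓕 n] A) (h1 : Integrable (A * h n) μ)
    (h2 : Integrable (A * h (n + 1)) μ) :
    ∫ ω, A ω * (h (n + 1) ω - h n ω) ∂μ = 0 := by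
  have e : ∫ ω, (A * h (n + 1)) ω ∂μ = ∫ ω, (A * h n) ω ∂μ := by
    rw [← integral_condExp (𝓕.le n)]
    apply integral_congr_ae
    refine (condExp_mul_of_stronglyMeasurable_left hA h2 (hh.integrable _)).trans ?_
    filter_upwards [hh.2 n (n + 1) (by omega)] with ω hω
    simp [hω]
  have : (fun ω => A ω * (h (n + 1) ω - h n ω)) = fun ω => (A * h (n + 1)) ω - (A * h n) ω := by
    ext ω; simp; ring
  rw [this, integral_sub h2 h1, e, sub_self]

lemma aux_burk {f g : ℕ → Ω → ℝ} {p : ℝ} (hp : 2 ≤ p)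
    (hf : Martingale f 𝓕 μ) (hg : Martingale g 𝓕 μ)
    (hsub0 : ∀ᵐ ω ∂μ, |g 0 ω| ≤ |f 0 ω|)
    (hsub : ∀ n : ℕ, ∀ᵐ ω ∂μ, |g (n+1) ω - g n ω| ≤ |f (n+1) ω - f n ω|)
    (hfL : ∀ n, MemLp (f n) (ENNReal.ofReal p) μ) (hgL : ∀ n, MemLp (g n) (ENNReal.ofReal p) μ)
    (n : ℕ) : ∫ ω, |g n ω| ^ p ∂μ ≤ (p - 1) ^ p * ∫ ω, |f n ω| ^ p ∂μ := by
  have hm : ∀ n, Measurable[𝓕 n] (fun ω => (f n ω, g n ω)) := fun n =>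
    (hf.stronglyMeasurable n).measurable.prodMk (hg.stronglyMeasurable n).measurable
  have hS : ∀ n, MemLp (fun ω => |f n ω| + |g n ω|) (ENNReal.ofReal p) μ := fun n =>
    (hfL n).norm.add (hgL n).norm
  have hSa : ∀ n ω, |(|f n ω| + |g n ω|)| = |f n ω| + |g n ω| := fun n ω =>
    abs_of_nonneg (by positivity)
  have hUi : ∀ n, Integrable (fun ω => auxU p (f n ω) (g n ω)) μ := fun n => by
    refine aux_int_bound (C := p) hp (hS n)
      (((auxU_meas p).comp (hm n)).mono (𝓕.le n) le_rfl).aestronglyMeasurable (fun ω => ?_)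
    rw [hSa]; exact auxU_bound hp
  have hAm : ∀ n, StronglyMeasurable[𝓕 n] (fun ω => auxA p (f n ω) (g n ω)) := fun n =>
    ((auxA_meas p).comp (hm n)).stronglyMeasurable
  have hBm : ∀ n, StronglyMeasurable[𝓕 n] (fun ω => auxB p (f n ω) (g n ω)) := fun n =>
    ((auxB_meas p).comp (hm n)).stronglyMeasurable
  have hAi : ∀ n k, Integrable ((fun ω => auxA p (f n ω) (g n ω)) * f k) μ := fun n k => by
    refine aux_int_mul (C := p ^ 2) hp (by positivity) (hS n) (hfL k)
      ((hAm n).mono (𝓕.le n)).aestronglyMeasurable (fun ω => ?_)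
    rw [hSa]; exact auxA_bound hp
  have hBi : ∀ n k, Integrable ((fun ω => auxB p (f n ω) (g n ω)) * g k) μ := fun n k => by
    refine aux_int_mul (C := p ^ 2) hp (by positivity) (hS n) (hgL k)
      ((hBm n).mono (𝓕.le n)).aestronglyMeasurable (fun ω => ?_)
    rw [hSa]; exact auxB_bound hp
  have hU : ∫ ω, auxU p (f n ω) (g n ω) ∂μ ≤ 0 := by
    induction n with
    | zero =>
      apply integral_nonpos_of_ae
      filter_upwards [hsub0] with ω hω using auxU_nonpos hp hω
    | succ n ih =>
      refine le_trans ?_ ih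
      have i1 : Integrable (fun ω => auxA p (f n ω) (g n ω) * (f (n + 1) ω - f n ω)) μ := by
        refine ((hAi n (n + 1)).sub (hAi n n)).congr (Filter.Eventually.of_forall fun ω => ?_)
        simp; ring
      have i2 : Integrable (fun ω => auxB p (f n ω) (g n ω) * (g (n + 1) ω - g n ω)) μ := by
        refine ((hBi n (n + 1)).sub (hBi n n)).congr (Filter.Eventually.of_forall fun ω => ?_)
        simp; ring
      have z1 := aux_mart_zero hf (hAm n) (hAi n n) (hAi n (n + 1))
      have z2 := aux_mart_zero hg (hBm n) (hBi n n) (hBi n (n + 1))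
      have i3 : Integrable (fun ω => auxU p (f n ω) (g n ω) +
          auxA p (f n ω) (g n ω) * (f (n + 1) ω - f n ω)) μ := (hUi n).add i1
      calc _ ≤ ∫ ω, ((auxU p (f n ω) (g n ω) + auxA p (f n ω) (g n ω) * (f (n + 1) ω - f n ω)) +
            auxB p (f n ω) (g n ω) * (g (n + 1) ω - g n ω)) ∂μ := by
            apply integral_mono_ae (hUi _) (i3.add i2)
            filter_upwards [hsub n] with ω hω using aux_step hp hω
        _ = _ := by
            rw [integral_add i3 i2, integral_add (hUi n) i1, z1, z2]; simp
  have hfi := (aux_int_pow hp (hfL n)).const_mul ((p - 1) ^ p)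
  have hgi := aux_int_pow hp (hgL n)
  have h1 : ∫ ω, (|g n ω| ^ p - (p - 1) ^ p * |f n ω| ^ p) ∂μ ≤
      ∫ ω, p * ((p - 1) / p) ^ (p - 1) * auxU p (f n ω) (g n ω) ∂μ := by
    apply integral_mono (hgi.sub hfi) ((hUi n).const_mul _)
    intro ω
    have := auxU_major (x := f n ω) (y := g n ω) hp
    rwa [Real.mul_rpow (by linarith) (abs_nonneg _)] at this
  rw [integral_sub hgi hfi, integral_const_mul, integral_const_mul] at h1
  have h2 : 0 ≤ p * ((p - 1) / p) ^ (p - 1) :=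
    mul_nonneg (by linarith) (Real.rpow_nonneg (div_nonneg (by linarith) (by linarith)) _)
  nlinarith

/-- running maximum -/
noncomputable def auxM (g : ℕ → Ω → ℝ) : ℕ → Ω → ℝ
  | 0 => fun ω => |g 0 ω|
  | n + 1 => fun ω => max (auxM g n ω) |g (n + 1) ω|

lemma auxM_nonneg (g : ℕ → Ω → ℝ) (n : ℕ) (ω : Ω) : 0 ≤ auxM g n ω := by
  cases n with
  | zero => exact abs_nonneg _
  | succ n => exact (abs_nonneg _).trans (le_max_right _ _)

lemma auxM_ge (g : ℕ → Ω → ℝ) (n : ℕ) (ω : Ω) : |g n ω| ≤ auxM g n ω := by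
  cases n with
  | zero => exact le_rfl
  | succ n => exact le_max_right _ _

lemma auxM_mono (g : ℕ → Ω → ℝ) : Monotone (auxM g) :=
  monotone_nat_of_le_succ fun _ _ => le_max_left _ _

lemma aux_doob {g : ℕ → Ω → ℝ} {p : ℝ} (hp : 2 ≤ p) (hg : Martingale g 𝓕 μ)
    (hgL : ∀ n, MemLp (g n) (ENNReal.ofReal p) μ) :
    (∀ n, Measurable (auxM g n)) ∧ ∀ n, Integrable (fun ω => auxM g n ω ^ p) μ ∧
      ∫ ω, auxM g n ω ^ p ∂μ ≤ (p / (p - 1)) ^ p * ∫ ω, |g n ω| ^ p ∂μ := by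
  have hgm : ∀ n, Measurable[𝓕 n] (g n) := fun n => (hg.stronglyMeasurable n).measurable
  have hMm : ∀ n, Measurable[𝓕 n] (auxM g n) := by
    intro n
    induction n with
    | zero => exact measurable_norm.comp (hgm 0)
    | succ n ih => exact (ih.mono (𝓕.mono (by omega)) le_rfl).max (measurable_norm.comp (hgm _))
  have hML : ∀ n, MemLp (auxM g n) (ENNReal.ofReal p) μ := by
    intro n
    induction n with
    | zero => exact (hgL 0).norm
    | succ n ih => exact ih.sup (hgL _).norm
  have hMa : ∀ n ω, |auxM g n ω| = auxM g n ω := fun n ω => abs_of_nonneg (auxM_nonneg g n ω)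
  refine ⟨fun n => (hMm n).mono (𝓕.le n) le_rfl, fun n => ?_⟩
  have hMi : ∀ n, Integrable (fun ω => auxM g n ω ^ p) μ := fun n => by
    simpa only [hMa] using aux_int_pow hp (hML n)
  refine ⟨hMi n, ?_⟩
  have hPm : ∀ n, StronglyMeasurable[𝓕 n] (fun ω => auxM g n ω ^ (p - 1)) := fun n =>
    ((by fun_prop : Measurable fun x : ℝ => x ^ (p - 1)).comp (hMm n)).stronglyMeasurable
  have hAm : ∀ n, StronglyMeasurable[𝓕 n] (fun ω => auxM g n ω ^ (p - 1) * auxσ (g n ω)) :=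
    fun n => (hPm n).mul (auxσ_meas.comp (hgm n)).stronglyMeasurable
  have hAi : ∀ n k, Integrable ((fun ω => auxM g n ω ^ (p - 1) * auxσ (g n ω)) * g k) μ :=
    fun n k => by
    refine aux_int_mul (C := 1) hp (by positivity) (hML n) (hgL k)
      ((hAm n).mono (𝓕.le n)).aestronglyMeasurable (fun ω => ?_)
    rw [hMa, abs_mul, auxσ_abs, abs_of_nonneg (Real.rpow_nonneg (auxM_nonneg g n ω) _)]; simp
  have hWi : ∀ n, Integrable
      (fun ω => (p - 1) * auxM g n ω ^ p - p * (auxM g n ω ^ (p - 1) * |g n ω|)) μ := fun n => by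
    refine ((hMi n).const_mul _).sub (Integrable.const_mul ?_ p)
    refine (hAi n n).congr (Filter.Eventually.of_forall fun ω => ?_)
    simp only [Pi.mul_apply]
    rw [mul_assoc, auxσ_mul_self]
  have hW : ∫ ω, ((p - 1) * auxM g n ω ^ p - p * (auxM g n ω ^ (p - 1) * |g n ω|)) ∂μ ≤ 0 := by
    induction n with
    | zero =>
      apply integral_nonpos
      intro ω
      simp only [auxM, Pi.zero_apply]
      rw [← aux_pow_succ' hp (abs_nonneg _)]
      have := Real.rpow_nonneg (abs_nonneg (g 0 ω)) p
      linarith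
    | succ n ih =>
      refine le_trans ?_ ih
      have i1 : Integrable (fun ω => (auxM g n ω ^ (p - 1) * auxσ (g n ω)) *
          (g (n + 1) ω - g n ω)) μ := by
        refine ((hAi n (n + 1)).sub (hAi n n)).congr (Filter.Eventually.of_forall fun ω => ?_)
        simp; ring
      have z1 := aux_mart_zero hg (hAm n) (hAi n n) (hAi n (n + 1))
      calc _ ≤ ∫ ω, (((p - 1) * auxM g n ω ^ p - p * (auxM g n ω ^ (p - 1) * |g n ω|)) -
            p * ((auxM g n ω ^ (p - 1) * auxσ (g n ω)) * (g (n + 1) ω - g n ω))) ∂μ := by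
            apply integral_mono (hWi _) ((hWi n).sub (i1.const_mul p))
            intro ω
            have hM0 := auxM_nonneg g n ω
            have hb0 := abs_nonneg (g (n + 1) ω)
            have s1 : auxσ (g n ω) * g (n + 1) ω ≤ |g (n + 1) ω| := by
              refine (le_abs_self _).trans ?_
              rw [abs_mul, auxσ_abs, one_mul]
            have s2 := auxσ_mul_self (g n ω)
            have s3 := mul_le_mul_of_nonneg_left s1
              (mul_nonneg (by linarith : 0 ≤ p) (Real.rpow_nonneg hM0 (p - 1)))
            have s4 : (p - 1) * auxM g (n + 1) ω ^ p
                - p * (auxM g (n + 1) ω ^ (p - 1) * |g (n + 1) ω|) ≤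
                (p - 1) * auxM g n ω ^ p - p * (auxM g n ω ^ (p - 1) * |g (n + 1) ω|) := by
              simp only [auxM]
              rcases le_total |g (n + 1) ω| (auxM g n ω) with hle | hle
              · rw [max_eq_left hle]
              · rw [max_eq_right hle, ← aux_pow_succ' hp hb0]
                have := aux_tangent (a := p) (by linarith) hM0 hb0
                have e := aux_pow_succ' hp hM0
                rw [e] at this ⊢
                linarith
            have s5 : p * auxM g n ω ^ (p - 1) * (auxσ (g n ω) * g n ω)
              = p * auxM g n ω ^ (p - 1) * |g n ω| := by rw [s2]
            show (p - 1) * auxM g (n + 1) ω ^ p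
                - p * (auxM g (n + 1) ω ^ (p - 1) * |g (n + 1) ω|) ≤
              ((p - 1) * auxM g n ω ^ p - p * (auxM g n ω ^ (p - 1) * |g n ω|)) -
            p * ((auxM g n ω ^ (p - 1) * auxσ (g n ω)) * (g (n + 1) ω - g n ω))
            linarith
        _ = _ := by
            rw [integral_sub (hWi n) (i1.const_mul p), integral_const_mul, z1]; simp
  have hgi := (aux_int_pow hp (hgL n)).const_mul ((p / (p - 1)) ^ p)
  have hp1 : 0 < p - 1 := by linarith
  have h1 : ∫ ω, (auxM g n ω ^ p - (p / (p - 1)) ^ p * |g n ω| ^ p) ∂μ ≤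
      ∫ ω, p / (p - 1) * ((p - 1) * auxM g n ω ^ p - p * (auxM g n ω ^ (p - 1) * |g n ω|)) ∂μ := by
    apply integral_mono ((hMi n).sub hgi) ((hWi n).const_mul _)
    intro ω
    have hM0 := auxM_nonneg g n ω
    have hq : 0 ≤ p / (p - 1) := div_nonneg (by linarith) hp1.le
    have := aux_tangent (a := p) (s := p / (p - 1) * |g n ω|) (by linarith) hM0 (by positivity)
    rw [Real.mul_rpow hq (abs_nonneg _)] at this
    have e := aux_pow_succ' hp hM0
    have e3 : p / (p - 1) * (p - 1) = p := by field_simp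
    show auxM g n ω ^ p - (p / (p - 1)) ^ p * |g n ω| ^ p ≤
      p / (p - 1) * ((p - 1) * auxM g n ω ^ p - p * (auxM g n ω ^ (p - 1) * |g n ω|))
    rw [mul_sub, ← mul_assoc, e3]
    rw [e] at this ⊢
    linarith
  rw [integral_sub (hMi n) hgi, integral_const_mul, integral_const_mul] at h1
  have h2 : 0 ≤ p / (p - 1) := div_nonneg (by linarith) hp1.le
  nlinarith

end prob

theorem maximal_inequality_martingale
    {Ω : Type*} {m0 : MeasurableSpace Ω} {μ : Measure Ω} [IsProbabilityMeasure μ]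
    {𝓕 : Filtration ℕ m0} {f g : ℕ → Ω → ℝ} {p : ℝ} (hp : 2 ≤ p)
    (hf : Martingale f 𝓕 μ) (hg : Martingale g 𝓕 μ)
    (hsub0 : ∀ᵐ ω ∂μ, |g 0 ω| ≤ |f 0 ω|)
    (hsub : ∀ n : ℕ, ∀ᵐ ω ∂μ, |g (n+1) ω - g n ω| ≤ |f (n+1) ω - f n ω|) :
    (∫⁻ ω, (⨆ n : ℕ, ENNReal.ofReal |g n ω|) ^ p ∂μ) ^ (1/p)
      ≤ ENNReal.ofReal p * ⨆ n : ℕ, eLpNorm (f n) (ENNReal.ofReal p) μ := by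
  have hp0 : 0 < p := by linarith
  by_cases htop : (⨆ n : ℕ, eLpNorm (f n) (ENNReal.ofReal p) μ) = ⊤
  · rw [htop, ENNReal.mul_top (by simpa using hp0)]; exact le_top
  have hfL : ∀ n, MemLp (f n) (ENNReal.ofReal p) μ := fun n =>
    ⟨(hf.integrable n).1, (le_iSup (fun n => eLpNorm (f n) (ENNReal.ofReal p) μ) n).trans_lt
      (lt_top_iff_ne_top.2 htop)⟩
  have hgL : ∀ n, MemLp (g n) (ENNReal.ofReal p) μ := by
    intro n
    induction n with
    | zero => exact (hfL 0).mono (hg.integrable 0).1 hsub0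
    | succ n ih =>
      have h1 : MemLp (g (n + 1) - g n) (ENNReal.ofReal p) μ :=
        ((hfL (n + 1)).sub (hfL n)).mono ((hg.integrable _).1.sub (hg.integrable _).1) (hsub n)
      simpa using ih.add h1
  obtain ⟨hMm, hD⟩ := aux_doob hp hg hgL
  have hn : ∀ n, ∫⁻ ω, ENNReal.ofReal (auxM g n ω) ^ p ∂μ ≤
      (ENNReal.ofReal p * eLpNorm (f n) (ENNReal.ofReal p) μ) ^ p := by
    intro n
    obtain ⟨hi, hle⟩ := hD n
    have hb := aux_burk hp hf hg hsub0 hsub hfL hgL n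
    have hq : 0 ≤ p / (p - 1) := div_nonneg (by linarith) (by linarith)
    have h3 : ∫ ω, auxM g n ω ^ p ∂μ ≤ p ^ p * ∫ ω, |f n ω| ^ p ∂μ := by
      refine hle.trans ((mul_le_mul_of_nonneg_left hb (Real.rpow_nonneg hq p)).trans_eq ?_)
      rw [← mul_assoc, ← Real.mul_rpow hq (by linarith), div_mul_cancel₀ _ (by linarith)]
    have e1 : ∀ ω, ENNReal.ofReal (auxM g n ω) ^ p = ENNReal.ofReal (auxM g n ω ^ p) := fun ω =>
      ENNReal.ofReal_rpow_of_nonneg (auxM_nonneg g n ω) hp0.le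
    simp only [e1]
    rw [← ofReal_integral_eq_lintegral_ofReal hi
      (Filter.Eventually.of_forall fun ω => Real.rpow_nonneg (auxM_nonneg g n ω) p)]
    rw [ENNReal.mul_rpow_of_nonneg _ _ hp0.le,
      eLpNorm_eq_lintegral_rpow_enorm_toReal (by simpa using hp0) (by simp),
      ENNReal.toReal_ofReal hp0.le, ← ENNReal.rpow_mul, one_div, inv_mul_cancel₀ hp0.ne',
      ENNReal.rpow_one]
    have e2 : ∀ ω, ‖f n ω‖ₑ ^ p = ENNReal.ofReal (|f n ω| ^ p) := fun ω => by
      rw [Real.enorm_eq_ofReal_abs, ENNReal.ofReal_rpow_of_nonneg (abs_nonneg _) hp0.le]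
    simp only [e2]
    rw [← ofReal_integral_eq_lintegral_ofReal (aux_int_pow hp (hfL n))
      (Filter.Eventually.of_forall fun ω => Real.rpow_nonneg (abs_nonneg _) p),
      ENNReal.ofReal_rpow_of_nonneg hp0.le hp0.le, ← ENNReal.ofReal_mul (by positivity)]
    exact ENNReal.ofReal_le_ofReal h3
  have hsup : ∫⁻ ω, (⨆ n : ℕ, ENNReal.ofReal |g n ω|) ^ p ∂μ ≤
      (ENNReal.ofReal p * ⨆ n : ℕ, eLpNorm (f n) (ENNReal.ofReal p) μ) ^ p := by
    calc ∫⁻ ω, (⨆ n : ℕ, ENNReal.ofReal |g n ω|) ^ p ∂μ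
        ≤ ∫⁻ ω, ⨆ n : ℕ, ENNReal.ofReal (auxM g n ω) ^ p ∂μ := by
          apply lintegral_mono
          intro ω
          have := (ENNReal.orderIsoRpow p hp0).map_iSup (fun n => ENNReal.ofReal |g n ω|)
          simp only [ENNReal.orderIsoRpow_apply] at this
          simp only [this]
          refine iSup_mono fun n => ?_
          exact ENNReal.rpow_le_rpow (ENNReal.ofReal_le_ofReal (auxM_ge g n ω)) hp0.le
      _ = ⨆ n : ℕ, ∫⁻ ω, ENNReal.ofReal (auxM g n ω) ^ p ∂μ := by
          apply lintegral_iSup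
          · exact fun n => (hMm n).ennreal_ofReal.pow_const p
          · intro a b hab ω
            exact ENNReal.rpow_le_rpow (ENNReal.ofReal_le_ofReal (auxM_mono g hab ω)) hp0.le
      _ ≤ _ := by
          refine iSup_le fun n => (hn n).trans (ENNReal.rpow_le_rpow ?_ hp0.le)
          gcongr
          exact le_iSup (fun n => eLpNorm (f n) (ENNReal.ofReal p) μ) n
  rw [one_div, ENNReal.rpow_inv_le_iff hp0]
  exact hsup
end

section
/- Let p ≥ 2. The constant p is best possible in the maximal inequality for ±1-transforms: for every β < p there exist a probability space with a filtration, a martingale f and a ±1-transform g of f (that is, dg_n = ε_n·df_n for all n with deterministic signs ε_n ∈ {−1,1}) such that ‖g*‖_{L^p} > β·‖f*‖_{L^p}. -/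
open MeasureTheory

namespace PMOne

/-- The law of the jump time. -/
noncomputable def mu (N : ℕ) (Q : ℕ → ℝ) : Measure ℕ :=
  ∑ k ∈ Finset.range (N+1), ENNReal.ofReal (Q k - Q (k+1)) • Measure.dirac k

/-- The filtration generated by the jump time. -/
def filt : Filtration ℕ (⊤ : MeasurableSpace ℕ) where
  seq n := MeasurableSpace.comap (fun k : ℕ => min k n) ⊤
  mono' := by
    intro i j hij s hs
    obtain ⟨t, -, rfl⟩ := hs
    refine ⟨(fun k => min k i) ⁻¹' t, trivial, ?_⟩
    ext k
    simp [min_assoc, hij]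
  le' := fun n => le_top

/-- A process moving along a deterministic path until the jump time. -/
def proc (A B : ℕ → ℝ) (n k : ℕ) : ℝ := if k < n then B k else A n

lemma mu_apply_lintegral (N : ℕ) (Q : ℕ → ℝ) (h : ℕ → ENNReal) :
    ∫⁻ k, h k ∂(mu N Q) = ∑ k ∈ Finset.range (N+1), ENNReal.ofReal (Q k - Q (k+1)) * h k := by
  unfold mu
  rw [lintegral_finsetSum_measure]
  refine Finset.sum_congr rfl fun k _ => ?_
  rw [lintegral_smul_measure, lintegral_dirac, smul_eq_mul]

lemma prob (N : ℕ) (Q : ℕ → ℝ) (hQ : Antitone Q) (h0 : Q 0 = 1) (hN : Q (N+1) = 0) :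
    IsProbabilityMeasure (mu N Q) := by
  constructor
  have := mu_apply_lintegral N Q 1
  simp only [Pi.one_apply, lintegral_one, mul_one] at this
  rw [this, ← ENNReal.ofReal_sum_of_nonneg, Finset.sum_range_sub', h0, hN]
  · simp
  · intro i _
    have := hQ (Nat.le_succ i)
    simp only [Nat.succ_eq_add_one] at this
    linarith

lemma integrable_mu (N : ℕ) (Q : ℕ → ℝ) (h : ℕ → ℝ) : Integrable h (mu N Q) := by
  refine ⟨(measurable_of_countable h).aestronglyMeasurable, ?_⟩
  unfold HasFiniteIntegral
  rw [mu_apply_lintegral, ENNReal.sum_lt_top]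
  intro k _
  exact ENNReal.mul_lt_top ENNReal.ofReal_lt_top enorm_lt_top

lemma integral_mu (N : ℕ) (Q : ℕ → ℝ) (hQ : Antitone Q) (h : ℕ → ℝ) :
    ∫ k, h k ∂(mu N Q) = ∑ k ∈ Finset.range (N+1), (Q k - Q (k+1)) * h k := by
  unfold mu
  rw [integral_finsetSum_measure]
  · refine Finset.sum_congr rfl fun k _ => ?_
    rw [integral_smul_measure, integral_dirac, smul_eq_mul, ENNReal.toReal_ofReal]
    have := hQ (Nat.le_succ k)
    simp only [Nat.succ_eq_add_one] at this
    linarith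
  · intro k _
    refine ⟨(measurable_of_countable h).aestronglyMeasurable, ?_⟩
    unfold HasFiniteIntegral
    rw [lintegral_smul_measure, lintegral_dirac, smul_eq_mul]
    exact ENNReal.mul_lt_top ENNReal.ofReal_lt_top enorm_lt_top

lemma sum_aux (Q A B : ℕ → ℝ) (n M : ℕ) :
    ∑ k ∈ Finset.range M, (Q k - Q (k+1)) * (proc A B (n+1) k - proc A B n k)
      = if M ≤ n then 0 else
        (Q n - Q (n+1)) * (B n - A n) + (Q (n+1) - Q M) * (A (n+1) - A n) := by
  induction M with
  | zero => simp
  | succ M ih =>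
    rw [Finset.sum_range_succ, ih]
    unfold proc
    rcases lt_trichotomy M n with h | h | h
    · rw [if_pos h.le, if_pos (by omega), if_pos h, if_pos (by omega)]; ring
    · subst h
      simp
    · rw [if_neg (by omega), if_neg (by omega), if_neg (by omega), if_neg (by omega)]; ring

lemma mart (N : ℕ) (Q A B : ℕ → ℝ) (hQ : Antitone Q) (h0 : Q 0 = 1)
    (hN : ∀ n, N < n → Q n = 0)
    (h : ∀ n, Q n * (A n - B n) = Q (n+1) * (A (n+1) - B n)) :
    Martingale (proc A B) filt (mu N Q) := by
  have := prob N Q hQ h0 (hN _ (Nat.lt_succ_self N))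
  have hmeas : ∀ n, StronglyMeasurable[filt n] (proc A B n) := by
    intro n
    have : proc A B n = (proc A B n) ∘ (fun k => min k n) := by
      funext k
      simp only [proc, Function.comp]
      by_cases hk : k < n
      · simp [hk, hk.le]
      · simp [hk]
    rw [this]
    apply Measurable.stronglyMeasurable
    exact measurable_from_top.comp (comap_measurable (fun k : ℕ => min k n))
  refine martingale_nat hmeas (fun n => integrable_mu _ _ _) fun n => ?_
  refine ae_eq_condExp_of_forall_setIntegral_eq (filt.le n) (integrable_mu _ _ _)
    (fun s _ _ => (integrable_mu _ _ _).integrableOn) ?_ (hmeas n).aestronglyMeasurable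
  intro s hs _
  have hs' : MeasurableSet s := trivial
  rw [← sub_eq_zero, ← integral_sub (integrable_mu _ _ _).integrableOn
    (integrable_mu _ _ _).integrableOn, ← integral_indicator hs', integral_mu _ _ hQ]
  obtain ⟨t, -, rfl⟩ := hs
  by_cases hn : n ∈ t
  · have key := sum_aux Q A B n (N+1)
    have hz : (∑ k ∈ Finset.range (N+1),
        (Q k - Q (k+1)) * (proc A B (n+1) k - proc A B n k)) = 0 := by
      rw [key]
      split_ifs with hh
      · rfl
      · rw [hN (N+1) (Nat.lt_succ_self N)]
        linarith [h n]
    rw [← neg_eq_zero, ← hz, ← Finset.sum_neg_distrib]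
    refine Finset.sum_congr rfl fun k _ => ?_
    by_cases hk : k < n
    · have e : proc A B (n+1) k - proc A B n k = 0 := by
        simp [proc, hk, Nat.lt_succ_of_lt hk]
      have e2 : proc A B n k - proc A B (n+1) k = 0 := by linarith
      classical
      rw [Set.indicator_apply]
      simp [e, e2]
    · rw [Set.indicator_of_mem]
      · ring
      · simpa [not_lt.1 hk] using hn
  · refine Finset.sum_eq_zero fun k _ => ?_
    by_cases hk : k < n
    · have e2 : proc A B n k - proc A B (n+1) k = 0 := by
        simp [proc, hk, Nat.lt_succ_of_lt hk]
      classical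
      rw [Set.indicator_apply]
      simp [e2]
    · rw [Set.indicator_of_notMem, mul_zero]
      simpa [not_lt.1 hk] using hn

/-- Choice of parameters. -/
lemma params {p a : ℝ} (hp : 2 ≤ p) (ha : 1 < a) (hap : a < p) :
    ∃ κ r q : ℝ, 0 < κ ∧ κ < 1 / a ∧ κ < 1 ∧ 1 < r ∧ 0 < q ∧ q ≤ 1 ∧
      r * (1 - κ) = 1 + κ ∧ q * (1 / a + κ * r) = 1 / a - κ ∧ 1 < q * r ^ p := by
  have hp0 : 0 < p := by linarith
  have ha0 : 0 < a := by linarith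
  set κ := (p - a) / (2 * p * a) with hκ
  have hκ0 : 0 < κ := div_pos (by linarith) (by positivity)
  have hκe : 2 * p * a * κ = p - a := by rw [hκ]; field_simp
  have haκ : a * κ < 1 := by nlinarith
  have hκa : κ < 1 / a := by rw [lt_div_iff₀ ha0]; linarith
  have hκ1 : κ < 1 := by nlinarith
  have h1κ : 0 < 1 - κ := by linarith
  set r := (1 + κ) / (1 - κ) with hr
  have hre : r * (1 - κ) = 1 + κ := by rw [hr]; field_simp
  have hr1 : 1 < r := by rw [hr, lt_div_iff₀ h1κ]; linarith
  have hr0 : 0 < r := by linarith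
  have hden : 0 < 1 / a + κ * r := by positivity
  set q := (1 / a - κ) / (1 / a + κ * r) with hq
  have hqe : q * (1 / a + κ * r) = 1 / a - κ := by rw [hq]; field_simp
  have hq0 : 0 < q := div_pos (by linarith) hden
  have hq1 : q ≤ 1 := by
    rw [hq, div_le_one hden]
    have : 0 < κ * r := by positivity
    linarith
  refine ⟨κ, r, q, hκ0, hκa, hκ1, hr1, hq0, hq1, hre, hqe, ?_⟩
  have hb : 1 + p * (r - 1) ≤ r ^ p := by
    have := one_add_mul_self_le_rpow_one_add (s := r - 1) (by linarith) (p := p) (by linarith)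
    simpa using this
  have hqa : q * (1 + a * κ * r) = 1 - a * κ := by
    have := congrArg (fun z => a * z) hqe
    field_simp at this
    linarith
  have hmain : 1 + a * κ * r < (1 - a * κ) * (1 + p * (r - 1)) := by
    refine lt_of_mul_lt_mul_right ?_ h1κ.le
    have e1 : (1 + a * κ * r) * (1 - κ) = 1 - κ + a * κ * (1 + κ) := by
      rw [← hre]; ring
    have e2 : (1 - a * κ) * (1 + p * (r - 1)) * (1 - κ)
        = (1 - a * κ) * (1 - κ + 2 * p * κ) := by
      have : (r - 1) * (1 - κ) = 2 * κ := by linarith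
      calc _ = (1 - a * κ) * (1 - κ + p * ((r - 1) * (1 - κ))) := by ring
        _ = _ := by rw [this]; ring
    rw [e1, e2]
    nlinarith [mul_pos hκ0 (sub_pos.2 hap)]
  have h3 : 1 + a * κ * r < (1 + a * κ * r) * (q * r ^ p) := by
    calc 1 + a * κ * r < (1 - a * κ) * (1 + p * (r - 1)) := hmain
      _ ≤ (1 - a * κ) * r ^ p := mul_le_mul_of_nonneg_left hb (by linarith)
      _ = _ := by rw [← hqa]; ring
  have h4 : 0 < 1 + a * κ * r := by positivity
  by_contra hc
  nlinarith [not_lt.1 hc]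

/-- Survivor path of `f`. -/
noncomputable def Af (κ r : ℝ) : ℕ → ℝ
  | 0 => (1 - κ) / 2
  | n+1 => (-1)^(n+1) * (κ * r ^ n)

/-- Survivor path of `g`. -/
noncomputable def Cf (κ r : ℝ) : ℕ → ℝ
  | 0 => (1 - κ) / 2
  | n+1 => r ^ n

/-- Jump targets of `f`. -/
noncomputable def Bf (a κ r : ℝ) (m : ℕ) : ℕ → ℝ
  | 0 => 1
  | n+1 => if n < m then (-1)^(n+1) * (r ^ n / a) else Af κ r (n+1)

/-- Signs. -/
def ef : ℕ → ℝ
  | 0 => 1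
  | n+1 => -(-1)^n

/-- Jump targets of `g`. -/
noncomputable def Df (a κ r : ℝ) (m n : ℕ) : ℝ :=
  Cf κ r n + ef (n+1) * (Bf a κ r m n - Af κ r n)

/-- Survival probabilities. -/
noncomputable def Qf (q : ℝ) (m : ℕ) : ℕ → ℝ
  | 0 => 1
  | n+1 => if n ≤ m then q ^ n / 2 else 0

lemma Qf_anti {q : ℝ} (h0 : 0 < q) (h1 : q ≤ 1) (m : ℕ) : Antitone (Qf q m) := by
  refine antitone_nat_of_succ_le fun n => ?_
  rcases n with _ | n
  · simp [Qf]; norm_num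
  · simp only [Qf]
    by_cases h : n + 1 ≤ m
    · rw [if_pos h, if_pos (by omega)]
      have := pow_le_pow_of_le_one h0.le h1 (Nat.le_succ n)
      simp only [Nat.succ_eq_add_one] at this
      linarith
    · rw [if_neg h]
      split_ifs <;> positivity

lemma balance {a κ r q : ℝ} (m : ℕ) (hre : r * (1 - κ) = 1 + κ)
    (hqe : q * (1 / a + κ * r) = 1 / a - κ) (n : ℕ) :
    Qf q m n * (Af κ r n - Bf a κ r m n) =
      Qf q m (n+1) * (Af κ r (n+1) - Bf a κ r m n) := by
  rcases n with _ | n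
  · simp [Qf, Af, Bf]; ring
  · simp only [Qf, Bf]
    rcases lt_trichotomy n m with h | h | h
    · rw [if_pos h.le, if_pos h, if_pos (by omega)]
      simp only [Af]
      have : q ^ (n + 1) / 2 * ((-1) ^ (n + 1 + 1) * (κ * r ^ (n + 1)) -
          (-1) ^ (n + 1) * (r ^ n / a))
          = -(q ^ n / 2 * ((-1) ^ (n + 1) * r ^ n)) * (q * (1 / a + κ * r)) := by
        ring
      rw [this, hqe]
      ring
    · subst h
      simp
    · have h1 : ¬ n ≤ m := by omega
      have h2 : ¬ n + 1 ≤ m := by omega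
      simp only [h1, h2, if_false, zero_mul]

lemma path_rel {κ r : ℝ} (hre : r * (1 - κ) = 1 + κ) (n : ℕ) :
    Cf κ r (n+1) - Cf κ r n = ef (n+1) * (Af κ r (n+1) - Af κ r n) := by
  rcases n with _ | n
  · simp [Cf, Af, ef]; ring
  · simp only [Cf, Af, ef]
    have h1 : ((-1 : ℝ)^(n+1)) * (-1)^(n+1) = 1 := by
      rw [← mul_pow]; simp
    have : -(-1:ℝ) ^ (n + 1) * ((-1) ^ (n + 1 + 1) * (κ * r ^ (n + 1)) -
        (-1) ^ (n + 1) * (κ * r ^ n))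
        = ((-1 : ℝ)^(n+1) * (-1)^(n+1)) * (κ * r ^ n * (r + 1)) := by ring
    rw [this, h1, pow_succ]
    have h2 : r - 1 = κ * (r + 1) := by linarith
    calc r ^ n * r - r ^ n = r ^ n * (r - 1) := by ring
      _ = _ := by rw [h2]; ring

lemma transform {a κ r : ℝ} (m : ℕ) (hre : r * (1 - κ) = 1 + κ) (n k : ℕ) :
    proc (Cf κ r) (Df a κ r m) (n+1) k - proc (Cf κ r) (Df a κ r m) n k
      = ef (n+1) * (proc (Af κ r) (Bf a κ r m) (n+1) k - proc (Af κ r) (Bf a κ r m) n k) := by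
  unfold proc
  rcases lt_trichotomy k n with h | h | h
  · simp [h, Nat.lt_succ_of_lt h]
  · subst h
    simp [Df]
  · rw [if_neg (by omega), if_neg (by omega), if_neg (by omega), if_neg (by omega)]
    exact path_rel hre n

lemma Af_bound {a κ r : ℝ} (hκ0 : 0 < κ) (hκa : κ < 1 / a) (hκ1 : κ < 1) (hr : 1 < r) (n : ℕ) :
    |Af κ r n| ≤ 1 ∨ |Af κ r n| ≤ 1 / a * |Cf κ r n| := by
  have hr0 : 0 < r := by linarith
  rcases n with _ | n
  · left
    simp only [Af]
    rw [abs_le]; constructor <;> linarith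
  · right
    simp only [Af, Cf, abs_mul, abs_pow, abs_neg, abs_one, one_pow, one_mul, abs_of_pos hκ0,
      abs_of_pos hr0]
    exact mul_le_mul_of_nonneg_right hκa.le (by positivity)

lemma Bf_bound {a κ r : ℝ} (ha : 0 < a) (hκ0 : 0 < κ) (hκa : κ < 1 / a) (hκ1 : κ < 1)
    (hr : 1 < r) (m n : ℕ) :
    |Bf a κ r m n| ≤ 1 ∨ |Bf a κ r m n| ≤ 1 / a * |Cf κ r n| := by
  have hr0 : 0 < r := by linarith
  rcases n with _ | n
  · left
    simp [Bf]
  · simp only [Bf]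
    split_ifs with h
    · right
      simp only [Cf, abs_mul, abs_div, abs_pow, abs_neg, abs_one, one_pow, one_mul, abs_of_pos ha,
        abs_of_pos hr0]
      apply le_of_eq; ring
    · exact Af_bound hκ0 hκa hκ1 hr (n+1)

lemma proc_bound {a κ r : ℝ} (ha : 0 < a) (hκ0 : 0 < κ) (hκa : κ < 1 / a) (hκ1 : κ < 1)
    (hr : 1 < r) (m k : ℕ) :
    (⨆ n : ℕ, ENNReal.ofReal |proc (Af κ r) (Bf a κ r m) n k|) ≤
      max 1 (ENNReal.ofReal (1/a) *
        ⨆ n : ℕ, ENNReal.ofReal |proc (Cf κ r) (Df a κ r m) n k|) := by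
  refine iSup_le fun n => ?_
  have key : ∃ j, |proc (Af κ r) (Bf a κ r m) n k| ≤ 1 ∨
      |proc (Af κ r) (Bf a κ r m) n k| ≤ 1 / a * |proc (Cf κ r) (Df a κ r m) j k| := by
    by_cases h : k < n
    · refine ⟨k, ?_⟩
      simpa [proc, h] using Bf_bound ha hκ0 hκa hκ1 hr m k
    · refine ⟨n, ?_⟩
      simpa [proc, h] using Af_bound hκ0 hκa hκ1 hr n
  obtain ⟨j, hj | hj⟩ := key
  · refine le_max_of_le_left ?_
    simpa using ENNReal.ofReal_le_ofReal hj
  · refine le_max_of_le_right ?_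
    refine (ENNReal.ofReal_le_ofReal hj).trans ?_
    rw [ENNReal.ofReal_mul (by positivity)]
    gcongr
    exact le_iSup (fun n => ENNReal.ofReal |proc (Cf κ r) (Df a κ r m) n k|) j

lemma proc_sup_lt_top (A B : ℕ → ℝ) (k : ℕ) :
    (⨆ n : ℕ, ENNReal.ofReal |proc A B n k|) < ⊤ := by
  have : (⨆ n : ℕ, ENNReal.ofReal |proc A B n k|) ≤
      ∑ n ∈ Finset.range (k+2), ENNReal.ofReal |proc A B n k| := by
    refine iSup_le fun n => ?_
    by_cases h : n < k + 2
    · exact Finset.single_le_sum (f := fun n => ENNReal.ofReal |proc A B n k|)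
        (fun _ _ => zero_le) (Finset.mem_range.2 h)
    · have e : proc A B n k = proc A B (k+1) k := by
        unfold proc
        rw [if_pos (by omega), if_pos (by omega)]
      rw [e]
      exact Finset.single_le_sum (f := fun n => ENNReal.ofReal |proc A B n k|)
        (fun _ _ => zero_le) (Finset.mem_range.2 (by omega : k + 1 < k + 2))
  refine this.trans_lt ?_
  rw [ENNReal.sum_lt_top]
  exact fun _ _ => ENNReal.ofReal_lt_top

end PMOne

open PMOne

/-- The constant `p` is best possible in the maximal inequality `‖g*‖_p ≤ p ‖f*‖_p`
for `±1`-transforms `g` of martingales `f`, `p ≥ 2`. -/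
theorem maximal_inequality_pm_one_transform_sharp
    {p : ℝ} (hp : 2 ≤ p) {β : ℝ} (hβ : β < p) :
    ∃ (Ω : Type) (m0 : MeasurableSpace Ω) (μ : Measure Ω) (_ : IsProbabilityMeasure μ)
      (𝓕 : Filtration ℕ m0) (f g : ℕ → Ω → ℝ) (ε : ℕ → ℝ),
      Martingale f 𝓕 μ ∧
      (∀ n : ℕ, ε n = 1 ∨ ε n = -1) ∧
      (∀ ω, g 0 ω = ε 0 * f 0 ω) ∧
      (∀ n : ℕ, ∀ ω, g (n+1) ω - g n ω = ε (n+1) * (f (n+1) ω - f n ω)) ∧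
      ENNReal.ofReal β * (∫⁻ ω, (⨆ n : ℕ, ENNReal.ofReal |f n ω|) ^ p ∂μ) ^ (1/p)
        < (∫⁻ ω, (⨆ n : ℕ, ENNReal.ofReal |g n ω|) ^ p ∂μ) ^ (1/p) := by
  have hp0 : 0 < p := by linarith
  obtain ⟨b, hb1, hbβ, hbp⟩ : ∃ b, 1 ≤ b ∧ β ≤ b ∧ b < p :=
    ⟨max β 1, le_max_right _ _, le_max_left _ _, max_lt hβ (by linarith)⟩
  obtain ⟨a, hba, hap⟩ := exists_between hbp
  have ha1 : 1 < a := by linarith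
  have ha0 : 0 < a := by linarith
  have hb0 : 0 < b := by linarith
  obtain ⟨κ, r, q, hκ0, hκa, hκ1, hr, hq0, hq1, hre, hqe, hgrow⟩ := params hp ha1 hap
  have hr0 : 0 < r := by linarith
  have hθ : (b / a) ^ p < 1 :=
    Real.rpow_lt_one (by positivity) ((div_lt_one ha0).2 hba) hp0
  obtain ⟨m, hm⟩ := pow_unbounded_of_one_lt (2 * (b ^ p / (1 - (b / a) ^ p))) hgrow
  have hanti := Qf_anti hq0 hq1 m
  have hvan : ∀ n, m + 1 < n → Qf q m n = 0 := by
    intro n hn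
    obtain ⟨n, rfl⟩ : ∃ l, n = l + 1 := ⟨n - 1, by omega⟩
    simp only [Qf]
    rw [if_neg (by omega)]
  refine ⟨ℕ, ⊤, mu (m+1) (Qf q m), prob (m+1) _ hanti rfl (hvan _ (by omega)), filt,
    proc (Af κ r) (Bf a κ r m), proc (Cf κ r) (Df a κ r m), ef,
    mart (m+1) _ _ _ hanti rfl hvan (balance m hre hqe), ?_, ?_, transform m hre, ?_⟩
  · rintro (_ | n)
    · left; rfl
    · rcases neg_one_pow_eq_or ℝ n with h | h <;> simp [ef, h]
  · intro k
    simp [proc, Cf, Af, ef]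
  set F : ℕ → ENNReal := fun k => ⨆ n : ℕ, ENNReal.ofReal |proc (Af κ r) (Bf a κ r m) n k|
    with hF
  set G : ℕ → ENNReal := fun k => ⨆ n : ℕ, ENNReal.ofReal |proc (Cf κ r) (Df a κ r m) n k|
    with hG
  have hprob := prob (m+1) _ hanti rfl (hvan _ (by omega))
  set I := ∫⁻ k, G k ^ p ∂(mu (m+1) (Qf q m)) with hI
  set J := ∫⁻ k, F k ^ p ∂(mu (m+1) (Qf q m)) with hJ
  change ENNReal.ofReal β * J ^ (1/p) < I ^ (1/p)
  have hIfin : I ≠ ⊤ := by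
    rw [hI, mu_apply_lintegral]
    refine (ENNReal.sum_lt_top.2 fun k _ => ENNReal.mul_lt_top ENNReal.ofReal_lt_top ?_).ne
    exact ENNReal.rpow_lt_top_of_nonneg hp0.le (proc_sup_lt_top _ _ k).ne
  have hJI : J ≤ 1 + ENNReal.ofReal ((1/a) ^ p) * I := by
    calc J ≤ ∫⁻ k, (1 + ENNReal.ofReal ((1/a) ^ p) * G k ^ p) ∂(mu (m+1) (Qf q m)) := by
          refine lintegral_mono fun k => ?_
          have h1 : F k ≤ max 1 (ENNReal.ofReal (1/a) * G k) :=
            proc_bound ha0 hκ0 hκa hκ1 hr m k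
          refine (ENNReal.rpow_le_rpow h1 hp0.le).trans ?_
          rcases max_choice (1 : ENNReal) (ENNReal.ofReal (1/a) * G k) with h | h
          · rw [h, ENNReal.one_rpow]; exact le_self_add
          · rw [h, ENNReal.mul_rpow_of_nonneg _ _ hp0.le,
              ENNReal.ofReal_rpow_of_nonneg (by positivity) hp0.le]
            exact le_add_self
      _ = _ := by
          rw [lintegral_add_left measurable_const, lintegral_const_mul' _ _ ENNReal.ofReal_ne_top]
          simp [hI]
  have hIlow : ENNReal.ofReal ((q * r ^ p) ^ m / 2) ≤ I := by
    rw [hI, mu_apply_lintegral]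
    refine le_trans ?_ (Finset.single_le_sum
      (f := fun k => ENNReal.ofReal (Qf q m k - Qf q m (k+1)) * G k ^ p)
      (fun _ _ => zero_le) (Finset.mem_range.2 (by omega : m + 1 < m + 1 + 1)))
    have hGm : ENNReal.ofReal (r ^ m) ≤ G (m+1) := by
      refine le_trans ?_ (le_iSup _ (m+1))
      simp [proc, Cf, abs_of_pos hr0]
    have hQm : Qf q m (m+1) - Qf q m (m+1+1) = q ^ m / 2 := by
      simp [Qf]
    simp only [hQm]
    calc ENNReal.ofReal ((q * r ^ p) ^ m / 2)
        = ENNReal.ofReal (q ^ m / 2) * ENNReal.ofReal (r ^ m) ^ p := by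
          rw [ENNReal.ofReal_rpow_of_nonneg (by positivity) hp0.le,
            ← ENNReal.ofReal_mul (by positivity)]
          congr 1
          rw [mul_pow, ← Real.rpow_natCast (r ^ p), ← Real.rpow_mul hr0.le,
            ← Real.rpow_natCast r, ← Real.rpow_mul hr0.le, mul_comm p]
          ring
      _ ≤ _ := by gcongr
  have hIreal : I = ENNReal.ofReal I.toReal := (ENNReal.ofReal_toReal hIfin).symm
  have hi : b ^ p / (1 - (b / a) ^ p) < I.toReal := by
    have := (ENNReal.ofReal_le_iff_le_toReal hIfin).1 hIlow
    linarith
  have hfin : ENNReal.ofReal (b ^ p) * J < I := by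
    calc ENNReal.ofReal (b ^ p) * J
        ≤ ENNReal.ofReal (b ^ p) * (1 + ENNReal.ofReal ((1/a) ^ p) * I) := by gcongr
      _ = ENNReal.ofReal (b ^ p * (1 + (1/a) ^ p * I.toReal)) := by
          rw [ENNReal.ofReal_mul (by positivity), ENNReal.ofReal_add (by positivity)
            (by positivity), ENNReal.ofReal_mul (by positivity), ENNReal.ofReal_one, ← hIreal]
      _ < ENNReal.ofReal I.toReal := by
          rw [div_lt_iff₀ (by linarith)] at hi
          have e : (b / a) ^ p = b ^ p * (1 / a) ^ p := by
            rw [← Real.mul_rpow hb0.le (by positivity)]; congr 1; ring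
          have hlt : b ^ p * (1 + (1/a) ^ p * I.toReal) < I.toReal := by
            rw [e] at hi; linarith
          have : 0 ≤ b ^ p * (1 + (1/a) ^ p * I.toReal) := by positivity
          exact (ENNReal.ofReal_lt_ofReal_iff (this.trans_lt hlt)).2 hlt
      _ = I := hIreal.symm
  calc ENNReal.ofReal β * J ^ (1/p) ≤ ENNReal.ofReal b * J ^ (1/p) := by gcongr
    _ = (ENNReal.ofReal (b ^ p) * J) ^ (1/p) := by
        rw [ENNReal.mul_rpow_of_nonneg _ _ (by positivity),
          ENNReal.ofReal_rpow_of_nonneg (by positivity) (by positivity),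
          ← Real.rpow_mul hb0.le, mul_one_div_cancel hp0.ne', Real.rpow_one]
    _ < I ^ (1/p) := ENNReal.rpow_lt_rpow hfin (by positivity)
end

section
/- Fix α ∈ [0,1] and p ≥ 2. Let f be a non-negative submartingale and let g be a real-valued adapted integrable process that is α-strongly subordinate to f. Then ‖g*‖_p ≤ (α+1)p·‖f‖_p, i.e. ‖sup_{n≥0}|g_n|‖_{L^p} ≤ (α+1)p·sup_{n≥0}‖f_n‖_{L^p}. -/
open MeasureTheory

lemma mis_tangent {q a b : ℝ} (hq : 1 ≤ q) (ha : 0 ≤ a) (hb : 0 ≤ b) :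
    b ^ q + q * b ^ (q-1) * (a - b) ≤ a ^ q := by
  rcases hb.eq_or_lt with rfl | hb
  · rw [Real.zero_rpow (by linarith)]
    rcases hq.eq_or_lt with rfl | hq
    · simp
    · rw [Real.zero_rpow (by linarith)]
      simpa using Real.rpow_nonneg ha q
  · have h := one_add_mul_self_le_rpow_one_add (s := a / b - 1) (by
      have : 0 ≤ a / b := by positivity
      linarith) hq
    have h2 : (1 + (a / b - 1)) = a / b := by ring
    rw [h2, Real.div_rpow ha hb.le] at h
    have hbq : 0 < b ^ q := Real.rpow_pos_of_pos hb q
    rw [le_div_iff₀ hbq] at h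
    rw [Real.rpow_sub_one hb.ne']
    calc _ = (1 + q * (a / b - 1)) * b ^ q := by field_simp
      _ ≤ _ := h

lemma mis_mul_rpow {q : ℝ} (r : ℝ) (hq : 1 ≤ q) : r * r ^ (q-1) = r ^ q := by
  rcases eq_or_ne r 0 with rfl | hr
  · rw [Real.zero_rpow (x := q) (by linarith), zero_mul]
  · rw [Real.rpow_sub_one hr]; field_simp

/-- derivative of a function frozen below `c`. -/
lemma mis_deriv_max {ψ ψ' : ℝ → ℝ} {c : ℝ} (h : ∀ r, HasDerivAt ψ (ψ' r) r) (hc : ψ' c = 0)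
    (r : ℝ) : HasDerivAt (fun r => ψ (max r c)) (ψ' (max r c)) r := by
  rcases lt_trichotomy r c with hr | hr | hr
  · rw [max_eq_right hr.le, hc]
    refine (hasDerivAt_const r (ψ c)).congr_of_eventuallyEq ?_
    filter_upwards [Iio_mem_nhds hr] with s hs
    rw [max_eq_right (le_of_lt hs)]
  · subst hr
    rw [max_self]
    rw [← hasDerivWithinAt_univ, ← Set.Iic_union_Ici (a := r)]
    apply HasDerivWithinAt.union
    · rw [hc]
      refine (hasDerivWithinAt_const r _ (ψ r)).congr ?_ (by simp)
      intro s hs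
      rw [max_eq_right hs]
    · refine (h r).hasDerivWithinAt.congr ?_ (by simp)
      intro s hs
      rw [max_eq_left hs]
  · rw [max_eq_left hr.le]
    refine (h r).congr_of_eventuallyEq ?_
    filter_upwards [Ioi_mem_nhds hr] with s hs
    rw [max_eq_left (le_of_lt hs)]

lemma mis_Da_pos {a a' b b' : ℝ → ℝ} (ha : ∀ r, HasDerivAt a (a' r) r)
    (hb : ∀ r s, 0 ≤ r → 0 ≤ s → b r + b' r * (s - r) ≤ b s)
    (hd : ∀ r s, 0 ≤ r → r ≤ s → a' s - a' r ≤ b s - b r)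
    {r s : ℝ} (hr : 0 ≤ r) (hrs : r ≤ s) :
    a s - a r - a' r * (s - r) ≤ (s - r) / 2 * (b s - b r) := by
  rcases hrs.eq_or_lt with rfl | hlt
  · simp
  set k := (b s - b r) / (s - r) with hk
  have hk' : k * (s - r) = b s - b r := by rw [hk]; field_simp [sub_ne_zero.2 hlt.ne']
  let G : ℝ → ℝ := fun t => a t - a' r * (t - r) - k / 2 * (t - r) ^ 2
  have hG : ∀ t, HasDerivAt G (a' t - a' r - k * (t - r)) t := by
    intro t
    have h1 : HasDerivAt G _ t := ((ha t).sub (((hasDerivAt_id t).sub_const r).const_mul (a' r))).sub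
      ((((hasDerivAt_id t).sub_const r).pow 2).const_mul (k / 2))
    convert h1 using 1
    simp only [id, Nat.cast_ofNat]; ring
  have hanti : AntitoneOn G (Set.Icc r s) := by
    apply antitoneOn_of_deriv_nonpos (convex_Icc r s)
    · exact fun t _ => (hG t).continuousAt.continuousWithinAt
    · exact fun t _ => (hG t).differentiableAt.differentiableWithinAt
    · intro t ht
      rw [interior_Icc] at ht
      rw [(hG t).deriv]
      have h1 := hd r t hr ht.1.le
      have h2 := hb t r (hr.trans ht.1.le) hr
      have h3 := hb t s (hr.trans ht.1.le) (hr.trans hrs)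
      have h4 : (s - r) * (b t - b r) ≤ (t - r) * (b s - b r) := by
        nlinarith [mul_le_mul_of_nonneg_left h2 (sub_nonneg.2 ht.2.le),
          mul_le_mul_of_nonneg_left h3 (sub_nonneg.2 ht.1.le)]
      have h5 : b t - b r ≤ k * (t - r) := by
        rw [← hk'] at h4
        have : 0 < s - r := sub_pos.2 hlt
        nlinarith
      linarith
  have := hanti (Set.left_mem_Icc.2 hrs) (Set.right_mem_Icc.2 hrs) hrs
  simp only [G] at this
  have h6 : k / 2 * (s - r) ^ 2 = (s - r) / 2 * (b s - b r) := by rw [← hk']; ring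
  rw [h6] at this
  simp at this
  linarith

lemma mis_Da_neg {a a' b b' : ℝ → ℝ} (ha : ∀ r, HasDerivAt a (a' r) r)
    (hb : ∀ r s, 0 ≤ r → 0 ≤ s → b r + b' r * (s - r) ≤ b s)
    (hd : ∀ r s, 0 ≤ r → r ≤ s → a' s - a' r ≤ b s - b r)
    {r s : ℝ} (hs : 0 ≤ s) (hrs : s ≤ r) :
    a s - a r - a' r * (s - r) ≤ b' r / 2 * (s - r) ^ 2 := by
  set k := b' r with hk
  let G : ℝ → ℝ := fun t => a t - a' r * (t - r) - k / 2 * (t - r) ^ 2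
  have hG : ∀ t, HasDerivAt G (a' t - a' r - k * (t - r)) t := by
    intro t
    have h1 : HasDerivAt G _ t := ((ha t).sub (((hasDerivAt_id t).sub_const r).const_mul (a' r))).sub
      ((((hasDerivAt_id t).sub_const r).pow 2).const_mul (k / 2))
    convert h1 using 1
    simp only [id, Nat.cast_ofNat]; ring
  have hm : MonotoneOn G (Set.Icc s r) := by
    apply monotoneOn_of_deriv_nonneg (convex_Icc s r)
    · exact fun t _ => (hG t).continuousAt.continuousWithinAt
    · exact fun t _ => (hG t).differentiableAt.differentiableWithinAt
    · intro t ht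
      rw [interior_Icc] at ht
      rw [(hG t).deriv]
      have h1 := hd t r (hs.trans ht.1.le) ht.2.le
      have h2 := hb r t (hs.trans hrs) (hs.trans ht.1.le)
      linarith
  have := hm (Set.left_mem_Icc.2 hrs) (Set.right_mem_Icc.2 hrs) hrs
  simp only [G] at this
  simp at this
  linarith

lemma mis_step_same {a a' b b' : ℝ → ℝ} (ha : ∀ r, HasDerivAt a (a' r) r)
    (hb : ∀ r s, 0 ≤ r → 0 ≤ s → b r + b' r * (s - r) ≤ b s)
    (hm : ∀ r s, 0 ≤ r → r ≤ s → b r ≤ b s)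
    (hd : ∀ r s, 0 ≤ r → r ≤ s → a' s - a' r ≤ b s - b r)
    {x y x' y' : ℝ} (hx : 0 ≤ x) (hx' : 0 ≤ x') (hy : 0 ≤ y) (hy' : 0 ≤ y')
    (hk : |y' - y| ≤ |x' - x|) :
    a (x' + y') - x' * b (x' + y') ≤ a (x + y) - x * b (x + y)
      + (a' (x + y) - x * b' (x + y) - b (x + y)) * (x' - x)
      + (a' (x + y) - x * b' (x + y)) * (y' - y) := by
  obtain ⟨r, hr⟩ : ∃ r, r = x + y := ⟨_, rfl⟩
  obtain ⟨s, hs⟩ : ∃ s, s = x' + y' := ⟨_, rfl⟩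
  rw [← hr, ← hs]
  have hr0 : 0 ≤ r := by linarith
  have hs0 : 0 ≤ s := by linarith
  have hconv := hb r s hr0 hs0
  rcases le_total x x' with h | h
  · rw [abs_of_nonneg (sub_nonneg.2 h), abs_le] at hk
    have hrs : r ≤ s := by linarith
    have h1 := mis_Da_pos ha hb hd hr0 hrs
    have h2 := hm r s hr0 hrs
    have h3 : (s - r) / 2 * (b s - b r) ≤ (x' - x) * (b s - b r) :=
      mul_le_mul_of_nonneg_right (by linarith) (by linarith)
    have h4 : 0 ≤ x * (b s - b r - b' r * (s - r)) := mul_nonneg hx (by linarith)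
    have h5 : y' - y = s - r - (x' - x) := by linarith
    rw [h5]
    nlinarith
  · rw [abs_of_nonpos (sub_nonpos.2 h), abs_le] at hk
    have hrs : s ≤ r := by linarith
    have h1 := mis_Da_neg ha hb hd hs0 hrs
    have h2 := hm s r hs0 hrs
    have h3 : 0 ≤ ((s - r) / 2 - (x' - x)) * (b r - b s) :=
      mul_nonneg (by linarith) (by linarith)
    have h4 : 0 ≤ (x + (s - r) / 2) * (b s - b r - b' r * (s - r)) :=
      mul_nonneg (by linarith) (by linarith)
    have h5 : y' - y = s - r - (x' - x) := by linarith
    rw [h5]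
    nlinarith

lemma mis_step_abs {a a' b b' : ℝ → ℝ} (ha : ∀ r, HasDerivAt a (a' r) r)
    (hb : ∀ r s, 0 ≤ r → 0 ≤ s → b r + b' r * (s - r) ≤ b s)
    (hm : ∀ r s, 0 ≤ r → r ≤ s → b r ≤ b s)
    (hd : ∀ r s, 0 ≤ r → r ≤ s → a' s - a' r ≤ b s - b r)
    (h0 : ∀ r, 0 ≤ r → a' r ≤ r * b' r)
    {x y x' y' : ℝ} (hx : 0 ≤ x) (hx' : 0 ≤ x') (hy : 0 ≤ y)
    (hk : |y' - y| ≤ |x' - x|) :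
    a (x' + |y'|) - x' * b (x' + |y'|) ≤ a (x + y) - x * b (x + y)
      + (a' (x + y) - x * b' (x + y) - b (x + y)) * (x' - x)
      + (a' (x + y) - x * b' (x + y)) * (y' - y) := by
  rcases le_or_gt 0 y' with hy' | hy'
  · rw [abs_of_nonneg hy']
    exact mis_step_same ha hb hm hd hx hx' hy hy' hk
  rw [abs_of_neg hy']
  obtain ⟨c, hc⟩ : ∃ c, c = a' (x + y) - x * b' (x + y) := ⟨_, rfl⟩
  have hyy : 0 < y - y' := by linarith
  have hk2 : y - y' ≤ |x' - x| := by
    have := (abs_le.1 hk).1; linarith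
  rcases hy.eq_or_lt with rfl | hypos
  · have h1 := mis_step_same ha hb hm hd (y := 0) (y' := -y') hx hx' le_rfl (by linarith)
      (by rw [sub_zero, abs_neg]; simpa using hk)
    have h2 := h0 x hx
    simp only [add_zero, sub_zero] at h1 ⊢
    nlinarith
  · obtain ⟨θ, hθ⟩ : ∃ θ, θ = y / (y - y') := ⟨_, rfl⟩
    have hθ0 : 0 < θ := by rw [hθ]; positivity
    have hθ1 : θ ≤ 1 := by rw [hθ, div_le_one hyy]; linarith
    have hθy : θ * (y - y') = y := by rw [hθ]; field_simp
    obtain ⟨x1, hx1⟩ : ∃ x1, x1 = x + θ * (x' - x) := ⟨_, rfl⟩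
    have hx10 : 0 ≤ x1 := by
      have : x1 = (1 - θ) * x + θ * x' := by rw [hx1]; ring
      rw [this]
      have : 0 ≤ 1 - θ := by linarith
      positivity
    have e1 : x1 - x = θ * (x' - x) := by rw [hx1]; ring
    have e2 : x' - x1 = (1 - θ) * (x' - x) := by rw [hx1]; ring
    have k1 : |0 - y| ≤ |x1 - x| := by
      rw [e1, abs_mul, abs_of_pos hθ0, zero_sub, abs_neg, abs_of_pos hypos]
      calc y = θ * (y - y') := hθy.symm
        _ ≤ _ := mul_le_mul_of_nonneg_left hk2 hθ0.le
    have k2 : |y - 0| ≤ |x - x1| := by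
      rw [abs_sub_comm, abs_sub_comm x]; exact k1
    have k3 : |-y' - 0| ≤ |x' - x1| := by
      rw [e2, abs_mul, abs_of_nonneg (by linarith : 0 ≤ 1 - θ), sub_zero,
        abs_of_pos (by linarith)]
      calc -y' = (1 - θ) * (y - y') := by linarith
        _ ≤ _ := mul_le_mul_of_nonneg_left hk2 (by linarith)
    have s1 := mis_step_same ha hb hm hd hx hx10 hy le_rfl k1
    have s2 := mis_step_same ha hb hm hd hx10 hx le_rfl hy k2
    have s3 := mis_step_same ha hb hm hd hx10 hx' le_rfl (by linarith : 0 ≤ -y') k3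
    have h2 := h0 x1 hx10
    simp only [add_zero, sub_zero] at s1 s2 s3
    obtain ⟨c1, hc1⟩ : ∃ c1, c1 = a' x1 - x1 * b' x1 := ⟨_, rfl⟩
    rw [← hc1] at s2 s3
    rw [← hc] at s1 ⊢
    have hc10 : c1 ≤ 0 := by linarith
    rw [e1] at s1
    rw [← neg_sub x1 x, e1] at s2
    rw [e2] at s3
    obtain ⟨W0, hW0⟩ : ∃ W0, W0 = a (x + y) - x * b (x + y) := ⟨_, rfl⟩
    obtain ⟨W1, hW1⟩ : ∃ W1, W1 = a x1 - x1 * b x1 := ⟨_, rfl⟩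
    rw [← hW0] at s1 s2 ⊢
    rw [← hW1] at s1 s2 s3
    obtain ⟨L, hL⟩ : ∃ L, L = y - y' := ⟨_, rfl⟩
    have ey : y = θ * L := by rw [hL]; exact hθy.symm
    have ey' : -y' = (1 - θ) * L := by rw [hL]; linarith
    have ed : y' - y = - L := by rw [hL]; ring
    rw [ed]
    rw [zero_sub, ey, ] at s1
    rw [ey'] at s3
    obtain ⟨D, hD⟩ : ∃ D, D = (c - b (x + y)) * (x' - x) + c * (-L) := ⟨_, rfl⟩
    obtain ⟨D1, hD1⟩ : ∃ D1, D1 = (c1 - b x1) * (x' - x) := ⟨_, rfl⟩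
    have t1 : W1 ≤ W0 + θ * D := by rw [hD]; rw [ey]; linarith
    have t2 : W0 ≤ W1 + θ * (c1 * L - D1) := by
      rw [hD1]; nlinarith [s2]
    have t3 : a (x' + (1 - θ) * L) - x' * b (x' + (1 - θ) * L)
        ≤ W1 + (1 - θ) * (D1 + c1 * L) := by
      rw [hD1]; linarith
    have t4 : 0 ≤ D - D1 + c1 * L := by
      by_contra hcon
      push Not at hcon
      have := mul_neg_of_pos_of_neg hθ0 hcon
      linarith
    have t5 : c1 * L ≤ 0 := mul_nonpos_of_nonpos_of_nonneg hc10 (by linarith)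
    have t6 : (1 - θ) * (D1 + c1 * L) ≤ (1 - θ) * D :=
      mul_le_mul_of_nonneg_left (by linarith) (by linarith)
    rw [ey']
    linarith

noncomputable def misa (q α κ z r : ℝ) : ℝ :=
  q / (q+1) * (z * z ^ q) + (max r (κ * z) * (max r (κ * z)) ^ q - max r (κ * z) * z ^ q)
    + α / (q+1) * (max r z * (max r z) ^ q - (q+1) * (max r z * z ^ q) + q * (z * z ^ q))

noncomputable def misad (q α κ z r : ℝ) : ℝ :=
  ((q+1) * (max r (κ * z)) ^ q - z ^ q) + α * ((max r z) ^ q - z ^ q)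

noncomputable def misb (q α κ z r : ℝ) : ℝ :=
  (1 + α) * ((q+1) * (max r (κ * z)) ^ q - z ^ q)

noncomputable def misbd (q α κ z r : ℝ) : ℝ :=
  if κ * z ≤ r then (1 + α) * ((q+1) * (q * r ^ (q-1))) else 0

noncomputable def misU (q α κ x y z : ℝ) : ℝ :=
  misa q α κ z (x + |y|) - x * misb q α κ z (x + |y|)

noncomputable def misG (q α κ x y z : ℝ) : ℝ :=
  misad q α κ z (x + |y|) - x * misbd q α κ z (x + |y|)

noncomputable def misA (q α κ x y z : ℝ) : ℝ :=
  misG q α κ x y z - misb q α κ z (x + |y|)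

noncomputable def misB (q α κ x y z : ℝ) : ℝ :=
  if 0 ≤ y then misG q α κ x y z else - misG q α κ x y z

lemma mis_hasDeriv_psi {q : ℝ} (hq : 1 ≤ q) (Z r : ℝ) :
    HasDerivAt (fun m : ℝ => m * m ^ q - m * Z) ((q+1) * r ^ q - Z) r := by
  have h : HasDerivAt (fun m : ℝ => m * m ^ q - m * Z) _ r := ((hasDerivAt_id r).mul
    (Real.hasDerivAt_rpow_const (Or.inr hq))).sub ((hasDerivAt_id r).mul_const Z)
  convert h using 1
  have := mis_mul_rpow r hq
  simp only [id]
  linear_combination -q * this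

lemma misa_hasDeriv {q α κ z : ℝ} (hq : 1 ≤ q) (hκ : 0 ≤ κ) (hκq : (q+1) * κ ^ q = 1)
    (hz : 0 ≤ z) (r : ℝ) : HasDerivAt (misa q α κ z) (misad q α κ z r) r := by
  have h1 := mis_deriv_max (c := κ * z) (fun r => mis_hasDeriv_psi hq (z ^ q) r) (by
    rw [Real.mul_rpow hκ hz]; linear_combination z ^ q * hκq) r
  have h2' : ∀ r, HasDerivAt (fun m : ℝ => m * m ^ q - (q+1) * (m * z ^ q))
      ((q+1) * (r ^ q - z ^ q)) r := by
    intro r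
    have h := (mis_hasDeriv_psi hq (z ^ q) r).sub
      (((hasDerivAt_id r).mul_const (z ^ q)).const_mul q)
    refine (h.congr_deriv (by ring)).congr_of_eventuallyEq (Filter.Eventually.of_forall ?_)
    intro m
    simp only [Pi.sub_apply, id]
    ring
  have h2 := mis_deriv_max (c := z) h2' (by simp) r
  have h3 := (h1.const_add (q / (q+1) * (z * z ^ q))).add
    ((h2.add_const (q * (z * z ^ q))).const_mul (α / (q+1)))
  have h4 : HasDerivAt (misa q α κ z) _ r := h3
  convert h4 using 1
  unfold misad
  have : q + 1 ≠ 0 := by linarith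
  field_simp

section
variable {q α κ z : ℝ} (hq : 1 ≤ q) (hα : 0 ≤ α) (hα1 : α ≤ 1) (hκ : 0 ≤ κ) (hκ1 : κ ≤ 1)
  (hκq : (q+1) * κ ^ q = 1) (hz : 0 ≤ z)

lemma misb_mono (hq : 1 ≤ q) (hα : 0 ≤ α) (r s : ℝ) (hr : 0 ≤ r) (hrs : r ≤ s) :
    misb q α κ z r ≤ misb q α κ z s := by
  unfold misb
  have : (max r (κ * z)) ^ q ≤ (max s (κ * z)) ^ q :=
    Real.rpow_le_rpow (le_max_of_le_left hr) (max_le_max_right _ hrs) (by linarith)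
  gcongr

lemma misb_sub (hq : 1 ≤ q) (hα : 0 ≤ α) (r s : ℝ) (hr : 0 ≤ r) (hs : 0 ≤ s) :
    misb q α κ z r + misbd q α κ z r * (s - r) ≤ misb q α κ z s := by
  by_cases h : κ * z ≤ r
  · unfold misb misbd
    rw [if_pos h, max_eq_left h]
    have h1 := mis_tangent hq hs hr
    have h2 : s ^ q ≤ (max s (κ * z)) ^ q :=
      Real.rpow_le_rpow hs (le_max_left _ _) (by linarith)
    have h3 : (1 + α) * ((q+1) * (r ^ q + q * r ^ (q-1) * (s - r)))
      ≤ (1 + α) * ((q+1) * (max s (κ * z)) ^ q) := by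
      gcongr
      linarith
    linarith
  · unfold misbd
    rw [if_neg h, zero_mul, add_zero]
    unfold misb
    have : (max r (κ * z)) ^ q ≤ (max s (κ * z)) ^ q := by
      rw [max_eq_right (not_le.1 h).le]
      exact Real.rpow_le_rpow (hr.trans (not_le.1 h).le) (le_max_right _ _) (by linarith)
    gcongr

lemma mis_diff (hq : 1 ≤ q) (hα : 0 ≤ α) (hκ1 : κ ≤ 1) (hz : 0 ≤ z)
    (r s : ℝ) (hr : 0 ≤ r) (hrs : r ≤ s) :
    misad q α κ z s - misad q α κ z r ≤ misb q α κ z s - misb q α κ z r := by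
  unfold misad misb
  have hkz : κ * z ≤ z := by nlinarith
  have h1 : (max r (κ * z)) ^ q ≤ (max s (κ * z)) ^ q :=
    Real.rpow_le_rpow (le_max_of_le_left hr) (max_le_max_right _ hrs) (by linarith)
  have key : (max s z) ^ q - (max r z) ^ q ≤ (max s (κ * z)) ^ q - (max r (κ * z)) ^ q := by
    rcases le_total s z with h | h
    · rw [max_eq_right h, max_eq_right (hrs.trans h)]; linarith
    · rw [max_eq_left h, max_eq_left (hkz.trans h)]
      have : (max r (κ * z)) ^ q ≤ (max r z) ^ q :=
        Real.rpow_le_rpow (le_max_of_le_left hr) (max_le_max_left _ hkz) (by linarith)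
      linarith
  have h2 : 0 ≤ α * (q * ((max s (κ * z)) ^ q - (max r (κ * z)) ^ q)) :=
    mul_nonneg hα (mul_nonneg (by linarith) (by linarith))
  nlinarith [mul_le_mul_of_nonneg_left key hα]

lemma misb_nonneg (hq : 1 ≤ q) (hα : 0 ≤ α) (hκ : 0 ≤ κ)
    (hκq : (q+1) * κ ^ q = 1) (hz : 0 ≤ z) (r : ℝ) : 0 ≤ misb q α κ z r := by
  unfold misb
  have : (κ * z) ^ q ≤ (max r (κ * z)) ^ q :=
    Real.rpow_le_rpow (by positivity) (le_max_right _ _) (by linarith)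
  rw [Real.mul_rpow hκ hz] at this
  have h2 : (q+1) * (κ ^ q * z ^ q) = z ^ q := by rw [← mul_assoc, hκq, one_mul]
  apply mul_nonneg (by linarith)
  nlinarith

lemma misad_le (hq : 1 ≤ q) (hα : 0 ≤ α) (hκ : 0 ≤ κ) (hκ1 : κ ≤ 1)
    (hκq : (q+1) * κ ^ q = 1) (hz : 0 ≤ z) (r : ℝ) (hr : 0 ≤ r) :
    misad q α κ z r ≤ r * misbd q α κ z r := by
  have hkz : κ * z ≤ z := by nlinarith
  unfold misad misbd
  by_cases h : κ * z ≤ r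
  · rw [if_pos h, max_eq_left h]
    have h1 := mis_mul_rpow r hq
    have hrq : 0 ≤ r ^ q := Real.rpow_nonneg hr q
    have hzq : 0 ≤ z ^ q := Real.rpow_nonneg hz q
    have h2 : (max r z) ^ q - z ^ q ≤ r ^ q := by
      rcases le_total r z with h | h
      · rw [max_eq_right h]; linarith
      · rw [max_eq_left h]; linarith
    have h3 : r * ((1 + α) * ((q+1) * (q * r ^ (q-1)))) = (1 + α) * ((q+1) * (q * r ^ q)) := by
      rw [← h1]; ring
    rw [h3]
    have h4 := mul_le_mul_of_nonneg_left h2 hα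
    have h5 : 0 ≤ (q - 1) * ((q+1) * r ^ q) := by
      apply mul_nonneg (by linarith); apply mul_nonneg (by linarith) hrq
    have h6 : 0 ≤ α * ((q + 1) * q * r ^ q - r ^ q) := by
      apply mul_nonneg hα
      nlinarith
    nlinarith
  · have h' := (not_le.1 h).le
    rw [if_neg h, max_eq_right h', max_eq_right (h'.trans hkz), Real.mul_rpow hκ hz]
    have h2 : (q+1) * (κ ^ q * z ^ q) = z ^ q := by rw [← mul_assoc, hκq, one_mul]
    simp [h2]

/-- pointwise concavity with fixed third variable -/
lemma misU_step_fixed (hq : 1 ≤ q) (hα : 0 ≤ α) (hκ : 0 ≤ κ) (hκ1 : κ ≤ 1)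
    (hκq : (q+1) * κ ^ q = 1) (hz : 0 ≤ z) {x y x' y' : ℝ} (hx : 0 ≤ x) (hx' : 0 ≤ x')
    (hk : |y' - y| ≤ |x' - x|) :
    misU q α κ x' y' z ≤ misU q α κ x y z + misA q α κ x y z * (x' - x)
      + misB q α κ x y z * (y' - y) := by
  have main : ∀ {y y' : ℝ}, 0 ≤ y → |y' - y| ≤ |x' - x| → 
      misU q α κ x' y' z ≤ misU q α κ x y z + misA q α κ x y z * (x' - x)
      + misG q α κ x y z * (y' - y) := by
    intro y y' hy hk
    have h := mis_step_abs (misa_hasDeriv (α := α) hq hκ hκq hz) (misb_sub (κ := κ) (z := z) hq hα)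
      (misb_mono (κ := κ) (z := z) hq hα) (mis_diff hq hα hκ1 hz)
      (misad_le hq hα hκ hκ1 hκq hz) hx hx' hy hk
    unfold misU misA misG
    rw [abs_of_nonneg hy]
    exact h
  unfold misB
  by_cases hy : 0 ≤ y
  · rw [if_pos hy]; exact main hy hk
  · rw [if_neg hy]
    have h := main (y := -y) (y' := -y') (by linarith) (by
      rw [← abs_neg]; convert hk using 2; ring)
    unfold misU misA misG at h ⊢
    simp only [abs_neg] at h
    linarith

lemma misU_mono_z (hq : 1 ≤ q) (hα : 0 ≤ α) (hκ1 : κ ≤ 1) (hz : 0 ≤ z)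
    {x y : ℝ} (hx : 0 ≤ x) : misU q α κ x y (max z |y|) ≤ misU q α κ x y z := by
  rcases le_total |y| z with h | h
  · rw [max_eq_left h]
  rw [max_eq_right h]
  have hy := abs_nonneg y
  set w := |y| with hw
  unfold misU misa misb
  rw [← hw]
  have e1 : max (x + w) (κ * w) = x + w := max_eq_left (by nlinarith)
  have e2 : max (x + w) (κ * z) = x + w := max_eq_left (by nlinarith)
  have e3 : max (x + w) w = x + w := max_eq_left (by linarith)
  have e4 : max (x + w) z = x + w := max_eq_left (by linarith)
  rw [e1, e2, e3, e4]
  have t := mis_tangent (q := q + 1) (by linarith) hy hz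
  have p1 : ∀ v : ℝ, 0 ≤ v → v ^ (q+1) = v * v ^ q := by
    intro v hv
    rw [Real.rpow_add_one' hv (by linarith)]; ring
  rw [p1 w hy, p1 z hz, add_sub_cancel_right] at t
  have hq1 : 0 < q + 1 := by linarith
  have t2 : - (1 / (q+1)) * (w * w ^ q) ≤ q / (q+1) * (z * z ^ q) - w * z ^ q := by
    rw [← sub_nonneg]
    have : q / (q+1) * (z * z ^ q) - w * z ^ q - - (1 / (q+1)) * (w * w ^ q)
      = (w * w ^ q - (z * z ^ q + (q+1) * z ^ q * (w - z))) / (q+1) := by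
      field_simp; ring
    rw [this]
    apply div_nonneg _ hq1.le
    linarith
  have t3 := mul_le_mul_of_nonneg_left t2 (by linarith : 0 ≤ 1 + α)
  rw [← sub_nonneg] at t3 ⊢
  refine t3.trans_eq ?_
  field_simp
  ring

lemma mis_drift (hq : 1 ≤ q) (hα : 0 ≤ α) (hα1 : α ≤ 1) (hκ : 0 ≤ κ) (hκ1 : κ ≤ 1)
    (hκq : (q+1) * κ ^ q = 1) (hz : 0 ≤ z) {x y : ℝ} (hx : 0 ≤ x) (hy : |y| ≤ z) :
    misA q α κ x y z + α * |misB q α κ x y z| ≤ 0 := by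
  have hB : |misB q α κ x y z| = |misG q α κ x y z| := by
    unfold misB; split_ifs <;> simp
  rw [hB]
  have hb0 := misb_nonneg hq hα hκ hκq hz (x + |y|)
  have hkz : κ * z ≤ z := by nlinarith
  have hya := abs_nonneg y
  unfold misA
  rcases le_total (misG q α κ x y z) 0 with h | h
  · rw [abs_of_nonpos h]
    nlinarith
  · rw [abs_of_nonneg h]
    suffices (1 + α) * misG q α κ x y z ≤ misb q α κ z (x + |y|) by linarith
    have hG : misG q α κ x y z ≤ (q+1) * (max (x + |y|) (κ * z)) ^ q - z ^ q := by
      unfold misG misad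
      suffices α * ((max (x + |y|) z) ^ q - z ^ q) ≤ x * misbd q α κ z (x + |y|) by linarith
      rcases le_total (x + |y|) z with h1 | h1
      · rw [max_eq_right h1, sub_self, mul_zero]
        unfold misbd
        apply mul_nonneg hx
        split_ifs
        · have : 0 ≤ (x + |y|) ^ (q-1) := Real.rpow_nonneg (by linarith) _
          positivity
        · exact le_rfl
      · rw [max_eq_left h1]
        unfold misbd
        rw [if_pos (hkz.trans h1)]
        set r := x + |y| with hr
        have hr0 : 0 ≤ r := by linarith
        have t := mis_tangent hq hz hr0
        have hP : 0 ≤ r ^ (q-1) := Real.rpow_nonneg hr0 _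
        have hrq : z ^ q ≤ r ^ q := Real.rpow_le_rpow hz h1 (by linarith)
        have t1 : r ^ q - z ^ q ≤ q * r ^ (q-1) * x := by
          have : q * r ^ (q-1) * (r - z) ≤ q * r ^ (q-1) * x := by
            gcongr
            linarith
          linarith
        have t2 : α * (r ^ q - z ^ q) ≤ 1 * (r ^ q - z ^ q) := by
          gcongr
        have t4 : 0 ≤ q * r ^ (q-1) * x := by positivity
        have t5 : x * ((1 + α) * ((q + 1) * (q * r ^ (q - 1)))) =
          (1 + α) * (q + 1) * (q * r ^ (q-1) * x) := by ring
        rw [t5]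
        have t6 : 1 ≤ (1 + α) * (q + 1) := by nlinarith
        nlinarith
    unfold misb
    gcongr

lemma misU_init (hq : 1 ≤ q) (hα : 0 ≤ α) (hκ1 : κ ≤ 1) {x y : ℝ} (hxy : |y| ≤ x) :
    misU q α κ x y |y| ≤ 0 := by
  have hy := abs_nonneg y
  set w := |y| with hw
  unfold misU misa misb
  rw [← hw]
  have hx : 0 ≤ x := hy.trans hxy
  have e1 : max (x + w) (κ * w) = x + w := max_eq_left (by nlinarith)
  have e3 : max (x + w) w = x + w := max_eq_left (by linarith)
  rw [e1, e3]
  have hq1 : 0 < q + 1 := by linarith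
  have hr : 0 ≤ x + w := by linarith
  have hR : 0 ≤ (x + w) ^ q := Real.rpow_nonneg hr _
  have hW : 0 ≤ w ^ q := Real.rpow_nonneg hy _
  set R := (x + w) ^ q
  set W := w ^ q
  have k1 : q / (q + 1) * (w * W) + ((x + w) * R - (x + w) * W) +
        α / (q + 1) * ((x + w) * R - (q + 1) * ((x + w) * W) + q * (w * W)) -
      x * ((1 + α) * ((q + 1) * R - W)) =
      (-(1 + α) * (w * W) + R * ((q + 1 + α) * (x + w) - (q+1)^2 * (1 + α) * x)) / (q+1) := by
    field_simp; ring
  rw [k1]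
  apply div_nonpos_of_nonpos_of_nonneg _ hq1.le
  have k2 : (q + 1 + α) * (x + w) - (q+1)^2 * (1 + α) * x ≤ 0 := by
    have : (q + 1 + α) * (x + w) ≤ (q + 1 + α) * (2 * x) := by
      gcongr; linarith
    have h2 : 0 ≤ (q+1)^2 * (1 + α) - 2 * (q + 1 + α) := by
      have h3 : 0 ≤ (q+1) * (q-1) := mul_nonneg hq1.le (by linarith)
      have h4 : 0 ≤ α * ((q+1)^2 - 2) := mul_nonneg hα (by nlinarith)
      nlinarith
    nlinarith
  have k3 : 0 ≤ (1 + α) * (w * W) := by positivity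
  nlinarith [mul_nonneg hR (neg_nonneg.2 k2)]

lemma misU_major (hq : 1 ≤ q) (hα : 0 ≤ α) (hκ : 0 ≤ κ) 
    (hκq : (q+1) * κ ^ q = 1) (hz : 0 ≤ z) {x y : ℝ} (hx : 0 ≤ x) :
    z ^ (q+1) - ((1 + α) * (q+1)) ^ (q+1) * x ^ (q+1) ≤ (q+1)^2 / q * misU q α κ x y z := by
  have p1 : ∀ v : ℝ, 0 ≤ v → v ^ (q+1) = v * v ^ q := by
    intro v hv
    rw [Real.rpow_add_one' hv (by linarith)]; ring
  have hq0 : 0 < q := by linarith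
  have hq1 : 0 < q + 1 := by linarith
  have hya := abs_nonneg y
  set r := x + |y| with hr
  have hr0 : 0 ≤ r := by linarith
  set m := max r (κ * z) with hm
  have hm0 : 0 ≤ m := le_max_of_le_left hr0
  have hmZ : z ^ q ≤ (q+1) * m ^ q := by
    have : (κ * z) ^ q ≤ m ^ q :=
      Real.rpow_le_rpow (by positivity) (le_max_right _ _) (by linarith)
    rw [Real.mul_rpow hκ hz] at this
    have h2 : (q+1) * (κ ^ q * z ^ q) = z ^ q := by rw [← mul_assoc, hκq, one_mul]
    nlinarith
  -- the auxiliary point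
  obtain ⟨w, hw0, hwq⟩ : ∃ w : ℝ, 0 ≤ w ∧ q * w ^ q = (q+1) * m ^ q - z ^ q := by
    refine ⟨(((q+1) * m ^ q - z ^ q) / q) ^ (1/q), ?_, ?_⟩
    · exact Real.rpow_nonneg (div_nonneg (by linarith) hq0.le) _
    · rw [← Real.rpow_mul (div_nonneg (by linarith) hq0.le), one_div_mul_cancel hq0.ne',
        Real.rpow_one]
      field_simp
  have hZ0 : 0 ≤ z ^ q := Real.rpow_nonneg hz _
  have hW0 : 0 ≤ w ^ q := Real.rpow_nonneg hw0 _
  -- power mean inequality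
  have key : q * (w * w ^ q - z * z ^ q) ≤ (q+1) * (m * (w ^ q - z ^ q)) := by
    rcases le_or_gt z w with hzw | hzw
    · have hWZ : z ^ q ≤ w ^ q := Real.rpow_le_rpow hz hzw hq0.le
      have hmean : q * w + z ≤ (q+1) * m := by
        have t1 := mis_tangent hq hw0 hm0
        have t2 := mis_tangent hq hz hm0
        rcases hm0.eq_or_lt with h0 | hmp
        · have : m ^ q = 0 := by rw [← h0]; exact Real.zero_rpow hq0.ne'
          have hw' : w ^ q = 0 := by nlinarith
          have hz' : z ^ q = 0 := by nlinarith
          rw [Real.rpow_eq_zero hw0 hq0.ne'] at hw'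
          rw [Real.rpow_eq_zero hz hq0.ne'] at hz'
          rw [hw', hz']; nlinarith
        · have hP : 0 < q * m ^ (q-1) := mul_pos hq0 (Real.rpow_pos_of_pos hmp _)
          have : q * m ^ (q-1) * (q * w + z - (q+1) * m) ≤ 0 := by nlinarith
          by_contra hcon
          push Not at hcon
          nlinarith [mul_pos hP (sub_pos.2 hcon)]
      have t3 := mis_tangent hq hw0 hz
      have hz1 := mis_mul_rpow z hq
      have t4 := mul_le_mul_of_nonneg_left t3 hz
      have t5 : z * (z ^ q + q * z ^ (q-1) * (w - z)) = z * z ^ q + q * z ^ q * (w - z) := by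
        rw [← hz1]; ring
      rw [t5] at t4
      have t6 := mul_le_mul_of_nonneg_right hmean (sub_nonneg.2 hWZ)
      nlinarith
    · have hzp : 0 < z := lt_of_le_of_lt hw0 hzw
      have hWZ : w ^ q ≤ z ^ q := Real.rpow_le_rpow hw0 hzw.le hq0.le
      have t1 := mis_tangent hq hw0 hz
      have t2 := mis_tangent hq hm0 hz
      have hz1 := mis_mul_rpow z hq
      have hP : 0 < z ^ (q-1) := Real.rpow_pos_of_pos hzp _
      set P := z ^ (q-1) with hPdef
      set W := w ^ q
      set M := m ^ q
      rw [← hz1] at t1 t2 hwq hWZ ⊢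
      -- `d = (z*P - W)/P`
      obtain ⟨d, hd⟩ : ∃ d, W = (z - d) * P := ⟨z - W / P, by field_simp; ring⟩
      have hd0 : 0 ≤ d := by
        rw [hd] at hWZ
        have : 0 ≤ d * P := by linarith
        exact nonneg_of_mul_nonneg_left this hP
      have hdz : d ≤ z := by
        rw [hd] at hW0
        have := nonneg_of_mul_nonneg_left hW0 hP
        linarith
      have a1 : q * w ≤ q * z - d := by
        rw [hd] at t1
        have : (q * w - q * z + d) * P ≤ 0 := by linarith
        have := nonpos_of_mul_nonpos_left this hP
        linarith
      have a2 : (q+1) * m ≤ (q+1) * z - d := by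
        have e : (q+1) * M = (q+1) * (z * P) - q * d * P := by rw [hd] at hwq; linarith
        have : (q * ((q+1) * m - (q+1) * z + d)) * P ≤ 0 := by nlinarith
        have := nonpos_of_mul_nonpos_left this hP
        have := nonpos_of_mul_nonpos_right this hq0
        linarith
      rw [hd]
      have a3 := mul_le_mul_of_nonneg_right a1 (mul_nonneg (sub_nonneg.2 hdz) hP.le)
      have a4 := mul_le_mul_of_nonneg_right a2 (mul_nonneg hd0 hP.le)
      nlinarith
  -- Young
  have young := mis_tangent (q := q+1) (by linarith) (mul_nonneg (by positivity : 0 ≤ (1 + α) * (q+1)) hx) hw0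
  rw [add_sub_cancel_right, p1 w hw0, Real.mul_rpow (by positivity) hx] at young
  rw [p1 z hz]
  set C := (1 + α) * (q+1) with hC
  -- the extra nonnegative term
  have hn0 : 0 ≤ max r z := le_max_of_le_left hr0
  have extra : 0 ≤ max r z * (max r z) ^ q - (q+1) * (max r z * z ^ q) + q * (z * z ^ q) := by
    have t := mis_tangent (q := q + 1) (by linarith) hn0 hz
    rw [p1 _ hn0, p1 z hz, add_sub_cancel_right] at t
    linarith
  have extra2 := mul_nonneg (div_nonneg hα hq1.le) extra
  have lower : q / (q+1) * (z * z ^ q) + (m * m ^ q - m * z ^ q)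
      - x * ((1 + α) * ((q+1) * m ^ q - z ^ q)) ≤ misU q α κ x y z := by
    unfold misU misa misb
    rw [← hr, ← hm]
    linarith
  have hMe : m ^ q = (q * w ^ q + z ^ q) / (q+1) := by field_simp; linarith
  have lower2 := mul_le_mul_of_nonneg_left lower (by positivity : 0 ≤ (q+1)^2 / q)
  refine le_trans ?_ lower2
  have e : (q+1)^2 / q * (q / (q+1) * (z * z ^ q) + (m * m ^ q - m * z ^ q)
      - x * ((1 + α) * ((q+1) * m ^ q - z ^ q))) =
      (q+1) * (z * z ^ q) + (q+1) * (m * (w ^ q - z ^ q)) - (q+1) * (C * x) * w ^ q := by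
    rw [hMe, hC]; field_simp; ring
  rw [e]
  nlinarith
end

lemma misG_bound {q α κ x y z : ℝ} (hq : 1 ≤ q) (hα : 0 ≤ α) (hα1 : α ≤ 1) (hκ : 0 ≤ κ)
    (hκ1 : κ ≤ 1) (hx : 0 ≤ x) (hz : 0 ≤ z) :
    |misb q α κ z (x + |y|)| ≤ (2 * q + 4) * (x + |y| + z) ^ q ∧
    |misG q α κ x y z| ≤ (q + 3 + 2 * (q + 1) * q) * (x + |y| + z) ^ q ∧
    |misU q α κ x y z| ≤ (2 * q + 8) * ((x + |y| + z) * (x + |y| + z) ^ q) := by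
  have hy := abs_nonneg y
  have hkz : κ * z ≤ z := by nlinarith
  have hkz0 : 0 ≤ κ * z := by positivity
  have hq1 : 0 < q + 1 := by linarith
  set S := x + |y| + z with hS
  have hS0 : 0 ≤ S := by positivity
  set r := x + |y| with hr
  have hr0 : 0 ≤ r := by positivity
  have hm0 : 0 ≤ max r (κ * z) := le_max_of_le_left hr0
  have hn0 : 0 ≤ max r z := le_max_of_le_left hr0
  have hmS : max r (κ * z) ≤ S := max_le (by linarith) (by linarith)
  have hnS : max r z ≤ S := max_le (by linarith) (by linarith)
  have hM := Real.rpow_le_rpow hm0 hmS (by linarith : 0 ≤ q)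
  have hN := Real.rpow_le_rpow hn0 hnS (by linarith : 0 ≤ q)
  have hZ := Real.rpow_le_rpow hz (by linarith : z ≤ S) (by linarith : 0 ≤ q)
  have hM0 := Real.rpow_nonneg hm0 q
  have hN0 := Real.rpow_nonneg hn0 q
  have hZ0 := Real.rpow_nonneg hz q
  have hT0 := Real.rpow_nonneg hS0 q
  have hxb : 0 ≤ x * misbd q α κ z r ∧ x * misbd q α κ z r ≤ 2 * (q+1) * q * S ^ q := by
    unfold misbd
    split_ifs
    · have h1 := Real.rpow_le_rpow hr0 (by linarith : r ≤ S) (by linarith : 0 ≤ q - 1)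
      have h2 := Real.rpow_nonneg hr0 (q-1)
      refine ⟨by positivity, ?_⟩
      rw [← mis_mul_rpow S hq]
      have h3 : x * r ^ (q-1) ≤ S * S ^ (q-1) :=
        mul_le_mul (by linarith) h1 h2 hS0
      calc x * ((1 + α) * ((q + 1) * (q * r ^ (q - 1))))
          = (1 + α) * ((q+1) * q) * (x * r ^ (q-1)) := by ring
        _ ≤ (1 + 1) * ((q+1) * q) * (S * S ^ (q-1)) := by gcongr
        _ = _ := by ring
    · refine ⟨by simp, ?_⟩
      rw [mul_zero]; positivity
  unfold misU misG
  rw [← hr]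
  have hbb : |misb q α κ z r| ≤ (2 * q + 4) * S ^ q := by
    unfold misb
    rw [abs_mul, abs_of_nonneg (by linarith : 0 ≤ 1 + α)]
    have : |(q+1) * (max r (κ * z)) ^ q - z ^ q| ≤ (q + 2) * S ^ q := by
      rw [abs_le]; constructor <;> nlinarith
    calc _ ≤ (1 + 1) * ((q + 2) * S ^ q) := by gcongr
      _ = _ := by ring
  refine ⟨hbb, ?_, ?_⟩
  · have h1 : |misad q α κ z r| ≤ (q + 3) * S ^ q := by
      unfold misad
      have h2 : |α * ((max r z) ^ q - z ^ q)| ≤ 1 * S ^ q := by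
        rw [abs_mul, abs_of_nonneg hα]
        gcongr
        rw [abs_le]; constructor <;> linarith
      have h3 : |(q+1) * (max r (κ * z)) ^ q - z ^ q| ≤ (q + 2) * S ^ q := by
        rw [abs_le]; constructor <;> nlinarith
      refine (abs_add_le _ _).trans ?_
      linarith
    refine (abs_sub _ _).trans ?_
    rw [abs_of_nonneg hxb.1]
    linarith [hxb.2]
  · have h4 : |x * misb q α κ z r| ≤ S * ((2 * q + 4) * S ^ q) := by
      rw [abs_mul, abs_of_nonneg hx]
      gcongr
      linarith
    have hzZ : z * z ^ q ≤ S * S ^ q := mul_le_mul (by linarith) hZ hZ0 hS0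
    have hmM : max r (κ * z) * (max r (κ * z)) ^ q ≤ S * S ^ q := mul_le_mul hmS hM hM0 hS0
    have hmZ : max r (κ * z) * z ^ q ≤ S * S ^ q := mul_le_mul hmS hZ hZ0 hS0
    have hnN : max r z * (max r z) ^ q ≤ S * S ^ q := mul_le_mul hnS hN hN0 hS0
    have hnZ : max r z * z ^ q ≤ S * S ^ q := mul_le_mul hnS hZ hZ0 hS0
    have hzZ0 := mul_nonneg hz hZ0
    have hmM0 := mul_nonneg hm0 hM0
    have hmZ0 := mul_nonneg hm0 hZ0
    have hnN0 := mul_nonneg hn0 hN0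
    have hnZ0 := mul_nonneg hn0 hZ0
    have h5 : |misa q α κ z r| ≤ 4 * (S * S ^ q) := by
      unfold misa
      have a1 : |q / (q+1) * (z * z ^ q)| ≤ 1 * (S * S ^ q) := by
        rw [abs_mul, abs_of_nonneg hzZ0, abs_of_nonneg (by positivity)]
        gcongr
        rw [div_le_one hq1]; linarith
      have a2 : |max r (κ * z) * (max r (κ * z)) ^ q - max r (κ * z) * z ^ q| ≤ S * S ^ q := by
        rw [abs_le]; constructor <;> linarith
      have a3 : |α / (q+1) * (max r z * (max r z) ^ q - (q+1) * (max r z * z ^ q)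
          + q * (z * z ^ q))| ≤ 1 / (q+1) * ((q+1) * (S * S ^ q)) := by
        rw [abs_mul, abs_of_nonneg (by positivity : 0 ≤ α / (q+1))]
        gcongr
        have b1 := mul_le_mul_of_nonneg_left hnZ hq1.le
        have b2 := mul_le_mul_of_nonneg_left hzZ (by linarith : 0 ≤ q)
        have b3 := mul_nonneg hq1.le hnZ0
        have b4 := mul_nonneg (by linarith : 0 ≤ q) hzZ0
        rw [abs_le]; constructor <;> nlinarith
      have a4 : 1 / (q+1) * ((q+1) * (S * S ^ q)) = S * S ^ q := by field_simp
      rw [a4] at a3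
      refine (abs_add_le _ _).trans ?_
      have := abs_add_le (q / (q+1) * (z * z ^ q))
        (max r (κ * z) * (max r (κ * z)) ^ q - max r (κ * z) * z ^ q)
      have hh := mul_nonneg hS0 hT0
      linarith
    refine (abs_sub _ _).trans ?_
    linarith

lemma misAB_bound {q α κ x y z : ℝ} (hq : 1 ≤ q) (hα : 0 ≤ α) (hα1 : α ≤ 1) (hκ : 0 ≤ κ)
    (hκ1 : κ ≤ 1) (hx : 0 ≤ x) (hz : 0 ≤ z) :
    |misA q α κ x y z| ≤ (3 * q + 7 + 2 * (q + 1) * q) * (x + |y| + z) ^ q ∧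
    |misB q α κ x y z| ≤ (3 * q + 7 + 2 * (q + 1) * q) * (x + |y| + z) ^ q := by
  obtain ⟨h1, h2, -⟩ := misG_bound (y := y) hq hα hα1 hκ hκ1 hx hz
  have hS : 0 ≤ (x + |y| + z) ^ q := Real.rpow_nonneg (by positivity) _
  constructor
  · unfold misA
    refine (abs_sub _ _).trans ?_
    linarith
  · have hB : |misB q α κ x y z| = |misG q α κ x y z| := by
      unfold misB; split_ifs <;> simp
    rw [hB]
    nlinarith

lemma misU_meas (q α κ : ℝ) : Measurable (fun v : ℝ × ℝ × ℝ => misU q α κ v.1 v.2.1 v.2.2) := by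
  unfold misU misa misb
  fun_prop

lemma misG_meas (q α κ : ℝ) : Measurable (fun v : ℝ × ℝ × ℝ => misG q α κ v.1 v.2.1 v.2.2) := by
  unfold misG misad misbd
  refine Measurable.sub (by fun_prop) (Measurable.mul (by fun_prop) ?_)
  refine Measurable.ite (measurableSet_le (by fun_prop) (by fun_prop)) ?_ ?_ <;> fun_prop

lemma misA_meas (q α κ : ℝ) : Measurable (fun v : ℝ × ℝ × ℝ => misA q α κ v.1 v.2.1 v.2.2) := by
  unfold misA
  refine (misG_meas q α κ).sub ?_
  unfold misb
  fun_prop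

lemma misB_meas (q α κ : ℝ) : Measurable (fun v : ℝ × ℝ × ℝ => misB q α κ v.1 v.2.1 v.2.2) := by
  unfold misB
  exact Measurable.ite (measurableSet_le (by fun_prop) (by fun_prop)) (misG_meas q α κ)
    (misG_meas q α κ).neg

/-- running maximum -/
noncomputable def misZ {Ω : Type*} (g : ℕ → Ω → ℝ) : ℕ → Ω → ℝ
  | 0 => fun ω => |g 0 ω|
  | n+1 => fun ω => max (misZ g n ω) |g (n+1) ω|

lemma misZ_ge {Ω : Type*} (g : ℕ → Ω → ℝ) (n : ℕ) (ω : Ω) : |g n ω| ≤ misZ g n ω := by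
  cases n with
  | zero => exact le_rfl
  | succ n => exact le_max_right _ _

lemma misZ_nonneg {Ω : Type*} (g : ℕ → Ω → ℝ) (n : ℕ) (ω : Ω) : 0 ≤ misZ g n ω :=
  (abs_nonneg _).trans (misZ_ge g n ω)

lemma misZ_mono {Ω : Type*} (g : ℕ → Ω → ℝ) (ω : Ω) : Monotone (fun n => misZ g n ω) :=
  monotone_nat_of_le_succ fun _ => le_max_left _ _

lemma misZ_adapted {Ω : Type*} {m0 : MeasurableSpace Ω} {𝓕 : Filtration ℕ m0} {g : ℕ → Ω → ℝ}
    (hg : Adapted 𝓕 g) : ∀ n, Measurable[𝓕 n] (misZ g n) := by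
  intro n
  induction n with
  | zero => exact continuous_abs.measurable.comp (hg 0)
  | succ n ih =>
    exact (ih.mono (𝓕.mono n.le_succ) le_rfl).max
      (continuous_abs.measurable.comp (hg (n+1)))

lemma mis_integrable_rpow {Ω : Type*} {m0 : MeasurableSpace Ω} {μ : Measure Ω} {q : ℝ}
    (hq : 1 ≤ q) {T : Ω → ℝ} (hT : MemLp T (ENNReal.ofReal (q+1)) μ) (hT0 : 0 ≤ᵐ[μ] T) :
    Integrable (fun ω => T ω * T ω ^ q) μ := by
  have h := hT.integrable_norm_rpow (by simp; linarith) (by simp)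
  rw [ENNReal.toReal_ofReal (by linarith)] at h
  refine h.congr ?_
  filter_upwards [hT0] with ω hω
  rw [Real.norm_of_nonneg hω, Real.rpow_add_one' hω (by linarith), mul_comm]

section
variable {Ω : Type*} {m0 : MeasurableSpace Ω} {μ : Measure Ω} [IsProbabilityMeasure μ]
  {𝓕 : Filtration ℕ m0} {f g : ℕ → Ω → ℝ} {α q κ : ℝ}

lemma mis_memLp_g (hfL : ∀ n, MemLp (f n) (ENNReal.ofReal (q+1)) μ)
    (hgint : ∀ n : ℕ, Integrable (g n) μ)
    (hsub0 : ∀ᵐ ω ∂μ, |g 0 ω| ≤ |f 0 ω|)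
    (hsub : ∀ n : ℕ, ∀ᵐ ω ∂μ, |g (n+1) ω - g n ω| ≤ |f (n+1) ω - f n ω|) (n : ℕ) :
    MemLp (g n) (ENNReal.ofReal (q+1)) μ := by
  induction n with
  | zero => exact (hfL 0).mono (hgint 0).1 (by simpa [Real.norm_eq_abs] using hsub0)
  | succ n ih =>
    have h1 : MemLp (g (n+1) - g n) (ENNReal.ofReal (q+1)) μ :=
      ((hfL (n+1)).sub (hfL n)).mono ((hgint (n+1)).1.sub (hgint n).1)
        (by simpa [Real.norm_eq_abs] using hsub n)
    have := ih.add h1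
    rwa [add_sub_cancel] at this

lemma mis_memLp_Z (hg : ∀ n, MemLp (g n) (ENNReal.ofReal (q+1)) μ) (n : ℕ) :
    MemLp (misZ g n) (ENNReal.ofReal (q+1)) μ := by
  induction n with
  | zero => exact (hg 0).norm
  | succ n ih => exact ih.sup (hg (n+1)).norm

/-- `∫ (A df + B dg) ≤ 0`. -/
lemma mis_cond_step {A B X Y : Ω → ℝ} {m : MeasurableSpace Ω} (hm : m ≤ m0)
    (hA : StronglyMeasurable[m] A) (hB : StronglyMeasurable[m] B)
    (hX : Integrable X μ) (hY : Integrable Y μ) (hAX : Integrable (A * X) μ)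
    (hBY : Integrable (B * Y) μ) (hAB : ∀ᵐ ω ∂μ, A ω + α * |B ω| ≤ 0)
    (hX0 : 0 ≤ᵐ[μ] μ[X | m]) (hc : ∀ᵐ ω ∂μ, |(μ[Y | m]) ω| ≤ α * (μ[X | m]) ω) :
    ∫ ω, (A ω * X ω + B ω * Y ω) ∂μ ≤ 0 := by
  have h1 := condExp_mul_of_stronglyMeasurable_left hA hAX hX
  have h2 := condExp_mul_of_stronglyMeasurable_left hB hBY hY
  have e : ∫ ω, (A ω * X ω + B ω * Y ω) ∂μ
      = ∫ ω, ((μ[A * X | m]) ω + (μ[B * Y | m]) ω) ∂μ := by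
    rw [integral_add integrable_condExp integrable_condExp, integral_condExp hm,
      integral_condExp hm]
    exact integral_add hAX hBY
  rw [e]
  apply integral_nonpos_of_ae
  filter_upwards [h1, h2, hAB, hX0, hc] with ω h1 h2 h3 h4 h5
  rw [h1, h2]
  simp only [Pi.mul_apply, Pi.zero_apply] at *
  have h6 : B ω * (μ[Y | m]) ω ≤ |B ω| * (α * (μ[X | m]) ω) :=
    (le_abs_self _).trans (by rw [abs_mul]; exact mul_le_mul_of_nonneg_left h5 (abs_nonneg _))
  nlinarith [mul_le_mul_of_nonneg_right h3 h4]

lemma mis_U_integrable (hq : 1 ≤ q) (hα : 0 ≤ α) (hα1 : α ≤ 1) (hκ : 0 ≤ κ) (hκ1 : κ ≤ 1)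
    (hfL : ∀ n, MemLp (f n) (ENNReal.ofReal (q+1)) μ) (hf0 : ∀ n : ℕ, 0 ≤ᵐ[μ] f n)
    (hgL : ∀ n, MemLp (g n) (ENNReal.ofReal (q+1)) μ) (n : ℕ) :
    Integrable (fun ω => misU q α κ (f n ω) (g n ω) (misZ g n ω)) μ := by
  have hZ := mis_memLp_Z hgL n
  have hT : MemLp (fun ω => f n ω + |g n ω| + misZ g n ω) (ENNReal.ofReal (q+1)) μ :=
    ((hfL n).add (hgL n).norm).add hZ
  have hI := mis_integrable_rpow hq hT (by
    filter_upwards [hf0 n] with ω hω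
    have := misZ_nonneg g n ω
    have hω' : 0 ≤ f n ω := hω
    simp only [Pi.zero_apply]
    positivity)
  refine (hI.const_mul (2 * q + 8)).mono' ?_ ?_
  · exact ((misU_meas q α κ).comp_aemeasurable
      ((hfL n).1.aemeasurable.prodMk ((hgL n).1.aemeasurable.prodMk hZ.1.aemeasurable))).aestronglyMeasurable
  · filter_upwards [hf0 n] with ω hω
    exact (misG_bound hq hα hα1 hκ hκ1 hω (misZ_nonneg g n ω)).2.2

lemma mis_coef_integrable {A X S : Ω → ℝ} {c : ℝ} (hq : 1 ≤ q) (hc : 0 ≤ c)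
    (hA : AEStronglyMeasurable A μ) (hX : MemLp X (ENNReal.ofReal (q+1)) μ)
    (hS : MemLp S (ENNReal.ofReal (q+1)) μ) (hS0 : 0 ≤ᵐ[μ] S)
    (hAS : ∀ᵐ ω ∂μ, |A ω| ≤ c * S ω ^ q) : Integrable (A * X) μ := by
  have hT : MemLp (fun ω => S ω + |X ω|) (ENNReal.ofReal (q+1)) μ := hS.add hX.norm
  have hI := mis_integrable_rpow hq hT (by
    filter_upwards [hS0] with ω hω
    have hω' : 0 ≤ S ω := hω
    simp only [Pi.zero_apply]
    positivity)
  refine (hI.const_mul c).mono' (hA.mul hX.1) ?_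
  filter_upwards [hS0, hAS] with ω hω h
  have hω' : 0 ≤ S ω := hω
  have hx := abs_nonneg (X ω)
  rw [Pi.mul_apply, Real.norm_eq_abs, abs_mul]
  have h1 : S ω ^ q ≤ (S ω + |X ω|) ^ q :=
    Real.rpow_le_rpow hω' (by linarith) (by linarith)
  have h0 := Real.rpow_nonneg hω' q
  calc |A ω| * |X ω| ≤ (c * S ω ^ q) * |X ω| := by gcongr
    _ ≤ (c * (S ω + |X ω|) ^ q) * (S ω + |X ω|) := by
        gcongr
        linarith
    _ = _ := by ring

lemma mis_U_step (hq : 1 ≤ q) (hα : 0 ≤ α) (hα1 : α ≤ 1) (hκ : 0 ≤ κ) (hκ1 : κ ≤ 1)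
    (hκq : (q+1) * κ ^ q = 1)
    (hfL : ∀ n, MemLp (f n) (ENNReal.ofReal (q+1)) μ)
    (hgL : ∀ n, MemLp (g n) (ENNReal.ofReal (q+1)) μ)
    (hf : Submartingale f 𝓕 μ) (hf0 : ∀ n : ℕ, 0 ≤ᵐ[μ] f n)
    (hgadp : Adapted 𝓕 g) (hgint : ∀ n : ℕ, Integrable (g n) μ)
    (hsub : ∀ n : ℕ, ∀ᵐ ω ∂μ, |g (n+1) ω - g n ω| ≤ |f (n+1) ω - f n ω|)
    (hcond : ∀ n : ℕ, ∀ᵐ ω ∂μ,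
      |(μ[g (n+1) - g n | 𝓕 n]) ω| ≤ α * (μ[f (n+1) - f n | 𝓕 n]) ω) (n : ℕ) :
    ∫ ω, misU q α κ (f (n+1) ω) (g (n+1) ω) (misZ g (n+1) ω) ∂μ
      ≤ ∫ ω, misU q α κ (f n ω) (g n ω) (misZ g n ω) ∂μ := by
  have hfm : Measurable[𝓕 n] (f n) := (hf.1 n).measurable
  have hvm : Measurable[𝓕 n] (fun ω => (f n ω, g n ω, misZ g n ω)) :=
    hfm.prodMk ((hgadp n).prodMk (misZ_adapted hgadp n))
  let A : Ω → ℝ := fun ω => misA q α κ (f n ω) (g n ω) (misZ g n ω)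
  let B : Ω → ℝ := fun ω => misB q α κ (f n ω) (g n ω) (misZ g n ω)
  have hA : StronglyMeasurable[𝓕 n] A := ((misA_meas q α κ).comp hvm).stronglyMeasurable
  have hB : StronglyMeasurable[𝓕 n] B := ((misB_meas q α κ).comp hvm).stronglyMeasurable
  have hS : MemLp (fun ω => f n ω + |g n ω| + misZ g n ω) (ENNReal.ofReal (q+1)) μ :=
    ((hfL n).add (hgL n).norm).add (mis_memLp_Z hgL n)
  have hS0 : 0 ≤ᵐ[μ] (fun ω => f n ω + |g n ω| + misZ g n ω) := by
    filter_upwards [hf0 n] with ω hω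
    have := misZ_nonneg g n ω
    have hω' : 0 ≤ f n ω := hω
    simp only [Pi.zero_apply]
    positivity
  have hAX : Integrable (A * (f (n+1) - f n)) μ := by
    refine mis_coef_integrable (c := 3 * q + 7 + 2 * (q + 1) * q) hq (by positivity)
      (hA.mono (𝓕.le n)).aestronglyMeasurable ((hfL (n+1)).sub (hfL n)) hS hS0 ?_
    filter_upwards [hf0 n] with ω hω
    exact (misAB_bound hq hα hα1 hκ hκ1 hω (misZ_nonneg g n ω)).1
  have hBY : Integrable (B * (g (n+1) - g n)) μ := by
    refine mis_coef_integrable (c := 3 * q + 7 + 2 * (q + 1) * q) hq (by positivity)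
      (hB.mono (𝓕.le n)).aestronglyMeasurable ((hgL (n+1)).sub (hgL n)) hS hS0 ?_
    filter_upwards [hf0 n] with ω hω
    exact (misAB_bound hq hα hα1 hκ hκ1 hω (misZ_nonneg g n ω)).2
  have hle := mis_cond_step (𝓕.le n) hA hB ((hf.2.2 (n+1)).sub (hf.2.2 n))
    ((hgint (n+1)).sub (hgint n)) hAX hBY (by
      filter_upwards [hf0 n] with ω hω
      exact mis_drift hq hα hα1 hκ hκ1 hκq (misZ_nonneg g n ω) hω (misZ_ge g n ω))
    (hf.condExp_sub_nonneg n.le_succ) (hcond n)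
  have hU := mis_U_integrable hq hα hα1 hκ hκ1 hfL hf0 hgL
  have hsum : Integrable (fun ω => A ω * (f (n+1) - f n) ω + B ω * (g (n+1) - g n) ω) μ :=
    hAX.add hBY
  calc _ ≤ ∫ ω, (misU q α κ (f n ω) (g n ω) (misZ g n ω)
        + (A ω * (f (n+1) - f n) ω + B ω * (g (n+1) - g n) ω)) ∂μ := by
        refine integral_mono_ae (hU (n+1)) ((hU n).add hsum) ?_
        filter_upwards [hf0 n, hf0 (n+1), hsub n] with ω h1 h2 h3
        have hz := misZ_nonneg g n ω
        have s1 := misU_mono_z (κ := κ) (y := g (n+1) ω) hq hα hκ1 hz h2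
        have s2 := misU_step_fixed hq hα hκ hκ1 hκq hz h1 h2 h3
        have s3 := s1.trans s2
        simp only [misZ, Pi.sub_apply, A, B]
        linarith
    _ = ∫ ω, misU q α κ (f n ω) (g n ω) (misZ g n ω) ∂μ
        + ∫ ω, (A ω * (f (n+1) - f n) ω + B ω * (g (n+1) - g n) ω) ∂μ :=
        integral_add (hU n) hsum
    _ ≤ _ := by linarith

lemma mis_kappa (hq : 1 ≤ q) : ∃ κ : ℝ, 0 ≤ κ ∧ κ ≤ 1 ∧ (q+1) * κ ^ q = 1 := by
  have hq1 : 0 < q + 1 := by linarith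
  refine ⟨(1 / (q+1)) ^ (1/q), by positivity, ?_, ?_⟩
  · apply Real.rpow_le_one (by positivity) _ (by positivity)
    rw [div_le_one hq1]; linarith
  · rw [← Real.rpow_mul (by positivity), one_div_mul_cancel (by linarith), Real.rpow_one]
    field_simp

lemma mis_Z_bound (hq : 1 ≤ q) (hα : 0 ≤ α) (hα1 : α ≤ 1)
    (hfL : ∀ n, MemLp (f n) (ENNReal.ofReal (q+1)) μ)
    (hf : Submartingale f 𝓕 μ) (hf0 : ∀ n : ℕ, 0 ≤ᵐ[μ] f n)
    (hgadp : Adapted 𝓕 g) (hgint : ∀ n : ℕ, Integrable (g n) μ)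
    (hsub0 : ∀ᵐ ω ∂μ, |g 0 ω| ≤ |f 0 ω|)
    (hsub : ∀ n : ℕ, ∀ᵐ ω ∂μ, |g (n+1) ω - g n ω| ≤ |f (n+1) ω - f n ω|)
    (hcond : ∀ n : ℕ, ∀ᵐ ω ∂μ,
      |(μ[g (n+1) - g n | 𝓕 n]) ω| ≤ α * (μ[f (n+1) - f n | 𝓕 n]) ω) (n : ℕ) :
    eLpNorm (misZ g n) (ENNReal.ofReal (q+1)) μ
      ≤ ENNReal.ofReal ((1 + α) * (q+1)) * eLpNorm (f n) (ENNReal.ofReal (q+1)) μ := by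
  have hq1 : 0 < q + 1 := by linarith
  obtain ⟨κ, hκ, hκ1, hκq⟩ := mis_kappa hq
  have hgL := mis_memLp_g hfL hgint hsub0 hsub
  have hU := mis_U_integrable hq hα hα1 hκ hκ1 hfL hf0 hgL
  have hUn : ∫ ω, misU q α κ (f n ω) (g n ω) (misZ g n ω) ∂μ ≤ 0 := by
    induction n with
    | zero =>
      apply integral_nonpos_of_ae
      filter_upwards [hf0 0, hsub0] with ω h1 h2
      rw [abs_of_nonneg h1] at h2
      exact misU_init hq hα hκ1 h2
    | succ n ih =>
      exact (mis_U_step hq hα hα1 hκ hκ1 hκq hfL hgL hf hf0 hgadp hgint hsub hcond n).trans ih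
  have hZL := mis_memLp_Z hgL n
  have hp0 : ENNReal.ofReal (q+1) ≠ 0 := by simp; linarith
  have hpt : ENNReal.ofReal (q+1) ≠ ⊤ := by simp
  have hZi := hZL.integrable_norm_rpow hp0 hpt
  have hfi := (hfL n).integrable_norm_rpow hp0 hpt
  rw [hZL.eLpNorm_eq_integral_rpow_norm hp0 hpt, (hfL n).eLpNorm_eq_integral_rpow_norm hp0 hpt,
    ← ENNReal.ofReal_mul (by positivity)]
  rw [ENNReal.toReal_ofReal hq1.le] at *
  apply ENNReal.ofReal_le_ofReal
  set C := (1 + α) * (q+1) with hC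
  have hC0 : 0 ≤ C := by positivity
  have key : ∫ ω, ‖misZ g n ω‖ ^ (q+1) ∂μ ≤ C ^ (q+1) * ∫ ω, ‖f n ω‖ ^ (q+1) ∂μ := by
    have h1 : ∫ ω, (‖misZ g n ω‖ ^ (q+1) - C ^ (q+1) * ‖f n ω‖ ^ (q+1)) ∂μ
        ≤ ∫ ω, (q+1)^2 / q * misU q α κ (f n ω) (g n ω) (misZ g n ω) ∂μ := by
      refine integral_mono_ae (hZi.sub (hfi.const_mul _)) ((hU n).const_mul _) ?_
      filter_upwards [hf0 n] with ω h1
      have hz := misZ_nonneg g n ω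
      rw [Real.norm_of_nonneg hz, Real.norm_of_nonneg h1]
      exact misU_major hq hα hκ hκq hz h1
    rw [integral_sub hZi (hfi.const_mul _), integral_const_mul, integral_const_mul] at h1
    have h2 : (q+1)^2 / q * ∫ ω, misU q α κ (f n ω) (g n ω) (misZ g n ω) ∂μ ≤ 0 :=
      mul_nonpos_of_nonneg_of_nonpos (by positivity) hUn
    linarith
  have hI0 : 0 ≤ ∫ ω, ‖misZ g n ω‖ ^ (q+1) ∂μ := integral_nonneg fun ω => by positivity
  have hJ0 : 0 ≤ ∫ ω, ‖f n ω‖ ^ (q+1) ∂μ := integral_nonneg fun ω => by positivity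
  calc _ ≤ (C ^ (q+1) * ∫ ω, ‖f n ω‖ ^ (q+1) ∂μ) ^ (q+1)⁻¹ :=
        Real.rpow_le_rpow hI0 key (by positivity)
    _ = _ := by
        rw [Real.mul_rpow (by positivity) hJ0, ← Real.rpow_mul hC0,
          mul_inv_cancel₀ hq1.ne', Real.rpow_one]
end

/-- Sharp maximal inequality for non-negative submartingales: if `f` is a non-negative
submartingale and `g` is `α`-strongly subordinate to `f`, `α ∈ [0,1]`, then
`‖g*‖_p ≤ (α+1) p ‖f‖_p` for `p ≥ 2`. -/
theorem maximal_inequality_submartingale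
    {Ω : Type*} {m0 : MeasurableSpace Ω} {μ : Measure Ω} [IsProbabilityMeasure μ]
    {𝓕 : Filtration ℕ m0} {f g : ℕ → Ω → ℝ} {α p : ℝ}
    (hα0 : 0 ≤ α) (hα1 : α ≤ 1) (hp : 2 ≤ p)
    (hf : Submartingale f 𝓕 μ) (hf0 : ∀ n : ℕ, 0 ≤ᵐ[μ] f n)
    (hgadp : Adapted 𝓕 g) (hgint : ∀ n : ℕ, Integrable (g n) μ)
    (hsub0 : ∀ᵐ ω ∂μ, |g 0 ω| ≤ |f 0 ω|)
    (hsub : ∀ n : ℕ, ∀ᵐ ω ∂μ, |g (n+1) ω - g n ω| ≤ |f (n+1) ω - f n ω|)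
    (hcond : ∀ n : ℕ, ∀ᵐ ω ∂μ,
      |(μ[g (n+1) - g n | 𝓕 n]) ω| ≤ α * (μ[f (n+1) - f n | 𝓕 n]) ω) :
    (∫⁻ ω, (⨆ n : ℕ, ENNReal.ofReal |g n ω|) ^ p ∂μ) ^ (1/p)
      ≤ ENNReal.ofReal ((α+1)*p) * ⨆ n : ℕ, eLpNorm (f n) (ENNReal.ofReal p) μ := by
  have hp0 : 0 < p := by linarith
  obtain ⟨q, rfl⟩ : ∃ q, p = q + 1 := ⟨p - 1, by ring⟩
  have hq : 1 ≤ q := by linarith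
  by_cases htop : (⨆ n : ℕ, eLpNorm (f n) (ENNReal.ofReal (q+1)) μ) = ⊤
  · rw [htop, ENNReal.mul_top]
    · exact le_top
    · simp only [ne_eq, ENNReal.ofReal_eq_zero, not_le]
      positivity
  have hfL : ∀ n, MemLp (f n) (ENNReal.ofReal (q+1)) μ := fun n =>
    ⟨(hf.2.2 n).1, lt_of_le_of_lt (le_iSup (fun n => eLpNorm (f n) (ENNReal.ofReal (q+1)) μ) n)
      (lt_top_iff_ne_top.2 htop)⟩
  have hZ := mis_Z_bound hq hα0 hα1 hfL hf hf0 hgadp hgint hsub0 hsub hcond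
  set K := ENNReal.ofReal ((α+1)*(q+1)) * ⨆ n : ℕ, eLpNorm (f n) (ENNReal.ofReal (q+1)) μ with hK
  have hZK : ∀ n, eLpNorm (misZ g n) (ENNReal.ofReal (q+1)) μ ≤ K := by
    intro n
    refine (hZ n).trans ?_
    rw [hK, add_comm 1 α]
    gcongr
    exact le_iSup (fun n => eLpNorm (f n) (ENNReal.ofReal (q+1)) μ) n
  have hlin : ∀ n, ∫⁻ ω, (ENNReal.ofReal (misZ g n ω)) ^ (q+1) ∂μ ≤ K ^ (q+1) := by
    intro n
    have h1 := hZK n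
    rw [eLpNorm_eq_lintegral_rpow_enorm_toReal (by simp; linarith) (by simp),
      ENNReal.toReal_ofReal hp0.le, one_div, ENNReal.rpow_inv_le_iff hp0] at h1
    refine le_trans (le_of_eq ?_) h1
    congr 1
    ext ω
    rw [Real.enorm_of_nonneg (misZ_nonneg g n ω)]
  rw [one_div, ENNReal.rpow_inv_le_iff hp0]
  have hmeas : ∀ n, Measurable (misZ g n) := fun n =>
    (misZ_adapted hgadp n).mono (𝓕.le n) le_rfl
  calc ∫⁻ ω, (⨆ n : ℕ, ENNReal.ofReal |g n ω|) ^ (q+1) ∂μ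
      ≤ ∫⁻ ω, ⨆ n : ℕ, (ENNReal.ofReal (misZ g n ω)) ^ (q+1) ∂μ := by
        apply lintegral_mono
        intro ω
        have e := (ENNReal.orderIsoRpow (q+1) hp0).map_iSup
          (fun n : ℕ => ENNReal.ofReal |g n ω|)
        simp only [ENNReal.orderIsoRpow_apply] at e
        simp only
        rw [e]
        refine iSup_mono fun n => ?_
        gcongr
        exact misZ_ge g n ω
    _ = ⨆ n : ℕ, ∫⁻ ω, (ENNReal.ofReal (misZ g n ω)) ^ (q+1) ∂μ := by
        apply lintegral_iSup
        · intro n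
          exact (hmeas n).ennreal_ofReal.pow_const _
        · intro i j hij ω
          simp only
          gcongr
          exact misZ_mono g ω hij
    _ ≤ K ^ (q+1) := iSup_le hlin
end

section
/- Fix α ∈ [0,1] and p ≥ 2. The constant (α+1)p is best possible even in the weaker maximal-function estimate: for every c < (α+1)p there exist a probability space with a filtration, a non-negative submartingale f and a real-valued adapted integrable process g that is α-strongly subordinate to f such that ‖g*‖_{L^p} > c·‖f*‖_{L^p}. -/
open MeasureTheory

namespace SharpMax

lemma params {a p c : ℝ} (ha : 1 ≤ a) (hp : 2 ≤ p) (hc0 : 0 ≤ c) (hc : c < a * p) :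
    ∃ δ q : ℝ, 0 < δ ∧ 0 < q ∧ q < 1 ∧ (1 - q) * (1 + a * δ) ^ p < 1 ∧
      c * (1 + (δ / q) * (q / (1 - (1 - q) * (1 + a * δ) ^ p)) ^ (1 / p)) <
        (q / (1 - (1 - q) * (1 + a * δ) ^ p)) ^ (1 / p) := by
  have hap : 0 < a * p := by positivity
  obtain ⟨δ, hδ, hδc⟩ : ∃ δ : ℝ, 0 < δ ∧ c * (1 + p * (a * δ)) < a * p := by
    refine ⟨(a * p - c) / (c * (a * p) + 1), div_pos (by linarith) (by positivity), ?_⟩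
    have h1 : 0 < c * (a * p) + 1 := by positivity
    have : c * (1 + p * (a * ((a * p - c) / (c * (a * p) + 1)))) =
      a * p - (a * p - c) / (c * (a * p) + 1) := by
      field_simp
      ring
    rw [this]
    have : 0 < (a * p - c) / (c * (a * p) + 1) := div_pos (by linarith) h1
    linarith
  have hB : 1 + p * (a * δ) ≤ (1 + a * δ) ^ p :=
    one_add_mul_self_le_rpow_one_add (by nlinarith [mul_pos (by linarith : 0 < a) hδ]) (by linarith)
  have haδ : 0 < a * δ := by positivity
  set R := (1 + a * δ) ^ p with hR
  have hR1 : 1 < R := by nlinarith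
  set q0 := 1 - 1 / R with hq0
  have hR0 : 0 < R := by linarith
  have hq0R : (1 - q0) * R = 1 := by rw [hq0]; field_simp; ring
  have hq0p : 0 < q0 := by
    rw [hq0, sub_pos, div_lt_one hR0]; exact hR1
  have hq0l : q0 < 1 := by
    have : 0 < 1 / R := by positivity
    rw [hq0]; linarith
  have hkey : c * δ < q0 := by
    have h2 : c * δ * R < R - 1 := by
      have h3 : 0 < 1 + p * (a * δ) := by positivity
      by_contra hcon
      push Not at hcon
      have h4 : R * (1 - c * δ) ≤ 1 := by linarith
      have h5 : 0 < 1 - c * δ := by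
        have : δ * (c * (1 + p * (a * δ))) < δ * (a * p) := mul_lt_mul_of_pos_left hδc hδ
        by_contra h
        push Not at h
        nlinarith
      have h6 : (1 + p * (a * δ)) * (1 - c * δ) ≤ 1 := by nlinarith
      have : δ * (c * (1 + p * (a * δ))) < δ * (a * p) := mul_lt_mul_of_pos_left hδc hδ
      nlinarith
    have : q0 * R = R - 1 := by linarith
    nlinarith
  set κ := 1 - c * δ / q0 with hκ
  have hκp : 0 < κ := by
    rw [hκ, sub_pos, div_lt_one hq0p]; exact hkey
  set T := (c + 1) / κ with hT
  have hTp : 0 < T := by positivity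
  have hTp' : 0 < T ^ p := by positivity
  set ε := min (q0 / (R * T ^ p)) ((1 - q0) / 2) with hε
  have hεp : 0 < ε := lt_min (by positivity) (by linarith)
  have hε1 : ε ≤ q0 / (R * T ^ p) := min_le_left _ _
  have hε2 : ε ≤ (1 - q0) / 2 := min_le_right _ _
  have hr : 1 - (1 - (q0 + ε)) * R = ε * R := by linarith
  refine ⟨δ, q0 + ε, hδ, by linarith, by linarith, by nlinarith [mul_pos hεp hR0], ?_⟩
  rw [hr]
  set q := q0 + ε with hq
  have hqp : 0 < q := by linarith
  have hY : T ≤ (q / (ε * R)) ^ (1 / p) := by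
    have h1 : T ^ p ≤ q / (ε * R) := by
      rw [le_div_iff₀ (by positivity)]
      rw [le_div_iff₀ (by positivity)] at hε1
      nlinarith
    calc T = (T ^ p) ^ (1 / p) := by
          rw [← Real.rpow_mul hTp.le, mul_one_div_cancel (by linarith), Real.rpow_one]
      _ ≤ _ := Real.rpow_le_rpow hTp'.le h1 (by positivity)
  set Y := (q / (ε * R)) ^ (1 / p)
  have h1 : c + 1 ≤ Y * κ := by
    rw [hT, div_le_iff₀ hκp] at hY; exact hY
  have h2 : c * δ / q ≤ c * δ / q0 := by
    apply div_le_div_of_nonneg_left (by positivity) hq0p (by linarith)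
  have hYp : 0 < Y := lt_of_lt_of_le hTp hY
  have h3 : Y * (c * δ / q) ≤ Y * (c * δ / q0) := mul_le_mul_of_nonneg_left h2 hYp.le
  have h4 : c * (1 + δ / q * Y) = c + Y * (c * δ / q) := by ring
  rw [h4]
  rw [hκ] at h1
  linarith

/-- the geometric law on `ℕ`. -/
noncomputable def geo (q : ℝ) : Measure ℕ :=
  Measure.sum (fun k => ENNReal.ofReal ((1 - q) ^ k * q) • Measure.dirac k)

lemma lintegral_geo (q : ℝ) (F : ℕ → ENNReal) :
    ∫⁻ k, F k ∂(geo q) = ∑' k, ENNReal.ofReal ((1 - q) ^ k * q) * F k := by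
  simp [geo, lintegral_sum_measure, lintegral_smul_measure, lintegral_dirac]

lemma tsum_geo {r q : ℝ} (hr0 : 0 ≤ r) (hr1 : r < 1) (hq : 0 ≤ q) :
    ∑' k : ℕ, ENNReal.ofReal (r ^ k * q) = ENNReal.ofReal (q / (1 - r)) := by
  rw [← ENNReal.ofReal_tsum_of_nonneg (fun k => by positivity)
    ((summable_geometric_of_lt_one hr0 hr1).mul_right q), tsum_mul_right,
    tsum_geometric_of_lt_one hr0 hr1]
  congr 1
  field_simp

lemma geo_prob {q : ℝ} (h0 : 0 < q) (h1 : q < 1) : IsProbabilityMeasure (geo q) := by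
  constructor
  have := lintegral_geo q (fun _ => 1)
  simp only [lintegral_one, mul_one] at this
  rw [this, tsum_geo (by linarith) (by linarith) h0.le]
  simp [h0.ne']

lemma geo_singleton {q : ℝ} (h0 : 0 < q) (h1 : q < 1) (j : ℕ) :
    (geo q).real {j} = (1 - q) ^ j * q := by
  rw [geo, measureReal_def, Measure.sum_smul_dirac_singleton, ENNReal.toReal_ofReal]
  have : 0 < 1 - q := by linarith
  positivity

lemma geo_Ici {q : ℝ} (h0 : 0 < q) (h1 : q < 1) (j : ℕ) :
    (geo q).real (Set.Ici j) = (1 - q) ^ j := by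
  have := geo_prob h0 h1
  induction j with
  | zero =>
    have : Set.Ici 0 = (Set.univ : Set ℕ) := by ext; simp
    simp [this]
  | succ j ih =>
    have h : Set.Ici j = {j} ∪ Set.Ici (j + 1) := by
      ext x; simp; omega
    rw [h, measureReal_union (by simp) measurableSet_Ici, geo_singleton h0 h1] at ih
    rw [pow_succ]; linarith

/-- The filtration: at time `n` we know `min τ (n / 2)`. -/
def filt : Filtration ℕ (⊤ : MeasurableSpace ℕ) where
  seq n := MeasurableSpace.comap (fun k => min k (n / 2)) ⊤
  mono' := by
    intro m n hmn
    rintro _ ⟨S, -, rfl⟩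
    refine ⟨(fun k => min k (m / 2)) ⁻¹' S, trivial, ?_⟩
    have : m / 2 ≤ n / 2 := Nat.div_le_div_right hmn
    ext k
    simp only [Set.mem_preimage]
    rw [min_assoc, min_eq_right this]
  le' n := le_top

lemma meas_filt {n : ℕ} {F : ℕ → ℝ} (h : ∀ k, n / 2 ≤ k → F k = F (n / 2)) :
    Measurable[filt n] F := by
  have : F = F ∘ (fun k => min k (n / 2)) := by
    ext k
    rcases le_total k (n / 2) with hk | hk
    · simp [hk]
    · simp [hk, h k hk]
  intro S _
  refine ⟨F ⁻¹' S, trivial, ?_⟩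
  rw [← Set.preimage_comp, ← this]

lemma integ {q : ℝ} (h0 : 0 < q) (h1 : q < 1) {j : ℕ} {F : ℕ → ℝ}
    (h : ∀ k, j ≤ k → F k = F j) : Integrable F (geo q) := by
  have := geo_prob h0 h1
  refine Integrable.of_bound (C := ∑ i ∈ Finset.range (j + 1), |F i|)
    (by fun_prop) (Filter.Eventually.of_forall fun k => ?_)
  have key : ∀ i ≤ j, ‖F i‖ ≤ ∑ i ∈ Finset.range (j + 1), |F i| := fun i hi =>
    Finset.single_le_sum (f := fun i => |F i|) (fun _ _ => abs_nonneg _)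
      (Finset.mem_range.2 (by omega))
  rcases le_total k j with hk | hk
  · exact key k hk
  · rw [h k hk]; exact key j le_rfl

/-- The martingale step. -/
lemma condExp_zero {q : ℝ} (h0 : 0 < q) (h1 : q < 1) {n j : ℕ} (hj : n / 2 = j) {D : ℕ → ℝ}
    {h l : ℝ} (hD0 : ∀ k < j, D k = 0) (hDj : D j = h) (hDl : ∀ k, j < k → D k = -l)
    (hl : q * h = (1 - q) * l) :
    (geo q)[D | filt n] =ᵐ[geo q] 0 := by
  have := geo_prob h0 h1
  have hDi : Integrable D (geo q) :=
    integ h0 h1 (j := j + 1) (fun k hk => by rw [hDl k (by omega), hDl (j + 1) (by omega)])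
  symm
  refine ae_eq_condExp_of_forall_setIntegral_eq (filt.le n) hDi
    (fun s _ _ => integrableOn_zero) ?_ aestronglyMeasurable_zero
  rintro _ ⟨S, -, rfl⟩ -
  simp only [Pi.zero_apply, integral_zero]
  symm
  rw [← integral_indicator (by trivial)]
  by_cases hS : j ∈ S
  · have : Set.indicator ((fun k => min k (n / 2)) ⁻¹' S) D =
        fun k => Set.indicator {j} (fun _ => h) k + Set.indicator (Set.Ici (j + 1)) (fun _ => -l) k := by
      ext k
      rcases lt_trichotomy k j with hk | hk | hk
      · have : k ≠ j := by omega
        have h2 : ¬ (j + 1 ≤ k) := by omega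
        simp [Set.indicator, hD0 k hk, this, h2]
      · subst hk
        simp [Set.indicator, hj, hS, hDj]
      · have h1 : k ≠ j := by omega
        have h2 : j + 1 ≤ k := by omega
        simp [Set.indicator, hj, h1, h2, min_eq_right hk.le, hS, hDl k hk]
    rw [this, integral_add ((integrable_const h).indicator (by trivial))
      ((integrable_const (-l)).indicator (by trivial)),
      integral_indicator_const _ (by trivial), integral_indicator_const _ (by trivial),
      geo_singleton h0 h1, geo_Ici h0 h1]
    simp only [smul_eq_mul]
    rw [pow_succ]
    linear_combination (1 - q) ^ j * hl
  · have : Set.indicator ((fun k => min k (n / 2)) ⁻¹' S) D = fun _ => 0 := by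
      ext k
      rcases lt_or_ge k j with hk | hk
      · simp [Set.indicator, hD0 k hk]
      · simp [Set.indicator, hj, min_eq_right hk, hS]
    rw [this]; simp

/-- growth sequence -/
noncomputable def W (α δ : ℝ) (j : ℕ) : ℝ := (1 + (α + 1) * δ) ^ j

noncomputable def ff (α δ q : ℝ) (n k : ℕ) : ℝ :=
  if n / 2 ≤ k then 1 + (if n % 2 = 0 then 0 else δ * W α δ (n / 2)) else 1 + δ / q * W α δ k

noncomputable def gg (α δ q : ℝ) (n k : ℕ) : ℝ :=
  if n / 2 ≤ k then W α δ (n / 2) * (1 + if n % 2 = 0 then 0 else α * δ)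
  else W α δ k * (1 + α * δ - δ / q + δ)

lemma ff_const (α δ q : ℝ) (n k : ℕ) (h : n / 2 ≤ k) : ff α δ q n k = ff α δ q n (n / 2) := by
  simp [ff, h]

lemma gg_const (α δ q : ℝ) (n k : ℕ) (h : n / 2 ≤ k) : gg α δ q n k = gg α δ q n (n / 2) := by
  simp [gg, h]

/-- even steps -/
lemma ff_even (α δ q : ℝ) (j k : ℕ) :
    ff α δ q (2 * j + 1) k - ff α δ q (2 * j) k = if j ≤ k then δ * W α δ j else 0 := by
  have h1 : (2 * j + 1) / 2 = j := by omega
  have h2 : (2 * j) / 2 = j := by omega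
  have h3 : (2 * j + 1) % 2 = 1 := by omega
  have h4 : (2 * j) % 2 = 0 := by omega
  simp only [ff, h1, h2, h3, h4]
  split_ifs <;> simp_all

lemma gg_even (α δ q : ℝ) (j k : ℕ) :
    gg α δ q (2 * j + 1) k - gg α δ q (2 * j) k
      = α * (ff α δ q (2 * j + 1) k - ff α δ q (2 * j) k) := by
  rw [ff_even]
  have h1 : (2 * j + 1) / 2 = j := by omega
  have h2 : (2 * j) / 2 = j := by omega
  have h3 : (2 * j + 1) % 2 = 1 := by omega
  have h4 : (2 * j) % 2 = 0 := by omega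
  simp only [gg, h1, h2, h3, h4]
  by_cases h : j ≤ k
  · simp [h]; ring
  · simp [h]

lemma ff_odd (α δ q : ℝ) (j k : ℕ) :
    ff α δ q (2 * j + 1 + 1) k - ff α δ q (2 * j + 1) k =
      if j < k then -(δ * W α δ j) else if k = j then (δ / q - δ) * W α δ j else 0 := by
  have h1 : (2 * j + 1) / 2 = j := by omega
  have h2 : (2 * j + 1 + 1) / 2 = j + 1 := by omega
  have h3 : (2 * j + 1) % 2 = 1 := by omega
  have h4 : (2 * j + 1 + 1) % 2 = 0 := by omega
  simp only [ff, h1, h2, h3, h4]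
  rcases lt_trichotomy k j with hk | hk | hk
  · have a1 : ¬ (j + 1 ≤ k) := by omega
    have a2 : ¬ (j ≤ k) := by omega
    have a3 : ¬ (j < k) := by omega
    have a4 : k ≠ j := by omega
    simp [a2, a3, a4]
  · subst hk
    simp; ring
  · have a1 : (j + 1 ≤ k) := by omega
    simp [a1, hk, hk.le]

lemma gg_odd (α δ q : ℝ) (j k : ℕ) :
    gg α δ q (2 * j + 1 + 1) k - gg α δ q (2 * j + 1) k
      = - (ff α δ q (2 * j + 1 + 1) k - ff α δ q (2 * j + 1) k) := by
  rw [ff_odd]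
  have h1 : (2 * j + 1) / 2 = j := by omega
  have h2 : (2 * j + 1 + 1) / 2 = j + 1 := by omega
  have h3 : (2 * j + 1) % 2 = 1 := by omega
  have h4 : (2 * j + 1 + 1) % 2 = 0 := by omega
  simp only [gg, h1, h2, h3, h4]
  rcases lt_trichotomy k j with hk | hk | hk
  · have a1 : ¬ (j + 1 ≤ k) := by omega
    have a2 : ¬ (j ≤ k) := by omega
    have a3 : ¬ (j < k) := by omega
    have a4 : k ≠ j := by omega
    simp [a2, a3, a4]
  · subst hk
    simp; ring
  · have a1 : (j + 1 ≤ k) := by omega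
    simp [a1, hk, hk.le, W, pow_succ]; ring

end SharpMax

open SharpMax in
/-- The constant `(α+1)p` is best possible in the maximal inequality
`‖g*‖_p ≤ (α+1) p ‖f*‖_p` for non-negative submartingales `f` and processes `g`
that are `α`-strongly subordinate to `f`, `α ∈ [0,1]`, `p ≥ 2`. -/
theorem maximal_inequality_submartingale_sharp
    {α p : ℝ} (hα0 : 0 ≤ α) (hα1 : α ≤ 1) (hp : 2 ≤ p) {c : ℝ} (hc : c < (α+1)*p) :
    ∃ (Ω : Type) (m0 : MeasurableSpace Ω) (μ : Measure Ω) (_ : IsProbabilityMeasure μ)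
      (𝓕 : Filtration ℕ m0) (f g : ℕ → Ω → ℝ),
      Submartingale f 𝓕 μ ∧ (∀ n : ℕ, 0 ≤ᵐ[μ] f n) ∧
      Adapted 𝓕 g ∧ (∀ n : ℕ, Integrable (g n) μ) ∧
      (∀ᵐ ω ∂μ, |g 0 ω| ≤ |f 0 ω|) ∧
      (∀ n : ℕ, ∀ᵐ ω ∂μ, |g (n+1) ω - g n ω| ≤ |f (n+1) ω - f n ω|) ∧
      (∀ n : ℕ, ∀ᵐ ω ∂μ,
        |(μ[g (n+1) - g n | 𝓕 n]) ω| ≤ α * (μ[f (n+1) - f n | 𝓕 n]) ω) ∧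
      ENNReal.ofReal c * (∫⁻ ω, (⨆ n : ℕ, ENNReal.ofReal |f n ω|) ^ p ∂μ) ^ (1/p)
        < (∫⁻ ω, (⨆ n : ℕ, ENNReal.ofReal |g n ω|) ^ p ∂μ) ^ (1/p) := by
  have hap : 0 < (α + 1) * p := by positivity
  obtain ⟨δ, q, hδ, hq0, hq1, hr1, hfin⟩ := params (a := α + 1) (p := p) (c := max c 0)
    (by linarith) hp (le_max_right _ _) (max_lt hc hap)
  have := geo_prob hq0 hq1
  have hρ : 1 ≤ 1 + (α + 1) * δ := by nlinarith
  have hWpos : ∀ j, 0 < W α δ j := fun j => by unfold W; positivity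
  have hWmono : Monotone (W α δ) := fun i j hij => pow_le_pow_right₀ hρ hij
  have hsδ : δ ≤ δ / q := by
    rw [le_div_iff₀ hq0]; nlinarith
  have hf_int : ∀ n, Integrable (ff α δ q n) (geo q) := fun n =>
    integ hq0 hq1 (j := n / 2) (ff_const α δ q n)
  have hg_int : ∀ n, Integrable (gg α δ q n) (geo q) := fun n =>
    integ hq0 hq1 (j := n / 2) (gg_const α δ q n)
  have hf_meas : ∀ n, Measurable[filt n] (ff α δ q n) := fun n => meas_filt (ff_const α δ q n)
  have hg_meas : ∀ n, Measurable[filt n] (gg α δ q n) := fun n => meas_filt (gg_const α δ q n)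
  have hf_pos : ∀ n k, 0 ≤ ff α δ q n k := by
    intro n k
    have := hWpos k
    have := hWpos (n / 2)
    unfold ff
    split_ifs <;> positivity
  have hf_le : ∀ n k, ff α δ q n k ≤ 1 + δ / q * W α δ k := by
    intro n k
    have h1 := hWpos k
    unfold ff
    split_ifs with h2 h3
    · have : 0 < δ / q * W α δ k := by positivity
      linarith
    · have := hWmono h2
      have h4 : δ * W α δ (n / 2) ≤ δ / q * W α δ k :=
        mul_le_mul hsδ this (hWpos _).le (by positivity)
      linarith
    · exact le_rfl
  -- conditional expectations
  have hcf_even : ∀ j, (geo q)[ff α δ q (2 * j + 1) - ff α δ q (2 * j) | filt (2 * j)]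
      = ff α δ q (2 * j + 1) - ff α δ q (2 * j) := by
    intro j
    refine condExp_of_stronglyMeasurable (filt.le _) (Measurable.stronglyMeasurable ?_)
      ((hf_int _).sub (hf_int _))
    refine meas_filt (fun k hk => ?_)
    have h2 : (2 * j) / 2 = j := by omega
    rw [h2] at hk ⊢
    simp only [Pi.sub_apply, ff_even, hk, le_refl, if_true]
  have hcg_even : ∀ j, (geo q)[gg α δ q (2 * j + 1) - gg α δ q (2 * j) | filt (2 * j)]
      = gg α δ q (2 * j + 1) - gg α δ q (2 * j) := by
    intro j
    refine condExp_of_stronglyMeasurable (filt.le _) (Measurable.stronglyMeasurable ?_)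
      ((hg_int _).sub (hg_int _))
    refine meas_filt (fun k hk => ?_)
    have h2 : (2 * j) / 2 = j := by omega
    rw [h2] at hk ⊢
    simp only [Pi.sub_apply, gg_even, ff_even, hk, le_refl, if_true]
  have hcf_odd : ∀ j, (geo q)[ff α δ q (2 * j + 1 + 1) - ff α δ q (2 * j + 1) | filt (2 * j + 1)]
      =ᵐ[geo q] 0 := by
    intro j
    refine condExp_zero hq0 hq1 (j := j) (h := (δ / q - δ) * W α δ j) (l := δ * W α δ j)
      (by omega) (fun k hk => ?_) ?_ (fun k hk => ?_) (by field_simp)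
    · have a3 : ¬ (j < k) := by omega
      have a4 : k ≠ j := by omega
      simp [ff_odd, a3, a4]
    · simp [ff_odd]
    · simp [ff_odd, hk]
  have hcg_odd : ∀ j, (geo q)[gg α δ q (2 * j + 1 + 1) - gg α δ q (2 * j + 1) | filt (2 * j + 1)]
      =ᵐ[geo q] 0 := by
    intro j
    refine condExp_zero hq0 hq1 (j := j) (h := -((δ / q - δ) * W α δ j)) (l := -(δ * W α δ j))
      (by omega) (fun k hk => ?_) ?_ (fun k hk => ?_) (by field_simp)
    · have a3 : ¬ (j < k) := by omega
      have a4 : k ≠ j := by omega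
      simp [gg_odd, ff_odd, a3, a4]
    · simp [gg_odd, ff_odd]
    · simp [gg_odd, ff_odd, hk]
  have hX : ∫⁻ k, (ENNReal.ofReal (W α δ k)) ^ p ∂(geo q) =
      ENNReal.ofReal (q / (1 - (1 - q) * (1 + (α + 1) * δ) ^ p)) := by
    have hq1' : 0 ≤ 1 - q := by linarith
    rw [lintegral_geo, ← tsum_geo (by positivity) hr1 hq0.le]
    congr 1
    ext k
    rw [ENNReal.ofReal_rpow_of_pos (hWpos k), ← ENNReal.ofReal_mul (by positivity)]
    congr 1
    have : W α δ k ^ p = ((1 + (α + 1) * δ) ^ p) ^ k := by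
      rw [W, ← Real.rpow_natCast, ← Real.rpow_natCast, ← Real.rpow_mul (by linarith),
        ← Real.rpow_mul (by linarith), mul_comm p (k : ℝ)]
    rw [this, mul_pow]; ring
  set Q := q / (1 - (1 - q) * (1 + (α + 1) * δ) ^ p) with hQ
  have hQp : 0 < Q := div_pos hq0 (by linarith)
  have hp0 : 0 < p := by linarith
  refine ⟨ℕ, ⊤, geo q, inferInstance, filt, ff α δ q, gg α δ q, ?_, ?_, ?_, hg_int, ?_, ?_, ?_, ?_⟩
  · refine submartingale_of_condExp_sub_nonneg_nat (fun n => (hf_meas n).stronglyMeasurable)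
      hf_int (fun n => ?_)
    obtain ⟨j, rfl | rfl⟩ := Nat.even_or_odd' n
    · rw [hcf_even]
      refine Filter.Eventually.of_forall fun k => ?_
      have := hWpos j
      simp only [Pi.sub_apply, ff_even, Pi.zero_apply]
      split_ifs <;> positivity
    · exact (hcf_odd j).symm.le
  · exact fun n => Filter.Eventually.of_forall (hf_pos n)
  · exact hg_meas
  · refine Filter.Eventually.of_forall fun k => ?_
    simp [ff, gg, W]
  · intro n
    refine Filter.Eventually.of_forall fun k => ?_
    obtain ⟨j, rfl | rfl⟩ := Nat.even_or_odd' n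
    · rw [gg_even, abs_mul, abs_of_nonneg hα0]
      exact mul_le_of_le_one_left (abs_nonneg _) hα1
    · rw [gg_odd, abs_neg]
  · intro n
    obtain ⟨j, rfl | rfl⟩ := Nat.even_or_odd' n
    · rw [hcf_even, hcg_even]
      refine Filter.Eventually.of_forall fun k => ?_
      have := hWpos j
      simp only [Pi.sub_apply, gg_even]
      rw [abs_of_nonneg]
      rw [ff_even]
      split_ifs <;> positivity
    · filter_upwards [hcf_odd j, hcg_odd j] with k h1 h2
      rw [h1, h2]; simp
  · have hgX : (ENNReal.ofReal (Q ^ (1 / p))) ≤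
        (∫⁻ ω, (⨆ n : ℕ, ENNReal.ofReal |gg α δ q n ω|) ^ p ∂(geo q)) ^ (1/p) := by
      rw [← ENNReal.ofReal_rpow_of_pos hQp, ← hX]
      gcongr with k
      refine le_trans ?_ (le_iSup _ (2 * k))
      refine ENNReal.ofReal_le_ofReal ?_
      have h2 : (2 * k) / 2 = k := by omega
      simp [gg, h2, le_abs_self]
    have hfX : (∫⁻ ω, (⨆ n : ℕ, ENNReal.ofReal |ff α δ q n ω|) ^ p ∂(geo q)) ^ (1/p) ≤
        ENNReal.ofReal (1 + δ / q * Q ^ (1 / p)) := by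
      calc _ ≤ (∫⁻ k, (((fun _ => 1) + fun k => ENNReal.ofReal (δ / q) * ENNReal.ofReal (W α δ k) :
              ℕ → ENNReal) k) ^ p ∂(geo q)) ^ (1/p) := by
            gcongr with k
            refine iSup_le fun n => ?_
            rw [abs_of_nonneg (hf_pos n k)]
            simp only [Pi.add_apply]
            rw [← ENNReal.ofReal_mul (by positivity), ← ENNReal.ofReal_one,
              ← ENNReal.ofReal_add (by norm_num) (mul_nonneg (by positivity) (hWpos k).le)]
            exact ENNReal.ofReal_le_ofReal (hf_le n k)
        _ ≤ _ := ENNReal.lintegral_Lp_add_le (by fun_prop) (by fun_prop) (by linarith)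
        _ = _ := by
            simp only [ENNReal.mul_rpow_of_nonneg _ _ hp0.le]
            rw [lintegral_const_mul _ (by fun_prop), hX,
              ENNReal.mul_rpow_of_nonneg _ _ (by positivity), ← ENNReal.rpow_mul,
              mul_one_div_cancel hp0.ne', ENNReal.ofReal_rpow_of_pos hQp,
              ENNReal.ofReal_add (by norm_num) (by positivity),
              ENNReal.ofReal_mul (by positivity)]
            simp
    refine lt_of_lt_of_le ?_ hgX
    have hcc : ENNReal.ofReal c = ENNReal.ofReal (max c 0) := by simp
    calc _ ≤ ENNReal.ofReal (max c 0) * ENNReal.ofReal (1 + δ / q * Q ^ (1 / p)) := by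
          rw [hcc]; gcongr
      _ = ENNReal.ofReal (max c 0 * (1 + δ / q * Q ^ (1 / p))) := by
          rw [ENNReal.ofReal_mul (le_max_right _ _)]
      _ < _ := (ENNReal.ofReal_lt_ofReal_iff (by positivity)).2 hfin
end

section
/- Fix α ∈ (0,1] and p ≥ 2, and set C = ((α+1)p)^p(p−1). There exists a function γ : [1/((α+1)p), ∞) → ℝ that is differentiable, satisfies the differential equation γ'(x) = (−1 + C(1−γ(x))γ(x)x^{p−2}) / (1 + C(1−γ(x))x^{p−1}) for all x > 1/((α+1)p) together with the initial condition γ(1/((α+1)p)) = 1 − 1/((α+1)p), and moreover γ is non-decreasing, concave and satisfies γ(x) < 1 for all x in its domain. -/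
open Set

lemma aux_local_exists (G : ℝ → ℝ → ℝ) (t₀ y₀ T : ℝ) (hT : 0 ≤ T) (hc : ∀ y, Continuous fun t => G t y)
    (K M : NNReal) (hK : ∀ t, |t - t₀| ≤ T → LipschitzWith K (G t))
    (hM : ∀ t, |t - t₀| ≤ T → ∀ y, |G t y| ≤ M) :
    ∃ γ : ℝ → ℝ, γ t₀ = y₀ ∧ ∀ t ∈ Ioo (t₀ - T) (t₀ + T), HasDerivAt γ (G t (γ t)) t := by
  have hmem : t₀ ∈ Icc (t₀ - T) (t₀ + T) := ⟨by linarith, by linarith⟩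
  have habs : ∀ t ∈ Icc (t₀ - T) (t₀ + T), |t - t₀| ≤ T := by
    intro t ht
    rw [abs_le]; constructor <;> linarith [ht.1, ht.2]
  have hPL : IsPicardLindelof G (⟨t₀, hmem⟩ : Icc (t₀ - T) (t₀ + T)) y₀
      (M * T.toNNReal) 0 M K := by
    refine ⟨fun t ht => (hK t (habs t ht)).lipschitzOnWith, fun y _ => (hc y).continuousOn,
      fun t ht y _ => hM t (habs t ht) y, ?_⟩
    simp [hT]
  obtain ⟨γ, h0, h1⟩ := hPL.exists_eq_forall_mem_Icc_hasDerivWithinAt₀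
  exact ⟨γ, h0, fun t ht => (h1 t (Ioo_subset_Icc_self ht)).hasDerivAt (Icc_mem_nhds ht.1 ht.2)⟩

lemma aux_global_exists (G : ℝ → ℝ → ℝ) (t₀ y₀ : ℝ) (hc : ∀ y, Continuous fun t => G t y)
    (hK : ∀ T : ℝ, ∃ K M : NNReal, ∀ t, |t - t₀| ≤ T → LipschitzWith K (G t) ∧ ∀ y, |G t y| ≤ M) :
    ∃ γ : ℝ → ℝ, γ t₀ = y₀ ∧ ∀ t, HasDerivAt γ (G t (γ t)) t := by
  have hex : ∀ T : ℝ, 0 ≤ T → ∃ γ : ℝ → ℝ, γ t₀ = y₀ ∧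
      ∀ t ∈ Ioo (t₀ - T) (t₀ + T), HasDerivAt γ (G t (γ t)) t := by
    intro T hT
    obtain ⟨K, M, h⟩ := hK T
    exact aux_local_exists G t₀ y₀ T hT hc K M (fun t ht => (h t ht).1) (fun t ht => (h t ht).2)
  choose! Y hY0 hY using hex
  have huniq : ∀ S T : ℝ, 0 < S → S ≤ T → EqOn (Y S) (Y T) (Ioo (t₀ - S) (t₀ + S)) := by
    intro S T hS hST
    obtain ⟨K, M, h⟩ := hK S
    refine ODE_solution_unique_of_mem_Ioo (v := G) (s := fun _ => univ) (K := K) (t₀ := t₀)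
      ?_ ⟨by linarith, by linarith⟩ ?_ ?_ ?_
    · intro t ht
      refine (h t ?_).1.lipschitzOnWith
      rw [abs_le]; constructor <;> linarith [ht.1, ht.2]
    · exact fun t ht => ⟨hY S hS.le t ht, mem_univ _⟩
    · exact fun t ht => ⟨hY T (hS.le.trans hST) t ⟨by linarith [ht.1], by linarith [ht.2]⟩, mem_univ _⟩
    · rw [hY0 S hS.le, hY0 T (hS.le.trans hST)]
  refine ⟨fun t => Y (|t - t₀| + 1) t, by simpa using hY0 1 zero_le_one, fun t => ?_⟩
  have h1 : 0 ≤ |t - t₀| := abs_nonneg _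
  have hd := hY (|t - t₀| + 2) (by linarith) t
    ⟨by linarith [neg_abs_le (t - t₀)], by linarith [le_abs_self (t - t₀)]⟩
  have heq : ∀ s, |s - t₀| < |t - t₀| + 1 → Y (|s - t₀| + 1) s = Y (|t - t₀| + 2) s := by
    intro s hs
    exact huniq _ _ (by positivity) (by linarith)
      ⟨by linarith [neg_abs_le (s - t₀)], by linarith [le_abs_self (s - t₀)]⟩
  have hev : (fun s => Y (|s - t₀| + 1) s) =ᶠ[nhds t] Y (|t - t₀| + 2) := by
    have : ∀ᶠ s in nhds t, |s - t₀| < |t - t₀| + 1 := by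
      have hcont : ContinuousAt (fun s : ℝ => |s - t₀|) t := by fun_prop
      exact hcont.eventually_lt_const (by linarith)
    filter_upwards [this] with s hs using heq s hs
  rw [← heq t (by linarith)] at hd
  exact hd.congr_of_eventuallyEq hev

lemma aux_cont_ind (f : ℝ → ℝ) (a : ℝ) (hf : ContinuousOn f (Ici a)) 
    (h : ∀ T, a ≤ T → (∀ x ∈ Ico a T, 0 < f x) → 0 < f T) : ∀ x, a ≤ x → 0 < f x := by
  intro x hx
  by_contra hneg
  push Not at hneg
  have hcl : IsCompact {y ∈ Icc a x | f y ≤ 0} := by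
    refine isCompact_Icc.of_isClosed_subset ?_ (fun y hy => hy.1)
    exact (hf.mono Icc_subset_Ici_self).preimage_isClosed_of_isClosed isClosed_Icc isClosed_Iic
  obtain ⟨s, hs, hmin⟩ := hcl.exists_isLeast ⟨x, ⟨hx, le_rfl⟩, hneg⟩
  have := h s hs.1.1 (fun y hy => by
    by_contra hy0
    push Not at hy0
    exact absurd (hmin ⟨⟨hy.1, hy.2.le.trans hs.1.2⟩, hy0⟩) (not_le.2 hy.2))
  exact absurd hs.2 (not_le.2 this)

lemma aux_lip {q r Q R y z : ℝ} (hq : 0 ≤ q) (hr : 0 ≤ r) (hqQ : q ≤ Q) (hrR : r ≤ R)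
    (hy0 : 0 ≤ y) (hy1 : y ≤ 1) (hz0 : 0 ≤ z) (hz1 : z ≤ 1) :
    |(-1 + q * ((1 - y) * y)) / (1 + r * (1 - y)) - (-1 + q * ((1 - z) * z)) / (1 + r * (1 - z))|
      ≤ ((1 + Q) * R + Q) * |y - z| := by
  have hD1 : 1 ≤ 1 + r * (1 - y) := by nlinarith
  have hD2 : 1 ≤ 1 + r * (1 - z) := by nlinarith
  set D1 := 1 + r * (1 - y)
  set D2 := 1 + r * (1 - z)
  have e : (-1 + q * ((1 - y) * y)) / D1 - (-1 + q * ((1 - z) * z)) / D2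
      = ((-1 + q * ((1 - y) * y)) / D1 * r + q * (1 - y - z)) * (y - z) / D2 := by
    have hD1' : D1 ≠ 0 := by linarith
    have hD2' : D2 ≠ 0 := by linarith
    rw [div_sub_div _ _ hD1' hD2', div_eq_div_iff (mul_ne_zero hD1' hD2') hD2']
    field_simp
    simp only [D1, D2]
    ring
  have hN : |(-1 + q * ((1 - y) * y)) / D1| ≤ 1 + Q := by
    rw [abs_div, abs_of_pos (by linarith : 0 < D1)]
    refine (div_le_self (abs_nonneg _) hD1).trans ?_
    have h1 : 0 ≤ (1 - y) * y := mul_nonneg (by linarith) hy0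
    have h2 : (1 - y) * y ≤ 1 := by nlinarith
    rw [abs_le]; constructor <;> nlinarith
  rw [e, abs_div, abs_of_pos (by linarith : 0 < D2)]
  refine (div_le_self (abs_nonneg _) hD2).trans ?_
  rw [abs_mul]
  refine mul_le_mul_of_nonneg_right ?_ (abs_nonneg _)
  refine (abs_add_le _ _).trans (add_le_add ?_ ?_)
  · rw [abs_mul, abs_of_nonneg hr]
    exact mul_le_mul hN hrR hr (by linarith)
  · rw [abs_mul, abs_of_nonneg hq]
    have : |1 - y - z| ≤ 1 := by rw [abs_le]; constructor <;> linarith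
    calc q * |1 - y - z| ≤ q * 1 := by gcongr
      _ ≤ Q := by linarith

lemma aux_bdd {q r Q y : ℝ} (hq : 0 ≤ q) (hr : 0 ≤ r) (hqQ : q ≤ Q)
    (hy0 : 0 ≤ y) (hy1 : y ≤ 1) :
    |(-1 + q * ((1 - y) * y)) / (1 + r * (1 - y))| ≤ 1 + Q := by
  have hD1 : 1 ≤ 1 + r * (1 - y) := by nlinarith
  rw [abs_div, abs_of_pos (by linarith : 0 < 1 + r * (1 - y))]
  refine (div_le_self (abs_nonneg _) hD1).trans ?_
  have h1 : 0 ≤ (1 - y) * y := mul_nonneg (by linarith) hy0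
  have h2 : (1 - y) * y ≤ 1 := by nlinarith
  rw [abs_le]; constructor <;> nlinarith

/-- existence for the clamped equation -/
lemma aux_clamped (C p a y₀ : ℝ) (hC : 0 < C) (hp : 2 ≤ p) (ha : 0 < a) :
    ∃ γ : ℝ → ℝ, γ a = y₀ ∧ ∀ t, HasDerivAt γ
      ((-1 + C * (max t a)^(p-2) * ((1 - max 0 (min (γ t) 1)) * max 0 (min (γ t) 1))) /
        (1 + C * (max t a)^(p-1) * (1 - max 0 (min (γ t) 1)))) t := by
  have hpos : ∀ t, 0 < max t a := fun t => lt_max_of_lt_right ha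
  have hy0 : ∀ y : ℝ, 0 ≤ max 0 (min y 1) := fun y => le_max_left _ _
  have hy1 : ∀ y : ℝ, max 0 (min y 1) ≤ 1 := fun y => max_le zero_le_one (min_le_right _ _)
  have hr0 : ∀ t s, 0 ≤ C * (max t a)^(s:ℝ) := fun t s =>
    mul_nonneg hC.le (Real.rpow_nonneg (hpos t).le _)
  apply aux_global_exists (fun t y => ((-1 + C * (max t a)^(p-2) * ((1 - max 0 (min y 1)) * max 0 (min y 1))) /
        (1 + C * (max t a)^(p-1) * (1 - max 0 (min y 1)))))
  · intro y
    have hmax : Continuous fun t => max t a := by fun_prop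
    have hpw : ∀ s : ℝ, Continuous fun t => (max t a)^s := fun s =>
      hmax.rpow_const (fun t => Or.inl (hpos t).ne')
    refine Continuous.div ?_ ?_ ?_
    · exact continuous_const.add ((continuous_const.mul (hpw _)).mul continuous_const)
    · exact continuous_const.add ((continuous_const.mul (hpw _)).mul continuous_const)
    · intro t
      have := mul_nonneg (hr0 t (p-1)) (sub_nonneg.2 (hy1 y))
      linarith
  · intro T
    set Q := C * (max (a + T) a)^(p-2)
    set R := C * (max (a + T) a)^(p-1)
    have hQ : 0 ≤ Q := hr0 _ _
    have hR : 0 ≤ R := hr0 _ _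
    refine ⟨((1 + Q) * R + Q).toNNReal, (1 + Q).toNNReal, fun t ht => ?_⟩
    have htT : max t a ≤ max (a + T) a := max_le_max (by linarith [(abs_le.1 ht).2]) le_rfl
    have hqQ : C * (max t a)^(p-2) ≤ Q :=
      mul_le_mul_of_nonneg_left (Real.rpow_le_rpow (hpos t).le htT (by linarith)) hC.le
    have hrR : C * (max t a)^(p-1) ≤ R :=
      mul_le_mul_of_nonneg_left (Real.rpow_le_rpow (hpos t).le htT (by linarith)) hC.le
    constructor
    · refine LipschitzWith.of_dist_le_mul fun y z => ?_
      rw [Real.dist_eq, Real.dist_eq, Real.coe_toNNReal _ (by positivity)]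
      refine (aux_lip (hr0 _ _) (hr0 _ _) hqQ hrR (hy0 y) (hy1 y) (hy0 z) (hy1 z)).trans ?_
      refine mul_le_mul_of_nonneg_left ?_ (by positivity)
      have h1 := abs_max_sub_max_le_max 0 (min y 1) 0 (min z 1)
      have h2 := abs_min_sub_min_le_max y 1 z 1
      simp at h1 h2
      exact h1.trans h2
    · intro y
      rw [Real.coe_toNNReal _ (by positivity)]
      exact aux_bdd (hr0 _ _) (hr0 _ _) hqQ (hy0 y) (hy1 y)

/-- the right-hand side of the differential equation -/
noncomputable def auxF (C p x y : ℝ) : ℝ :=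
  (-1 + C * x^(p-2) * ((1 - y) * y)) / (1 + C * x^(p-1) * (1 - y))

lemma auxF_deriv {C p x g : ℝ} {γ : ℝ → ℝ} (hC : 0 < C) (hx : 0 < x) (hγ : γ x ≤ 1)
    (hd : HasDerivAt γ g x) (hg : g = auxF C p x (γ x)) :
    HasDerivAt (fun t => auxF C p t (γ t))
      (-(C * x^(p-2) * (x + γ x) / (1 + C * x^(p-1) * (1 - γ x))^2 *
        (x * g - (p-2) * (1 - γ x))) / x) x := by
  have hP : ∀ s : ℝ, 0 < x ^ s := fun s => Real.rpow_pos_of_pos hx s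
  have hD : 0 < 1 + C * x^(p-1) * (1 - γ x) := by
    have := mul_nonneg (mul_nonneg hC.le (hP (p-1)).le) (sub_nonneg.2 hγ)
    linarith
  have h2 : HasDerivAt (fun t : ℝ => t^(p-2)) ((p-2) * x^(p-2-1)) x :=
    Real.hasDerivAt_rpow_const (Or.inl hx.ne')
  have h1 : HasDerivAt (fun t : ℝ => t^(p-1)) ((p-1) * x^(p-1-1)) x :=
    Real.hasDerivAt_rpow_const (Or.inl hx.ne')
  have hv : HasDerivAt (fun t => 1 - γ t) (-g) x := hd.const_sub 1
  have hN := ((h2.const_mul C).mul (hv.mul hd)).const_add (-1)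
  have hDd := ((h1.const_mul C).mul hv).const_add 1
  have hq := hN.div hDd hD.ne'
  refine hq.congr_deriv ?_
  have e1 : x^(p-1) = x * x^(p-2) := by
    rw [show p - 1 = 1 + (p-2) by ring, Real.rpow_add hx, Real.rpow_one]
  have e2 : x^(p-2-1) = x^(p-2) / x := by rw [Real.rpow_sub_one hx.ne']
  have e3 : x^(p-1-1) = x^(p-2) := by congr 1; ring
  have hg' : g * (1 + C * x^(p-1) * (1 - γ x)) = -1 + C * x^(p-2) * ((1 - γ x) * γ x) := by
    rw [hg, auxF, div_mul_cancel₀ _ hD.ne']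
  simp only [Pi.mul_apply, e2, e3]
  rw [e1] at hg' hD ⊢
  generalize x^(p-2) = P at *
  generalize γ x = y at *
  have hD' : 1 + C * (x * P) * (1 - y) ≠ 0 := hD.ne'
  have hk : (y - x * g) * (1 + C * (x * P) * (1 - y)) = x + y := by
    linear_combination (-x) * hg'
  rw [← hg', ← hk]
  field_simp
  ring

/-- positivity from a differential inequality -/
lemma aux_gron (h : ℝ → ℝ) (a T M : ℝ) (haT : a ≤ T) (hc : ContinuousOn h (Icc a T)) (h0 : 0 < h a)
    (hd : ∀ x ∈ Ioo a T, ∃ d, HasDerivAt h d x ∧ -M * h x ≤ d) : 0 < h T := by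
  have hmono : MonotoneOn (fun x => Real.exp (M * x) * h x) (Icc a T) := by
    refine monotoneOn_of_deriv_nonneg (convex_Icc a T) ?_ ?_ ?_
    · exact ContinuousOn.mul (by fun_prop) hc
    · rw [interior_Icc]
      intro x hx
      obtain ⟨d, hd, -⟩ := hd x hx
      have he : DifferentiableAt ℝ (fun x => Real.exp (M * x)) x := by fun_prop
      exact (he.mul hd.differentiableAt).differentiableWithinAt
    · rw [interior_Icc]
      intro x hx
      obtain ⟨d, hd, hle⟩ := hd x hx
      have he : HasDerivAt (fun x => Real.exp (M * x)) (Real.exp (M * x) * (M * 1)) x :=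
        ((hasDerivAt_id x).const_mul M).exp
      have hm : HasDerivAt (fun x => Real.exp (M * x) * h x) _ x := he.mul hd
      rw [hm.deriv]
      have := Real.exp_pos (M * x)
      nlinarith
  have := hmono (left_mem_Icc.2 haT) (right_mem_Icc.2 haT) haT
  simp only at this
  have h3 : 0 < Real.exp (M * T) * h T := lt_of_lt_of_le (by positivity) this
  exact (pos_iff_pos_of_mul_pos h3).1 (Real.exp_pos _)

lemma aux_core (C p a y₀ : ℝ) (hC : 0 < C) (hp : 2 ≤ p) (ha : 0 < a) (hy0 : 0 < y₀) (hy1 : y₀ < 1)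
    (hh0 : 0 < a * auxF C p a y₀ - (p - 2) * (1 - y₀)) :
    ∃ γ : ℝ → ℝ, γ a = y₀ ∧ (∀ x, a ≤ x → HasDerivAt γ (auxF C p x (γ x)) x) ∧
      (∀ x, a ≤ x → 0 < γ x ∧ γ x < 1 ∧ 0 < x * auxF C p x (γ x) - (p - 2) * (1 - γ x)) := by
  obtain ⟨γ, hγa, hγ⟩ := aux_clamped C p a y₀ hC hp ha
  have hcont : Continuous γ := continuous_iff_continuousAt.2 fun t => (hγ t).continuousAt
  have hlt : ∀ x, a ≤ x → 0 < 1 - γ x := by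
    refine aux_cont_ind _ a (by fun_prop) ?_
    intro T haT hT
    by_contra hneg
    have hge : 1 ≤ γ T := by linarith
    have haT' : a < T := lt_of_le_of_ne haT (by rintro rfl; linarith)
    have hd := hγ T
    have e : max 0 (min (γ T) 1) = 1 := by rw [min_eq_right hge]; simp
    rw [e] at hd
    norm_num at hd
    have hev : ∀ᶠ x in nhdsWithin T (Iio T), γ T < γ x := by
      have h1 := (hasDerivAt_iff_tendsto_slope.1 hd).mono_left
        (nhdsWithin_mono T (fun x (hx : x < T) => hx.ne))
      filter_upwards [h1.eventually_lt_const (show (-1:ℝ) < 0 by norm_num), self_mem_nhdsWithin]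
        with x hx hxT
      rw [slope_def_field, div_neg_iff] at hx
      have : x < T := hxT
      rcases hx with hx | hx <;> linarith [hx.1, hx.2]
    obtain ⟨x, hx1, hx2⟩ := (hev.and (Ico_mem_nhdsLT haT')).exists
    linarith [hT x hx2]
  have hcl : ∀ x, a ≤ x → 0 ≤ γ x → HasDerivAt γ (auxF C p x (γ x)) x := by
    intro x hx h0
    have := hγ x
    rwa [max_eq_left hx, min_eq_left (by linarith [hlt x hx]), max_eq_right h0] at this
  have hDpos : ∀ x, a ≤ x → 0 < 1 + C * x^(p-1) * (1 - γ x) := by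
    intro x hx
    have hx0 : 0 < x := ha.trans_le hx
    have := mul_pos (mul_pos hC (Real.rpow_pos_of_pos hx0 (p-1))) (hlt x hx)
    linarith
  have hpw : ∀ s : ℝ, ContinuousOn (fun x : ℝ => x^s) (Ici a) := fun s =>
    continuousOn_id.rpow_const (fun x hx => Or.inl (ha.trans_le hx).ne')
  have hFc : ContinuousOn (fun x => auxF C p x (γ x)) (Ici a) := by
    unfold auxF
    have h1 := hpw (p-1)
    have h2 := hpw (p-2)
    exact ContinuousOn.div (by fun_prop) (by fun_prop) (fun x hx => (hDpos x hx).ne')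
  set A : ℝ → ℝ := fun x => C * x^(p-2) * (x + γ x) / (1 + C * x^(p-1) * (1 - γ x))^2 with hA
  have hAc : ContinuousOn A (Ici a) := by
    have h1 := hpw (p-1)
    have h2 := hpw (p-2)
    exact ContinuousOn.div (by fun_prop) (by fun_prop) (fun x hx => (pow_pos (hDpos x hx) 2).ne')
  set h : ℝ → ℝ := fun x => x * auxF C p x (γ x) - (p - 2) * (1 - γ x) with hh
  have hhc : ContinuousOn h (Ici a) := by fun_prop
  have hmin : ∀ x, a ≤ x → 0 < min (γ x) (h x) := by
    refine aux_cont_ind _ a (ContinuousOn.inf hcont.continuousOn hhc) ?_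
    intro T haT hT
    have hT1 : ∀ x ∈ Ico a T, 0 < γ x := fun x hx => (lt_min_iff.1 (hT x hx)).1
    have hT2 : ∀ x ∈ Ico a T, 0 < h x := fun x hx => (lt_min_iff.1 (hT x hx)).2
    have hmono : MonotoneOn γ (Icc a T) := by
      refine monotoneOn_of_deriv_nonneg (convex_Icc a T) hcont.continuousOn
        (fun x _ => (hγ x).differentiableAt.differentiableWithinAt) ?_
      rw [interior_Icc]
      intro x hx
      rw [(hcl x hx.1.le (hT1 x ⟨hx.1.le, hx.2⟩).le).deriv]
      have h1 := hT2 x ⟨hx.1.le, hx.2⟩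
      have h2 := hlt x hx.1.le
      have hx0 : 0 < x := ha.trans hx.1
      have h3 : 0 < x * auxF C p x (γ x) := by
        simp only [hh] at h1
        have := mul_nonneg (sub_nonneg.2 hp) h2.le
        linarith
      exact ((pos_iff_pos_of_mul_pos h3).1 hx0).le
    have hγT : 0 < γ T := by
      have := hmono (left_mem_Icc.2 haT) (right_mem_Icc.2 haT) haT
      linarith
    refine lt_min hγT ?_
    obtain ⟨M, hM⟩ := isCompact_Icc.bddAbove_image (hAc.mono (Icc_subset_Ici_self : Icc a T ⊆ Ici a))
    refine aux_gron h a T M haT (hhc.mono Icc_subset_Ici_self) (by simpa [hh, hγa] using hh0) ?_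
    intro x hx
    have hx0 : 0 < x := ha.trans hx.1
    have hxl := hlt x hx.1.le
    have hd := hcl x hx.1.le (hT1 x ⟨hx.1.le, hx.2⟩).le
    have hdF := auxF_deriv (p := p) hC hx0 (by linarith) hd rfl
    have hdh := ((hasDerivAt_id x).mul hdF).sub ((hd.const_sub 1).const_mul (p-2))
    refine ⟨_, hdh, ?_⟩
    have hAM : A x ≤ M := hM ⟨x, Ioo_subset_Icc_self hx, rfl⟩
    have hhx := hT2 x ⟨hx.1.le, hx.2⟩
    have e : x * auxF C p x (γ x) = h x + (p-2) * (1 - γ x) := by simp [hh]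
    have hF : 0 ≤ auxF C p x (γ x) := by
      have : 0 < x * auxF C p x (γ x) := by
        have := mul_nonneg (sub_nonneg.2 hp) hxl.le
        linarith
      exact ((pos_iff_pos_of_mul_pos this).1 hx0).le
    change -M * h x ≤ 1 * auxF C p x (γ x) + x * (-(A x * h x) / x) - (p-2) * -(auxF C p x (γ x))
    have e2 : x * (-(A x * h x) / x) = -(A x * h x) := by field_simp
    rw [e2]
    nlinarith [mul_nonneg (sub_nonneg.2 hp) hF, mul_le_mul_of_nonneg_right hAM hhx.le]
  exact ⟨γ, hγa, fun x hx => hcl x hx (lt_min_iff.1 (hmin x hx)).1.le, fun x hx =>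
    ⟨(lt_min_iff.1 (hmin x hx)).1, by linarith [hlt x hx], (lt_min_iff.1 (hmin x hx)).2⟩⟩

/-- Existence of the special solution `γ` of the differential equation
`γ'(x) = (-1 + C(1-γ(x))γ(x)x^{p-2}) / (1 + C(1-γ(x))x^{p-1})`, `C = ((α+1)p)^p (p-1)`,
on `[1/((α+1)p), ∞)` with `γ(1/((α+1)p)) = 1 - 1/((α+1)p)`, which is non-decreasing,
concave and bounded above by `1`. -/
theorem special_ode_solution_exists
    {α p : ℝ} (hα0 : 0 < α) (hα1 : α ≤ 1) (hp : 2 ≤ p) :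
    ∃ γ : ℝ → ℝ,
      DifferentiableOn ℝ γ (Set.Ici (((α+1)*p)⁻¹)) ∧
      (∀ x : ℝ, ((α+1)*p)⁻¹ < x →
        HasDerivAt γ
          ((-1 + ((α+1)*p)^p * (p-1) * (1 - γ x) * γ x * x^(p-2)) /
            (1 + ((α+1)*p)^p * (p-1) * (1 - γ x) * x^(p-1))) x) ∧
      γ (((α+1)*p)⁻¹) = 1 - ((α+1)*p)⁻¹ ∧
      MonotoneOn γ (Set.Ici (((α+1)*p)⁻¹)) ∧
      ConcaveOn ℝ (Set.Ici (((α+1)*p)⁻¹)) γ ∧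
      (∀ x : ℝ, ((α+1)*p)⁻¹ ≤ x → γ x < 1) := by
  have hK2 : 2 < (α+1)*p := by nlinarith
  have hKe : (α+1)*p - p = α * p := by ring
  have hαp : 0 < α * p := by positivity
  generalize (α+1)*p = K at *
  have hK : 0 < K := by linarith
  have ha : 0 < K⁻¹ := inv_pos.2 hK
  have ha1 : K⁻¹ < 1 := inv_lt_one_of_one_lt₀ (by linarith)
  have hC : 0 < K^p * (p-1) := mul_pos (Real.rpow_pos_of_pos hK p) (by linarith)
  have hh0 : 0 < K⁻¹ * auxF (K^p*(p-1)) p K⁻¹ (1 - K⁻¹) - (p - 2) * (1 - (1 - K⁻¹)) := by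
    have e1 : K^p * (p-1) * K⁻¹^(p-2) = K^2 * (p-1) := by
      rw [Real.inv_rpow hK.le, Real.rpow_sub hK, Real.rpow_two]
      have := Real.rpow_pos_of_pos hK p
      field_simp
    have e2 : K^p * (p-1) * K⁻¹^(p-1) = K * (p-1) := by
      rw [Real.inv_rpow hK.le, Real.rpow_sub hK, Real.rpow_one]
      have := Real.rpow_pos_of_pos hK p
      field_simp
    have e3 : auxF (K^p*(p-1)) p K⁻¹ (1 - K⁻¹) = ((p-1)*K - p) / p := by
      rw [auxF, e1, e2]
      have h3 : 1 + K * (p-1) * (1 - (1 - K⁻¹)) = p := by field_simp; ring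
      rw [h3]
      congr 1
      field_simp
      ring
    rw [e3]
    have : K⁻¹ * (((p-1)*K - p) / p) - (p - 2) * (1 - (1 - K⁻¹)) = K⁻¹ * ((p-1)*(K-p)/p) := by
      field_simp
      ring
    rw [this, hKe]
    have : 0 < p - 1 := by linarith
    positivity
  obtain ⟨γ, hγa, hd, hprop⟩ := aux_core (K^p*(p-1)) p K⁻¹ (1 - K⁻¹) hC hp ha
    (by linarith) (by linarith) hh0
  have hF : ∀ x, K⁻¹ ≤ x → 0 ≤ auxF (K^p*(p-1)) p x (γ x) := by
    intro x hx
    obtain ⟨h1, h2, h3⟩ := hprop x hx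
    have hx0 : 0 < x := ha.trans_le hx
    have : 0 < x * auxF (K^p*(p-1)) p x (γ x) := by
      have := mul_nonneg (sub_nonneg.2 hp) (sub_nonneg.2 h2.le)
      linarith
    exact ((pos_iff_pos_of_mul_pos this).1 hx0).le
  have hdiff : DifferentiableOn ℝ γ (Ici K⁻¹) := fun x hx =>
    (hd x hx).differentiableAt.differentiableWithinAt
  have hdF : ∀ x, K⁻¹ ≤ x → HasDerivAt (fun t => auxF (K^p*(p-1)) p t (γ t)) _ x := fun x hx =>
    auxF_deriv (p := p) hC (ha.trans_le hx) (hprop x hx).2.1.le (hd x hx) rfl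
  refine ⟨γ, hdiff, ?_, hγa, ?_, ?_, fun x hx => (hprop x hx).2.1⟩
  · intro x hx
    refine (hd x hx.le).congr_deriv ?_
    rw [auxF]
    congr 1 <;> ring
  · refine monotoneOn_of_deriv_nonneg (convex_Ici _) hdiff.continuousOn
      (hdiff.mono interior_subset) ?_
    intro x hx
    have hx' : K⁻¹ ≤ x := interior_subset hx
    rw [(hd x hx').deriv]
    exact hF x hx'
  · refine AntitoneOn.concaveOn_of_deriv (convex_Ici _) hdiff.continuousOn
      (hdiff.mono interior_subset) ?_
    have hanti : AntitoneOn (fun t => auxF (K^p*(p-1)) p t (γ t)) (Ici K⁻¹) := by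
      refine antitoneOn_of_deriv_nonpos (convex_Ici _)
        (fun x hx => (hdF x hx).continuousAt.continuousWithinAt)
        (fun x hx => (hdF x (interior_subset hx)).differentiableAt.differentiableWithinAt) ?_
      intro x hx
      have hx' : K⁻¹ ≤ x := interior_subset hx
      rw [(hdF x hx').deriv]
      obtain ⟨h1, h2, h3⟩ := hprop x hx'
      have hx0 : 0 < x := ha.trans_le hx'
      have hP := Real.rpow_pos_of_pos hx0 (p-2)
      refine div_nonpos_of_nonpos_of_nonneg (neg_nonpos.2 (mul_nonneg ?_ h3.le)) hx0.le
      positivity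
    intro x hx y hy hxy
    have hx' : K⁻¹ ≤ x := interior_subset hx
    have hy' : K⁻¹ ≤ y := interior_subset hy
    rw [(hd x hx').deriv, (hd y hy').deriv]
    exact hanti hx' hy' hxy
end

section
/- Fix α ∈ (0,1] and p ≥ 2, and let γ be the special ODE solution. Then for every x > 1/((α+1)p) one has (p−2)(1−γ(x)) − x·γ'(x) ≤ 0; equivalently, x·γ'(x) ≥ (p−2)(1−γ(x)). -/
/-- Key inequality `(p-2)(1-γ(x)) - x γ'(x) ≤ 0` for the special ODE solution `γ`. -/
theorem special_ode_solution_key_inequality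
    {α p : ℝ} (hα0 : 0 < α) (hα1 : α ≤ 1) (hp : 2 ≤ p) {γ : ℝ → ℝ}
    (hγdiff : DifferentiableOn ℝ γ (Set.Ici (((α+1)*p)⁻¹)))
    (hγode : ∀ x : ℝ, ((α+1)*p)⁻¹ < x →
      HasDerivAt γ
        ((-1 + ((α+1)*p)^p * (p-1) * (1 - γ x) * γ x * x^(p-2)) /
          (1 + ((α+1)*p)^p * (p-1) * (1 - γ x) * x^(p-1))) x)
    (hγinit : γ (((α+1)*p)⁻¹) = 1 - ((α+1)*p)⁻¹)
    (hγmono : MonotoneOn γ (Set.Ici (((α+1)*p)⁻¹)))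
    (hγconc : ConcaveOn ℝ (Set.Ici (((α+1)*p)⁻¹)) γ)
    (hγlt : ∀ x : ℝ, ((α+1)*p)⁻¹ ≤ x → γ x < 1) :
    ∀ x : ℝ, ((α+1)*p)⁻¹ < x → (p-2) * (1 - γ x) - x * deriv γ x ≤ 0 := by
  intro x hx
  have hapos : 0 < (α+1)*p := by positivity
  have ha0 : 0 < ((α+1)*p)⁻¹ := inv_pos.mpr hapos
  have ha1 : ((α+1)*p)⁻¹ < 1 := by
    apply inv_lt_one_of_one_lt₀
    nlinarith
  set a := ((α+1)*p)⁻¹ with ha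
  have hx0 : 0 < x := ha0.trans hx
  have hK : 0 < ((α+1)*p)^p * (p-1) := mul_pos (Real.rpow_pos_of_pos hapos _) (by linarith)
  set K := ((α+1)*p)^p * (p-1) with hKdef
  have hγpos : 0 < γ x := by
    have := hγmono (Set.mem_Ici.2 le_rfl) (Set.mem_Ici.2 hx.le) hx.le
    linarith
  have hu : 0 < 1 - γ x := by linarith [hγlt x hx.le]
  -- the derivative is antitone
  have hanti : AntitoneOn (deriv γ) (Set.Ioi a) := by
    have h := (hγconc.subset Set.Ioi_subset_Ici_self (convex_Ioi a)).antitoneOn_deriv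
      (fun y hy => (hγode y hy).differentiableAt)
    exact h
  set d := deriv γ x with hd
  have hγx : HasDerivAt γ d x := (hγode x hx).differentiableAt.hasDerivAt
  set s : ℝ → ℝ := fun y => K * (1 - γ y) * y^(p-2) with hs
  set s' : ℝ := K * (0 - d) * x^(p-2) + K * (1 - γ x) * ((p-2) * x^(p-2-1)) with hs'
  have hsd : HasDerivAt s s' x :=
    (((hasDerivAt_const x (1:ℝ)).sub hγx).const_mul K).mul
      (Real.hasDerivAt_rpow_const (Or.inl hx0.ne'))
  have hpow : ∀ y : ℝ, 0 < y → y^(p-1) = y^(p-2) * y := by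
    intro y hy
    rw [← Real.rpow_add_one hy.ne']
    congr 1; ring
  have heq : ∀ y ∈ Set.Ioi a, deriv γ y = (-1 + s y * γ y) / (1 + s y * y) := by
    intro y hy
    rw [(hγode y hy).deriv, hpow y (ha0.trans hy)]
    simp only [hs]
    congr 1 <;> ring
  have hspos : 0 < s x := mul_pos (mul_pos hK hu) (Real.rpow_pos_of_pos hx0 _)
  have hD : 0 < 1 + s x * x := by positivity
  have hg : HasDerivAt (fun y => (-1 + s y * γ y) / (1 + s y * y))
      (((s' * γ x + s x * d) * (1 + s x * x) - (-1 + s x * γ x) * (s' * x + s x * 1))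
        / (1 + s x * x)^2) x :=
    ((hsd.mul hγx).const_add (-1)).div ((hsd.mul (hasDerivAt_id x)).const_add 1) hD.ne'
  have hdg : HasDerivAt (deriv γ)
      (((s' * γ x + s x * d) * (1 + s x * x) - (-1 + s x * γ x) * (s' * x + s x * 1))
        / (1 + s x * x)^2) x := by
    apply hg.congr_of_eventuallyEq
    filter_upwards [Ioi_mem_nhds hx] with y hy using heq y hy
  have hle := hanti.derivWithin_nonpos (x := x)
  rw [hdg.hasDerivWithinAt.derivWithin (isOpen_Ioi.uniqueDiffWithinAt hx)] at hle
  have hdx : d * (1 + s x * x) = -1 + s x * γ x := by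
    rw [hd, heq x hx]; field_simp
  have hnum : (s' * γ x + s x * d) * (1 + s x * x) - (-1 + s x * γ x) * (s' * x + s x * 1)
      = s' * (γ x + x) := by
    rw [← hdx]
    linear_combination (-s' * x) * hdx
  rw [hnum] at hle
  have hs'le : s' ≤ 0 := by
    by_contra hc
    push Not at hc
    have : 0 < s' * (γ x + x) / (1 + s x * x)^2 := by positivity
    linarith
  have hx2 : x^(p-2) = x^(p-2-1) * x := by
    rw [← Real.rpow_add_one hx0.ne']
    congr 1; ring
  have hQ : 0 < K * x^(p-2-1) := mul_pos hK (Real.rpow_pos_of_pos hx0 _)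
  have hfin : s' = (K * x^(p-2-1)) * ((p-2) * (1 - γ x) - x * d) := by
    rw [hs', hx2]; ring
  rw [hfin] at hs'le
  by_contra hc
  push Not at hc
  linarith [mul_pos hQ hc]
end

section
/- For every real p ≥ 2, α ∈ (0,1] and all non-negative reals X, Y, one has (α+1)^p·X^p ≥ ((X+Y)/(p−1))^{p−1}·((p(α+1)−1)·X − Y). -/
/-- The elementary inequality
`(α+1)^p X^p ≥ ((X+Y)/(p-1))^{p-1} ((p(α+1)-1) X - Y)` for `X, Y ≥ 0`,
`p ≥ 2`, `α ∈ (0,1]`. -/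
theorem majorization_elementary_inequality
    {α p : ℝ} (hα0 : 0 < α) (hα1 : α ≤ 1) (hp : 2 ≤ p) :
    ∀ X Y : ℝ, 0 ≤ X → 0 ≤ Y →
      ((X+Y)/(p-1))^(p-1) * ((p*(α+1)-1)*X - Y) ≤ (α+1)^p * X^p := by
  intro X Y hX hY
  have hp1 : 0 < p - 1 := by linarith
  have hp0 : 0 < p := by linarith
  have hS : 0 ≤ (X+Y)/(p-1) := by positivity
  have hR : 0 ≤ (α+1)^p * X^p := by positivity
  rcases le_total ((p*(α+1)-1)*X - Y) 0 with hZ | hZ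
  · exact (mul_nonpos_of_nonneg_of_nonpos (Real.rpow_nonneg hS _) hZ).trans hR
  · have h := Real.geom_mean_le_arith_mean2_weighted (w₁ := (p-1)/p) (w₂ := 1/p)
      (by positivity) (by positivity) hS hZ (by field_simp; ring)
    have e : (p-1)/p * ((X+Y)/(p-1)) + 1/p * ((p*(α+1)-1)*X - Y) = (α+1)*X := by
      field_simp
      ring
    rw [e] at h
    have h2 := Real.rpow_le_rpow (by positivity) h hp0.le
    rw [Real.mul_rpow (by positivity) (by positivity), ← Real.rpow_mul hS,
      ← Real.rpow_mul hZ, div_mul_cancel₀ _ hp0.ne', div_mul_cancel₀ _ hp0.ne',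
      Real.rpow_one, Real.mul_rpow (by positivity) hX] at h2
    exact h2
end
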